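/- The weakly compact reflection principle Refl_wc(κ) implies that κ is ω-weakly compact. -/

import Mathlib

open FirstOrder FirstOrder.Language ZFSet
open scoped Classical

noncomputable section

def memLang : Language where
  Functions := fun _ => Empty
  Relations := fun n => match n with | 2 => Unit | _ => Empty

def memRel : memLang.Relations 2 := Unit.unit

def mem' (n : ℕ) (i j : Fin n) : memLang.BoundedFormula Empty n :=
  Relations.boundedFormula₂ memRel (Term.var (Sum.inr i)) (Term.var (Sum.inr j))

def eq' (n : ℕ) (i j : Fin n) : memLang.BoundedFormula Empty n :=
  Term.bdEqual (Term.var (Sum.inr i)) (Term.var (Sum.inr j))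

def extAx : memLang.Sentence :=
  ((((mem' 3 2 0).iff (mem' 3 2 1)).all.imp (eq' 2 0 1)).all).all

def pairAx : memLang.Sentence :=
  ((((mem' 3 0 2) ⊓ (mem' 3 1 2)).ex).all).all

def unionAx : memLang.Sentence :=
  (((((mem' 4 2 3) ⊓ (mem' 4 3 0)).imp (mem' 4 2 1)).all.all).ex).all

def foundAx : memLang.Sentence :=
  (((mem' 2 1 0).ex.imp
    (((mem' 2 1 0) ⊓ (((mem' 3 2 1).imp (mem' 3 2 0).not).all)).ex)).all)


def infAx₁ : memLang.BoundedFormula Empty 1 :=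
  ((mem' 2 1 0) ⊓ ((mem' 3 2 1).not.all)).ex

def infAx₂ : memLang.BoundedFormula Empty 1 :=
  ((mem' 2 1 0).imp
    (((mem' 3 2 0) ⊓ ((mem' 3 1 2) ⊓
      (((mem' 4 3 2).iff ((mem' 4 3 1) ⊔ (eq' 4 3 1))).all))).ex)).all

def infAx : memLang.Sentence := (infAx₁ ⊓ infAx₂).ex

def choiceHyp₁ : memLang.BoundedFormula Empty 1 :=
  ((mem' 2 1 0).imp ((mem' 3 2 1).ex)).all

def choiceHyp₂ : memLang.BoundedFormula Empty 1 :=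
  ((((mem' 3 1 0) ⊓ ((mem' 3 2 0) ⊓ (eq' 3 1 2).not)).imp
     (((mem' 4 3 1) ⊓ (mem' 4 3 2)).ex.not)).all).all

def choiceConcl : memLang.BoundedFormula Empty 1 :=
  (((mem' 3 2 0).imp
    (((mem' 4 3 2) ⊓ ((mem' 4 3 1) ⊓
       ((((mem' 5 4 2) ⊓ (mem' 5 4 1)).imp (eq' 5 4 3)).all))).ex)).all).ex

def choiceAx : memLang.Sentence :=
  (((choiceHyp₁ ⊓ choiceHyp₂).imp choiceConcl)).all

def sepAx (n : ℕ) (φ : memLang.BoundedFormula Empty (n + 2)) : memLang.Sentence :=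
  (((((mem' (n+3) ⟨n+2, by omega⟩ ⟨n+1, by omega⟩).iff
      ((mem' (n+3) ⟨n+2, by omega⟩ ⟨n, by omega⟩) ⊓ (φ.liftAt 1 (n+1)))).all).ex).all).alls

def collAx (n : ℕ) (φ : memLang.BoundedFormula Empty (n + 3)) : memLang.Sentence :=
  (((((mem' (n+2) ⟨n+1, by omega⟩ ⟨n, by omega⟩).imp φ.ex).all).imp
    ((((mem' (n+3) ⟨n+2, by omega⟩ ⟨n, by omega⟩).imp
        (((mem' (n+4) ⟨n+3, by omega⟩ ⟨n+1, by omega⟩) ⊓ (φ.liftAt 1 (n+1))).ex)).all).ex)).all).alls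

def ZFCminus : Set memLang.Sentence :=
  {extAx, pairAx, unionAx, foundAx, infAx, choiceAx}
    ∪ (⋃ n, Set.range (sepAx n)) ∪ (⋃ n, Set.range (collAx n))

end

noncomputable section

/-! ## Satisfaction in transitive sets -/

instance zfStr (M : ZFSet.{0}) : memLang.Structure M.toSet where
  funMap := fun {_} f _ => f.elim
  RelMap := fun {n} =>
    match n with
    | 2 => fun _ v => ((v 0 : M.toSet) : ZFSet) ∈ ((v 1 : M.toSet) : ZFSet)
    | 0 => fun r _ => r.elim
    | 1 => fun r _ => r.elim
    | (_+3) => fun r _ => r.elim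

/-- Realization of a formula in the membership structure `(M, ∈)`, with a valuation
taking values in `M`. -/
def RealizeIn (M : ZFSet.{0}) {n : ℕ} (φ : memLang.BoundedFormula Empty n)
    (v : Fin n → ZFSet.{0}) : Prop :=
  ∃ hv : ∀ i, v i ∈ M, φ.Realize (fun e => e.elim) (fun i => (⟨v i, hv i⟩ : M.toSet))

/-- `M ⊨ ZFC⁻`. -/
def ModelsZFCminus (M : ZFSet.{0}) : Prop :=
  ∀ φ ∈ ZFCminus, Sentence.Realize (↥M.toSet) φ

/-! ## Cardinals, ordinals and basic combinatorial notions -/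

/-- The cardinality of (the extension of) a ZF-set. -/
def zcard (x : ZFSet.{0}) : Cardinal := Cardinal.mk x.toSet

/-- `κ` is a (von Neumann) cardinal. -/
def IsCardinalZ (κ : ZFSet.{0}) : Prop :=
  κ.IsOrdinal ∧ ∀ β ∈ κ, zcard β < zcard κ

/-- `κ^{<κ} = κ`. -/
def PowLtEqSelf (κ : ZFSet.{0}) : Prop :=
  ∀ β ∈ κ, zcard κ ^ zcard β ≤ zcard κ

def zsucc (x : ZFSet.{0}) : ZFSet := insert x x

def natZ : ℕ → ZFSet.{0}
  | 0 => ∅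
  | n+1 => zsucc (natZ n)

def iterSucc (β : ZFSet.{0}) : ℕ → ZFSet
  | 0 => β
  | n+1 => zsucc (iterSucc β n)

def IsLimitZ (α : ZFSet.{0}) : Prop := α.IsOrdinal ∧ α ≠ ∅ ∧ ∀ β ∈ α, zsucc β ∈ α

/-- The value `f(x)` of a ZF-coded function `f` at `x`. -/
def app (f x : ZFSet.{0}) : ZFSet :=
  ⋃₀ (ZFSet.sep (fun y => ZFSet.pair x y ∈ f) (⋃₀ (⋃₀ f)))

/-- The restriction `f ↾ β` of a ZF-coded function. -/
def restrictF (f β : ZFSet.{0}) : ZFSet :=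
  ZFSet.sep (fun z => ∃ ξ ∈ β, ∃ y, z = ZFSet.pair ξ y) f

/-! ## κ-models, elementary embeddings and weak compactness,
relative to an ambient class `W` of sets (`W = Set.univ` is the ground universe `V`). -/

/-- `M` is a κ-model (computed relative to the universe `W`): it is transitive, of size `κ`,
contains `κ`, is closed under `<κ`-sequences lying in `W`, and satisfies `ZFC⁻`. -/
def IsKappaModelIn (W : Set ZFSet.{0}) (κ M : ZFSet.{0}) : Prop :=
  M ∈ W ∧ κ ∈ M ∧ M.IsTransitive ∧ zcard M = zcard κ ∧
  (∀ β ∈ κ, ∀ f : ZFSet, f ∈ W → ZFSet.IsFunc β M f → f ∈ M) ∧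
  ModelsZFCminus M

abbrev IsKappaModel (κ M : ZFSet.{0}) : Prop := IsKappaModelIn Set.univ κ M

/-- `j` is an elementary embedding from `(M, ∈)` to `(N, ∈)`. -/
def IsElemEmbedding (M N : ZFSet.{0}) (j : ZFSet.{0} → ZFSet.{0}) : Prop :=
  (∀ x ∈ M, j x ∈ N) ∧
  ∀ (n : ℕ) (φ : memLang.BoundedFormula Empty n) (v : Fin n → ZFSet),
    (∀ i, v i ∈ M) → (RealizeIn M φ v ↔ RealizeIn N φ (fun i => j (v i)))

/-- `j` has critical point `κ`: it fixes every ordinal below `κ` and moves `κ`. -/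
def HasCritPoint (j : ZFSet.{0} → ZFSet.{0}) (κ : ZFSet.{0}) : Prop :=
  (∀ x ∈ κ, j x = x) ∧ κ ∈ j κ

/-- `S` is a weakly compact subset of `κ`, computed relative to the universe `W`:
for every `A ⊆ κ` in `W` there are κ-models `M ∋ A, S` and `N` and an elementary
embedding `j : M → N` with critical point `κ` such that `κ ∈ j(S)`. -/
def IsWeaklyCompactIn (W : Set ZFSet.{0}) (κ S : ZFSet.{0}) : Prop :=
  S ⊆ κ ∧ ∀ A : ZFSet, A ∈ W → A ⊆ κ →
    ∃ (M N : ZFSet) (j : ZFSet → ZFSet),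
      IsKappaModelIn W κ M ∧ IsKappaModelIn W κ N ∧ A ∈ M ∧ S ∈ M ∧
      IsElemEmbedding M N j ∧ HasCritPoint j κ ∧ κ ∈ j S

abbrev IsWeaklyCompactSubset (κ S : ZFSet.{0}) : Prop := IsWeaklyCompactIn Set.univ κ S

/-- `κ` is a weakly compact cardinal (relative to the universe `W`). -/
def IsWCCardinalIn (W : Set ZFSet.{0}) (κ : ZFSet.{0}) : Prop :=
  IsCardinalZ κ ∧ PowLtEqSelf κ ∧ IsWeaklyCompactIn W κ κ

abbrev IsWCCardinal (κ : ZFSet.{0}) : Prop := IsWCCardinalIn Set.univ κ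

/-! ## Clubs, stationarity, inaccessibility, Mahloness -/

/-- `C` is a closed unbounded subset of the ordinal `γ`. -/
def IsClubIn (C γ : ZFSet.{0}) : Prop :=
  C ⊆ γ ∧ (∀ ξ ∈ γ, ∃ η ∈ C, ξ ∈ η ∨ ξ = η) ∧
  ∀ β ∈ γ, (∃ ξ, ξ ∈ β) → (∀ ξ ∈ β, ∃ η, η ∈ C ∧ η ∈ β ∧ ξ ∈ η) → β ∈ C

/-- `S` is a stationary subset of `γ`, relative to the universe `W`. -/
def IsStationaryIn (W : Set ZFSet.{0}) (S γ : ZFSet.{0}) : Prop :=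
  ∀ C : ZFSet, C ∈ W → IsClubIn C γ → ∃ x, x ∈ S ∧ x ∈ C

/-- `γ` is a regular cardinal, relative to the universe `W`. -/
def IsRegularIn (W : Set ZFSet.{0}) (γ : ZFSet.{0}) : Prop :=
  IsCardinalZ γ ∧
  ∀ β ∈ γ, ∀ f : ZFSet, f ∈ W → ZFSet.IsFunc β γ f →
    ∃ δ ∈ γ, ∀ ξ ∈ β, ∀ y, ZFSet.pair ξ y ∈ f → y ∈ δ

/-- `γ` is an inaccessible cardinal (regular, uncountable strong limit),
relative to the universe `W`. -/
def IsInaccessibleIn (W : Set ZFSet.{0}) (γ : ZFSet.{0}) : Prop :=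
  IsRegularIn W γ ∧ ZFSet.omega ∈ γ ∧
  ∀ β ∈ γ, ¬ ∃ f : ZFSet, f ∈ W ∧ ZFSet.IsFunc γ (ZFSet.powerset β) f ∧
    (∀ x x' y, ZFSet.pair x y ∈ f → ZFSet.pair x' y ∈ f → x = x')

/-- `γ` is a Mahlo cardinal: it is inaccessible and the inaccessibles below it
are stationary, relative to the universe `W`. -/
def IsMahloIn (W : Set ZFSet.{0}) (γ : ZFSet.{0}) : Prop :=
  IsInaccessibleIn W γ ∧
  IsStationaryIn W (ZFSet.sep (fun β => IsInaccessibleIn W β) γ) γ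

/-- `C` is 1-closed in `κ`: it contains every inaccessible `γ < κ` in which `C ∩ γ`
is stationary (relative to the universe `W`). -/
def IsOneClosedIn (W : Set ZFSet.{0}) (C κ : ZFSet.{0}) : Prop :=
  ∀ γ ∈ κ, IsInaccessibleIn W γ → IsStationaryIn W (C ∩ γ) γ → γ ∈ C

/-- `C` is 1-club in `κ`: stationary and 1-closed (relative to the universe `W`). -/
def IsOneClubIn (W : Set ZFSet.{0}) (C κ : ZFSet.{0}) : Prop :=
  IsStationaryIn W C κ ∧ IsOneClosedIn W C κ

/-! ## Traces and higher orders of weak compactness -/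

/-- The weakly compact trace operation. -/
def wcTraceIn (W : Set ZFSet.{0}) (κ X : ZFSet.{0}) : ZFSet :=
  ZFSet.sep (fun γ => IsWeaklyCompactIn W γ (X ∩ γ)) κ

/-- Finite iterates of the weakly compact trace operation (on the canonical
representatives of the classes `[X]₁`). -/
def iterWcTraceIn (W : Set ZFSet.{0}) (κ : ZFSet.{0}) : ℕ → ZFSet.{0} → ZFSet.{0}
  | 0, X => X
  | n+1, X => wcTraceIn W κ (iterWcTraceIn W κ n X)

/-- `κ` is an `n`-weakly compact cardinal (relative to the universe `W`):
all iterates `Tr^m_{wc}([κ]₁)` for `m < n` are nonzero, i.e. weakly compact. -/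
def IsNWeaklyCompactIn (W : Set ZFSet.{0}) (κ : ZFSet.{0}) (n : ℕ) : Prop :=
  ∀ m < n, IsWeaklyCompactIn W κ (iterWcTraceIn W κ m κ)

/-- `κ` is an `ω`-weakly compact cardinal (relative to the universe `W`). -/
def IsOmegaWeaklyCompactIn (W : Set ZFSet.{0}) (κ : ZFSet.{0}) : Prop :=
  ∀ n : ℕ, IsWeaklyCompactIn W κ (iterWcTraceIn W κ n κ)

/-- `S^β_n`: the Mahlo cardinals below `β` for `n = 0`, and the `n`-weakly compact
cardinals below `β` for `n > 0` (relative to the universe `W`). -/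
def SsetIn (W : Set ZFSet.{0}) (β : ZFSet.{0}) : ℕ → ZFSet
  | 0 => ZFSet.sep (fun α => IsMahloIn W α) β
  | n+1 => ZFSet.sep (fun α => IsNWeaklyCompactIn W α (n+1)) β

/-- The weakly compact reflection principle `Refl_wc(κ)` (relative to the universe `W`):
`κ` is weakly compact and every weakly compact subset of `κ` has a weakly compact
proper initial segment. -/
def ReflWcIn (W : Set ZFSet.{0}) (κ : ZFSet.{0}) : Prop :=
  IsWCCardinalIn W κ ∧
  ∀ S : ZFSet, S ∈ W → IsWeaklyCompactIn W κ S → ∃ γ ∈ κ, IsWeaklyCompactIn W γ (S ∩ γ)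

end

noncomputable section

/-! ## Forcing notions, generic filters, names and generic extensions -/

/-- The order of a ZF-coded partial order: `p ≤ q` iff `(p, q) ∈ R`. -/
def zle (R p q : ZFSet.{0}) : Prop := ZFSet.pair p q ∈ R

/-- `(P, R)` is a ZF-coded partial order (a forcing notion). -/
def IsPosetOn (P R : ZFSet.{0}) : Prop :=
  R ⊆ ZFSet.prod P P ∧ (∀ p ∈ P, zle R p p) ∧
  ∀ p q r : ZFSet, zle R p q → zle R q r → zle R p r

/-- `D` is a dense subset of the forcing notion `(P, R)`. -/
def IsDenseIn (P R D : ZFSet.{0}) : Prop :=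
  D ⊆ P ∧ ∀ p ∈ P, ∃ q ∈ D, zle R q p

/-- `G` (a class of conditions) is a filter on `(P, R)`. -/
def IsClassFilterOn (P R : ZFSet.{0}) (G : Set ZFSet.{0}) : Prop :=
  (∀ p ∈ G, p ∈ P) ∧ (∀ p ∈ G, ∀ q, q ∈ P → zle R p q → q ∈ G) ∧
  ∀ p ∈ G, ∀ q ∈ G, ∃ r, r ∈ G ∧ zle R r p ∧ zle R r q

/-- `G` is generic over the universe `V` for `(P, R)`: it is a filter meeting every
dense subset of `P` (lying in `V`). -/
def IsGenericOverV (P R : ZFSet.{0}) (G : Set ZFSet.{0}) : Prop :=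
  IsClassFilterOn P R G ∧ ∀ D : ZFSet, IsDenseIn P R D → ∃ q, q ∈ G ∧ q ∈ D

/-- `G` is generic for `(P, R)` over the class `W`: it is a filter meeting every
dense subset of `P` lying in `W`. -/
def IsGenericOverClass (W : Set ZFSet.{0}) (P R : ZFSet.{0}) (G : Set ZFSet.{0}) : Prop :=
  IsClassFilterOn P R G ∧ ∀ D : ZFSet, D ∈ W → IsDenseIn P R D → ∃ q, q ∈ G ∧ q ∈ D

/-- A ZF-coded filter on `(P, R)`. -/
def IsSetFilterOn (P R G : ZFSet.{0}) : Prop :=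
  G ⊆ P ∧ (∀ p ∈ G, ∀ q ∈ P, zle R p q → q ∈ G) ∧
  ∀ p ∈ G, ∀ q ∈ G, ∃ r ∈ G, zle R r p ∧ zle R r q

/-- `G` is a filter on `(P, R)` generic over the (set) model `M`. -/
def IsGenericOverSet (M P R G : ZFSet.{0}) : Prop :=
  IsSetFilterOn P R G ∧ ∀ D : ZFSet, D ∈ M → IsDenseIn P R D → ∃ q ∈ G, q ∈ D

/-- The image of a ZF-set under an arbitrary (class) function. -/
def myImage (f : ZFSet.{0} → ZFSet.{0}) (x : ZFSet.{0}) : ZFSet.{0} :=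
  ZFSet.range.{0,0} (fun a : (Quotient.out x).Type => f (ZFSet.mk ((Quotient.out x).Func a)))

/-- The evaluation `val_G(τ)` of a `P`-name `τ` by a filter `G`
(every ZF-set is regarded as a name). -/
def zval (G : Set ZFSet.{0}) : ZFSet.{0} → ZFSet.{0} :=
  (ZFSet.mem_wf.transGen).fix (fun τ rec =>
    myImage (fun σ => if h : Relation.TransGen (· ∈ ·) σ τ then rec σ h else ∅)
      (ZFSet.sep (fun σ => ∃ p, p ∈ G ∧ ZFSet.pair σ p ∈ τ) (⋃₀ (⋃₀ τ : ZFSet))))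

/-- The generic extension `V[G]` of the universe, as a class: all evaluations of names. -/
def VofG (G : Set ZFSet.{0}) : Set ZFSet.{0} := Set.range (zval G)

/-- The generic extension `M[G]` of a set model `M` by a class filter `G`:
the evaluations of all names lying in `M`. -/
def extClass (M : ZFSet.{0}) (G : Set ZFSet.{0}) : ZFSet.{0} := myImage (zval G) M

/-- The generic extension `M[G]` of a set model `M` by a set filter `G`. -/
def extSet (M G : ZFSet.{0}) : ZFSet.{0} := extClass M {x | x ∈ G}

/-- The check-name `x̌` of a ground model set `x` (relative to the forcing `P`). -/
def checkName (P : ZFSet.{0}) : ZFSet.{0} → ZFSet.{0} :=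
  ZFSet.mem_wf.fix (fun x rec =>
    ⋃₀ (myImage (fun y => if h : y ∈ x then myImage (fun p => ZFSet.pair (rec y h) p) P else ∅) x))

/-- The canonical name `Ġ` for the generic filter. -/
def genName (P : ZFSet.{0}) : ZFSet.{0} :=
  myImage (fun p => ZFSet.pair (checkName P p) p) P

/-- The ground model `V`, as a class. -/
def GroundV : Set ZFSet.{0} := Set.univ

/-- `(P, R)` is `κ`-c.c.: every antichain has size `< κ`. -/
def IsKappaCC (P R κ : ZFSet.{0}) : Prop :=
  ∀ A : ZFSet, A ⊆ P →
    (∀ p ∈ A, ∀ q ∈ A, p ≠ q → ¬ ∃ r ∈ P, zle R r p ∧ zle R r q) →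
    zcard A < zcard κ

/-! ## Games and strategic closure -/

/-- It is Player II's turn at stage `α`: `α` is a limit ordinal, or of the form `λ + (2n+1)`
(Player I moves first, at stage `0`, and Player II plays first at limit stages). -/
def IsIITurn (α : ZFSet.{0}) : Prop :=
  IsLimitZ α ∨ ∃ (β : ZFSet) (n : ℕ), (β = ∅ ∨ IsLimitZ β) ∧ α = iterSucc β (2*n+1)

/-- `f` is a ZF-coded descending sequence of conditions of `(P, R)` of length `α`. -/
def IsDescPlay (P R α f : ZFSet.{0}) : Prop :=
  ZFSet.IsFunc α P f ∧ ∀ β ∈ α, ∀ γ ∈ β, zle R (app f β) (app f γ)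

/-- `s` is (the graph of) a deterministic strategy. -/
def IsFunctionLike (s : ZFSet.{0}) : Prop :=
  ∀ x y y', ZFSet.pair x y ∈ s → ZFSet.pair x y' ∈ s → y = y'

/-- `s` is a winning strategy for Player II in the game `G_δ(P)`: along any descending play
(lying in the universe `W`) in which Player II has followed `s`, when it is Player II's turn
`s` provides a condition below all conditions played so far. -/
def IsWinningStratII (W : Set ZFSet.{0}) (P R δ s : ZFSet.{0}) : Prop :=
  ∀ α ∈ δ, ∀ f : ZFSet, f ∈ W → IsDescPlay P R α f →
    (∀ β ∈ α, IsIITurn β → ZFSet.pair (restrictF f β) (app f β) ∈ s) →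
    IsIITurn α →
    ∃ q, ZFSet.pair (restrictF f α) q ∈ s ∧ q ∈ P ∧ ∀ γ ∈ α, zle R q (app f γ)

/-- `(P, R)` is `δ`-strategically closed, relative to the universe `W`:
Player II has a winning strategy in the game of length `δ`. -/
def IsStratClosedIn (W : Set ZFSet.{0}) (P R δ : ZFSet.{0}) : Prop :=
  ∃ s, s ∈ W ∧ IsFunctionLike s ∧ IsWinningStratII W P R δ s

/-- `(P, R)` is `<κ`-strategically closed relative to `W`. -/
def IsLtStratClosedIn (W : Set ZFSet.{0}) (P R κ : ZFSet.{0}) : Prop :=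
  ∀ δ ∈ κ, IsStratClosedIn W P R δ

/-- `(P, R)` is `α⁺`-closed: every descending sequence of length `< α⁺`
(i.e. of length an ordinal of size `≤ |α|`) has a lower bound in `P`. -/
def IsSuccCardClosed (P R α : ZFSet.{0}) : Prop :=
  ∀ β : ZFSet, β.IsOrdinal → zcard β ≤ zcard α →
    ∀ f : ZFSet, IsDescPlay P R β f → ∃ q ∈ P, ∀ γ ∈ β, zle R q (app f γ)

/-! ## The 1-club shooting forcing `T¹(X)` -/

/-- `c` is bounded below `κ`. -/
def IsBoundedBelow (c κ : ZFSet.{0}) : Prop := ∃ β ∈ κ, c ⊆ β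

/-- The poset `T¹(X)` of bounded 1-closed subsets of `X ⊆ κ`, relative to the universe `W`. -/
def T1In (W : Set ZFSet.{0}) (κ X : ZFSet.{0}) : ZFSet :=
  ZFSet.sep (fun c => c ∈ W ∧ IsBoundedBelow c κ ∧ IsOneClosedIn W c κ) (ZFSet.powerset X)

abbrev T1 (κ X : ZFSet.{0}) : ZFSet := T1In Set.univ κ X

/-- `c₁` end-extends `c₂` (i.e. `c₁ ≤ c₂` in `T¹(X)`). -/
def IsEndExtension (c₁ c₂ : ZFSet.{0}) : Prop :=
  c₂ ⊆ c₁ ∧ ∀ x ∈ c₁, x ∉ c₂ → ∀ y ∈ c₂, y ∈ x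

/-- The end-extension order on `T¹(X)`, as a ZF-coded relation. -/
def T1OrderIn (W : Set ZFSet.{0}) (κ X : ZFSet.{0}) : ZFSet :=
  ZFSet.pairSep (fun c₁ c₂ => IsEndExtension c₁ c₂) (T1In W κ X) (T1In W κ X)

abbrev T1Order (κ X : ZFSet.{0}) : ZFSet := T1OrderIn Set.univ κ X

end

noncomputable section

/-! ## The von Neumann hierarchy -/

/-- The von Neumann hierarchy `V_α` (for `α` an ordinal): `V_x = ⋃_{y ∈ x} 𝒫(V_y)`. -/
def Vrank : ZFSet.{0} → ZFSet.{0} :=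
  ZFSet.mem_wf.fix (fun x rec =>
    ⋃₀ (myImage (fun y => if h : y ∈ x then ZFSet.powerset (rec y h) else ∅) x))

/-! ## Π¹₁-indescribability -/

/-- The language with a membership relation and two unary predicates
(for the parameter `A` and a second-order variable `X`). -/
def memLang2 : Language where
  Functions := fun _ => Empty
  Relations := fun n => match n with | 1 => Fin 2 | 2 => Unit | _ => Empty

/-- The structure `(Vκ, ∈, A, B)`. -/
def str2 (Vk A B : ZFSet.{0}) : memLang2.Structure (↥Vk.toSet) where
  funMap := fun {_} f _ => f.elim
  RelMap := fun {n} =>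
    match n with
    | 1 => fun (r : Fin 2) v => if r = 0 then (((v 0 : Vk.toSet) : ZFSet) ∈ A)
                      else (((v 0 : Vk.toSet) : ZFSet) ∈ B)
    | 2 => fun _ v => ((v 0 : Vk.toSet) : ZFSet) ∈ ((v 1 : Vk.toSet) : ZFSet)
    | 0 => fun r _ => r.elim
    | (_+3) => fun r _ => r.elim

/-- `(Vk, ∈, A) ⊨ ∀X ψ(X)`: the Π¹₁-sentence with first-order matrix `ψ` holds in
`(Vk, ∈, A)`, where the second-order universal quantifier ranges over all subsets of `Vk`. -/
def SatisfiesPi11 (Vk A : ZFSet.{0}) (ψ : memLang2.Sentence) : Prop :=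
  ∀ B : ZFSet, B ⊆ Vk → @Sentence.Realize memLang2 _ (str2 Vk A B) ψ

/-! ## Products of 1-club shooting forcings, and lottery sums -/

/-- The ZF-coded set `[m, ω)` of natural numbers `≥ m`. -/
def omegaFrom (m : ℕ) : ZFSet.{0} :=
  ZFSet.sep (fun n => natZ m ⊆ n) ZFSet.omega

/-- The product `∏_{n ∈ [m, ω)} T¹(γ \ S^γ_n)`, computed relative to the universe `W`. -/
def prodT1In (W : Set ZFSet.{0}) (γ : ZFSet.{0}) (m : ℕ) : ZFSet :=
  ZFSet.sep
    (fun f => f ∈ W ∧ ZFSet.IsFunc (omegaFrom m) (ZFSet.powerset γ) f ∧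
      ∀ n : ℕ, m ≤ n → app f (natZ n) ∈ T1In W γ (γ \ SsetIn W γ n))
    (ZFSet.powerset (ZFSet.prod (omegaFrom m) (ZFSet.powerset γ)))

/-- The (pointwise end-extension) order on the product. -/
def prodT1Le (f g : ZFSet.{0}) (m : ℕ) : Prop :=
  ∀ n : ℕ, m ≤ n → IsEndExtension (app f (natZ n)) (app g (natZ n))

/-- The lottery sum `⊕_{m<ω} ∏_{n ∈ [m,ω)} T¹(γ \ S^γ_n)`, relative to the universe `W`;
`∅` serves as the top element `1`. -/
def lotterySumIn (W : Set ZFSet.{0}) (γ : ZFSet.{0}) : ZFSet :=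
  insert ∅ (ZFSet.sep
    (fun z => ∃ (m : ℕ) (f : ZFSet), z = ZFSet.pair (natZ m) f ∧ f ∈ prodT1In W γ m)
    (ZFSet.prod ZFSet.omega (ZFSet.powerset (ZFSet.prod ZFSet.omega (ZFSet.powerset γ)))))

/-- The order on the lottery sum: everything is below the top `∅`, and
`(m, f) ≤ (m', g)` iff `m = m'` and `f ≤ g` pointwise. -/
def lotteryLeIn (W : Set ZFSet.{0}) (γ : ZFSet.{0}) (a b : ZFSet.{0}) : Prop :=
  b = ∅ ∨ ∃ (m : ℕ) (f g : ZFSet), a = ZFSet.pair (natZ m) f ∧ b = ZFSet.pair (natZ m) g ∧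
    f ∈ prodT1In W γ m ∧ g ∈ prodT1In W γ m ∧ prodT1Le f g m

/-- The order on the lottery sum, as a ZF-coded relation. -/
def lotteryOrderIn (W : Set ZFSet.{0}) (γ : ZFSet.{0}) : ZFSet :=
  ZFSet.pairSep (fun a b => lotteryLeIn W γ a b) (lotterySumIn W γ) (lotterySumIn W γ)

/-! ## Easton-support iterations -/

/-- `p` is a ZF-coded function with domain `α`. -/
def IsFuncWithDomain (p α : ZFSet.{0}) : Prop := ∃ y : ZFSet, ZFSet.IsFunc α y p

/-- `p` (a condition of an iteration of length `α`) has Easton support: its support is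
bounded below every inaccessible `δ ≤ α` (stages where `p` takes the trivial value `∅`
are outside the support). -/
def HasEastonSupport (p α : ZFSet.{0}) : Prop :=
  ∀ δ : ZFSet, IsInaccessibleIn Set.univ δ → (δ ∈ α ∨ δ = α) →
    ∃ β ∈ δ, ∀ ξ ∈ δ, app p ξ ≠ ∅ → ξ ∈ β

/-- The restriction of a class filter `G` on an iteration to the first `β` stages. -/
def resFilter (G : Set ZFSet.{0}) (β : ZFSet.{0}) : Set ZFSet.{0} :=
  {q | ∃ p, p ∈ G ∧ q = restrictF p β}

/-- `⟨(P_α, Q̇_α) : α < κ⟩` is an Easton-support forcing iteration (described by the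
cumulative sequence of initial segments `Pseq α` with orders `Rseq α`, whose conditions
are functions with domain `α` and Easton support, coherent under restriction). -/
structure IsEastonIteration (κ : ZFSet.{0}) (Pseq Rseq : ZFSet.{0} → ZFSet.{0}) : Prop where
  isOrd : κ.IsOrdinal
  poset : ∀ α : ZFSet, α.IsOrdinal → (α ∈ κ ∨ α = κ) → IsPosetOn (Pseq α) (Rseq α)
  conds : ∀ α : ZFSet, α.IsOrdinal → (α ∈ κ ∨ α = κ) →
    ∀ p ∈ Pseq α, IsFuncWithDomain p α ∧ HasEastonSupport p α
  coherMem : ∀ α : ZFSet, α.IsOrdinal → (α ∈ κ ∨ α = κ) →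
    ∀ β ∈ α, ∀ p ∈ Pseq α, restrictF p β ∈ Pseq β
  coherLe : ∀ α : ZFSet, α.IsOrdinal → (α ∈ κ ∨ α = κ) →
    ∀ β ∈ α, ∀ p ∈ Pseq α, ∀ q ∈ Pseq α,
      zle (Rseq α) p q → zle (Rseq β) (restrictF p β) (restrictF q β)
  genRes : ∀ α : ZFSet, α.IsOrdinal → (α ∈ κ ∨ α = κ) → ∀ β ∈ α,
    ∀ G : Set ZFSet, IsGenericOverV (Pseq α) (Rseq α) G →
      IsGenericOverV (Pseq β) (Rseq β) (resFilter G β)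

/-- The main iteration of the paper: the Easton-support iteration which, at each stage
`γ < κ` that is Mahlo in `V`, forces with the lottery sum
`⊕_{m<ω} ∏_{n ∈ [m,ω)} T¹(γ \ S^γ_n)` as computed in `V^{P_γ}`, and trivially at
other stages.  The stage-`γ` behaviour is described by evaluating the stage-`γ`
components of conditions by a generic for the first `γ` stages. -/
structure IsMainIteration (κ : ZFSet.{0}) (Pseq Rseq : ZFSet.{0} → ZFSet.{0})
    extends IsEastonIteration κ Pseq Rseq : Prop where
  trivialStage : ∀ γ ∈ κ, ¬ IsMahloIn Set.univ γ → ∀ p ∈ Pseq κ, app p γ = ∅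
  lotteryStage : ∀ γ ∈ κ, IsMahloIn Set.univ γ →
    ∀ G : Set ZFSet, IsGenericOverV (Pseq γ) (Rseq γ) G →
      (∀ p ∈ Pseq (zsucc γ), zval G (app p γ) ∈ lotterySumIn (VofG G) γ) ∧
      (∀ q ∈ lotterySumIn (VofG G) γ, ∃ p ∈ Pseq (zsucc γ), zval G (app p γ) = q) ∧
      (∀ p ∈ Pseq (zsucc γ), ∀ q ∈ Pseq (zsucc γ), zle (Rseq (zsucc γ)) p q →
        zle (lotteryOrderIn (VofG G) γ) (zval G (app p γ)) (zval G (app q γ)))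

/-- An Easton-support iteration all of whose stages are (forced to be)
`α`-strategically closed. -/
structure IsStratClosedIteration (κ : ZFSet.{0}) (Pseq Rseq : ZFSet.{0} → ZFSet.{0})
    extends IsEastonIteration κ Pseq Rseq : Prop where
  stageClosed : ∀ α ∈ κ,
    ∀ G : Set ZFSet, IsGenericOverV (Pseq α) (Rseq α) G →
      ∃ Q R' : ZFSet, Q ∈ VofG G ∧ R' ∈ VofG G ∧ IsPosetOn Q R' ∧
        IsStratClosedIn (VofG G) Q R' α ∧
        (∀ p ∈ Pseq (zsucc α), zval G (app p α) ∈ Q) ∧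
        (∀ q ∈ Q, ∃ p ∈ Pseq (zsucc α), zval G (app p α) = q) ∧
        (∀ p ∈ Pseq (zsucc α), ∀ q ∈ Pseq (zsucc α), zle (Rseq (zsucc α)) p q →
          zle R' (zval G (app p α)) (zval G (app q α)))

end

noncomputable section

/-! ## Miscellaneous auxiliary notions used in the statements -/

/-- `M` is an elementary substructure of `(H, ∈)`. -/
def IsElemSubstructure (M H : ZFSet.{0}) : Prop :=
  M ⊆ H ∧ ∀ (n : ℕ) (φ : memLang.BoundedFormula Empty n) (v : Fin n → ZFSet),
    (∀ i, v i ∈ M) → (RealizeIn M φ v ↔ RealizeIn H φ v)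

/-- `H = H_{κ⁺}`: the sets whose transitive closure has size at most `κ`. -/
def IsHkappaPlus (κ H : ZFSet.{0}) : Prop :=
  ∀ x : ZFSet, x ∈ H ↔ ∃ t : ZFSet, x ⊆ t ∧ t.IsTransitive ∧ zcard t ≤ zcard κ

/-- `I` is a (proper) ideal on `lam`. -/
def IsIdealOn (lam I : ZFSet.{0}) : Prop :=
  (∀ X ∈ I, X ⊆ lam) ∧ ∅ ∈ I ∧ lam ∉ I ∧
  (∀ X ∈ I, ∀ Y : ZFSet, Y ⊆ X → Y ∈ I) ∧
  (∀ X ∈ I, ∀ Y ∈ I, X ∪ Y ∈ I)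

/-- `I` is `lam`-complete: it is closed under unions of fewer than `lam` members. -/
def IsLamCompleteIdeal (lam I : ZFSet.{0}) : Prop :=
  ∀ x : ZFSet, x ⊆ I → zcard x < zcard lam → (⋃₀ x : ZFSet) ∈ I

/-- `I` is a normal `lam`-complete (proper) ideal on `lam`: every regressive ZF-coded
function on an `I`-positive set is constant on an `I`-positive set. -/
def IsNormalIdealOn (lam I : ZFSet.{0}) : Prop :=
  IsIdealOn lam I ∧ IsLamCompleteIdeal lam I ∧
  ∀ S : ZFSet, S ⊆ lam → S ∉ I →
    ∀ f : ZFSet, ZFSet.IsFunc S lam f → (∀ α ∈ S, α ≠ ∅ → app f α ∈ α) →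
      ∃ β ∈ lam, ZFSet.sep (fun α => ZFSet.pair α β ∈ f) S ∉ I

/-- The pair `(W, V)` has the `δ`-approximation property. -/
def HasApproxProperty (W : Set ZFSet.{0}) (δ : ZFSet.{0}) : Prop :=
  ∀ A : ZFSet, (∀ a ∈ A, a ∈ W) →
    (∀ a : ZFSet, a ∈ W → zcard a < zcard δ → A ∩ a ∈ W) → A ∈ W

/-- The pair `(W, V)` has the `δ`-cover property. -/
def HasCoverProperty (W : Set ZFSet.{0}) (δ : ZFSet.{0}) : Prop :=
  ∀ A : ZFSet, (∀ a ∈ A, a ∈ W) → zcard A < zcard δ →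
    ∃ B : ZFSet, B ∈ W ∧ A ⊆ B ∧ zcard B < zcard δ

/-- The dense set `D_α = {c ∈ T¹(X) : sup c > α⁺}` (a set `c` has `sup c > α⁺` iff it
contains an ordinal of cardinality greater than `|α|`). -/
def DsetT1 (κ X α : ZFSet.{0}) : ZFSet :=
  ZFSet.sep (fun c => ∃ ξ ∈ c, zcard α < zcard ξ) (T1 κ X)

/-- The `1`-club `C = ⋃ {f(m) : f ∈ I_γ}` added by the product selected by the lottery
held at stage `γ` of the main iteration. -/
def stageClub (G : Set ZFSet.{0}) (γ : ZFSet.{0}) (m : ℕ) : ZFSet :=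
  ZFSet.sep (fun ξ => ∃ p, p ∈ G ∧ ∃ f : ZFSet,
    zval (resFilter G γ) (app p γ) = ZFSet.pair (natZ m) f ∧ ξ ∈ app f (natZ m)) γ

end

/-! ## Relations on transitive sets definable by first-order formulas -/

/-- `R` is uniformly definable over transitive sets. -/
class Dfn (n : ℕ) (R : ZFSet.{0} → (Fin n → ZFSet.{0}) → Prop) : Prop where
  out : ∃ φ : memLang.BoundedFormula Empty n, ∀ M : ZFSet.{0}, M.IsTransitive →
    ∀ w : Fin n → M.toSet, φ.Realize (fun e => e.elim) w ↔ R M (fun i => (w i).1)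

theorem Dfn.congr {n : ℕ} {R R' : ZFSet.{0} → (Fin n → ZFSet.{0}) → Prop} (h : Dfn n R)
    (hR : ∀ M : ZFSet.{0}, M.IsTransitive → ∀ v : Fin n → ZFSet.{0}, (∀ i, v i ∈ M) →
      (R' M v ↔ R M v)) : Dfn n R' := by
  obtain ⟨φ, hφ⟩ := h.out
  exact ⟨φ, fun M hM w => (hφ M hM w).trans (hR M hM _ fun i => (w i).2).symm⟩

theorem realize_mem' {M : ZFSet.{0}} {n : ℕ} (i j : Fin n) (w : Fin n → M.toSet) :
    (mem' n i j).Realize (fun e => e.elim) w ↔ (w i).1 ∈ (w j).1 := by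
  simp only [mem', BoundedFormula.realize_rel₂]
  rfl

theorem realize_eq' {M : ZFSet.{0}} {n : ℕ} (i j : Fin n) (w : Fin n → M.toSet) :
    (eq' n i j).Realize (fun e => e.elim) w ↔ (w i).1 = (w j).1 := by
  simp [eq', BoundedFormula.realize_bdEqual, Subtype.ext_iff]

instance Dfn.mem {n : ℕ} (i j : Fin n) : Dfn n (fun _ v => v i ∈ v j) :=
  ⟨mem' n i j, fun _ _ w => realize_mem' i j w⟩

instance Dfn.eq {n : ℕ} (i j : Fin n) : Dfn n (fun _ v => v i = v j) :=
  ⟨eq' n i j, fun _ _ w => realize_eq' i j w⟩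

instance (priority := low) Dfn.const {n : ℕ} (p : Prop) : Dfn n (fun _ _ => p) := by
  by_cases hp : p
  · exact ⟨⊤, by simp [hp]⟩
  · exact ⟨⊥, by simp [hp]⟩

section

variable {n : ℕ} {P Q : ZFSet.{0} → (Fin n → ZFSet.{0}) → Prop}

instance Dfn.not [hP : Dfn n P] : Dfn n (fun M v => ¬ P M v) := by
  obtain ⟨φ, hφ⟩ := hP.out
  exact ⟨φ.not, fun M hM w => by rw [BoundedFormula.realize_not, hφ M hM]⟩

instance Dfn.imp [hP : Dfn n P] [hQ : Dfn n Q] : Dfn n (fun M v => P M v → Q M v) := by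
  obtain ⟨φ, hφ⟩ := hP.out
  obtain ⟨ψ, hψ⟩ := hQ.out
  exact ⟨φ.imp ψ, fun M hM w => by rw [BoundedFormula.realize_imp, hφ M hM, hψ M hM]⟩

instance Dfn.and [hP : Dfn n P] [hQ : Dfn n Q] : Dfn n (fun M v => P M v ∧ Q M v) := by
  obtain ⟨φ, hφ⟩ := hP.out
  obtain ⟨ψ, hψ⟩ := hQ.out
  exact ⟨φ ⊓ ψ, fun M hM w => by rw [BoundedFormula.realize_inf, hφ M hM, hψ M hM]⟩

instance Dfn.or [hP : Dfn n P] [hQ : Dfn n Q] : Dfn n (fun M v => P M v ∨ Q M v) := by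
  obtain ⟨φ, hφ⟩ := hP.out
  obtain ⟨ψ, hψ⟩ := hQ.out
  exact ⟨φ ⊔ ψ, fun M hM w => by rw [BoundedFormula.realize_sup, hφ M hM, hψ M hM]⟩

instance Dfn.iff [hP : Dfn n P] [hQ : Dfn n Q] : Dfn n (fun M v => P M v ↔ Q M v) := by
  obtain ⟨φ, hφ⟩ := hP.out
  obtain ⟨ψ, hψ⟩ := hQ.out
  exact ⟨φ.iff ψ, fun M hM w => by rw [BoundedFormula.realize_iff, hφ M hM, hψ M hM]⟩

instance Dfn.finForall {k : ℕ} {P : Fin k → ZFSet.{0} → (Fin n → ZFSet.{0}) → Prop}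
    [hP : ∀ l, Dfn n (P l)] : Dfn n (fun M v => ∀ l, P l M v) := by
  choose φ hφ using fun l => (hP l).out
  refine ⟨BoundedFormula.iInf φ, fun M hM w => ?_⟩
  rw [BoundedFormula.realize_iInf]
  exact forall_congr' fun l => hφ l M hM w

variable {R : ZFSet.{0} → (Fin n → ZFSet.{0}) → ZFSet.{0} → Prop}

theorem Dfn.snoc_eq {M : ZFSet.{0}} (w : Fin n → M.toSet) (a : M.toSet) :
    (fun i => ((Fin.snoc w a : Fin (n + 1) → M.toSet) (Fin.castSucc i)).1) = fun i => (w i).1 := by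
  funext i
  simp

instance Dfn.all [hR : Dfn (n + 1) (fun M u => R M (fun i => u i.castSucc) (u (Fin.last n)))] :
    Dfn n (fun M v => ∀ x, x ∈ M → R M v x) := by
  obtain ⟨φ, hφ⟩ := hR.out
  refine ⟨φ.all, fun M hM w => ?_⟩
  rw [BoundedFormula.realize_all]
  simp only [hφ M hM, Dfn.snoc_eq, Fin.snoc_last]
  exact ⟨fun h x hx => h ⟨x, hx⟩, fun h x => h x.1 x.2⟩

instance Dfn.ex [hR : Dfn (n + 1) (fun M u => R M (fun i => u i.castSucc) (u (Fin.last n)))] :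
    Dfn n (fun M v => ∃ x, x ∈ M ∧ R M v x) := by
  obtain ⟨φ, hφ⟩ := hR.out
  refine ⟨φ.ex, fun M hM w => ?_⟩
  rw [BoundedFormula.realize_ex]
  simp only [hφ M hM, Dfn.snoc_eq, Fin.snoc_last]
  exact ⟨fun ⟨x, h⟩ => ⟨x.1, x.2, h⟩, fun ⟨x, hx, h⟩ => ⟨⟨x, hx⟩, h⟩⟩

instance Dfn.ball (i : Fin n)
    [hR : Dfn (n + 1) (fun M u => R M (fun i => u i.castSucc) (u (Fin.last n)))] :
    Dfn n (fun M v => ∀ x, x ∈ v i → R M v x) :=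
  Dfn.congr (R := fun M v => ∀ x, x ∈ M → x ∈ v i → R M v x) inferInstance
    fun _ hM _ hv => ⟨fun h x _ hx => h x hx, fun h x hx => h x (hM.mem_trans hx (hv i)) hx⟩

instance Dfn.bex (i : Fin n)
    [hR : Dfn (n + 1) (fun M u => R M (fun i => u i.castSucc) (u (Fin.last n)))] :
    Dfn n (fun M v => ∃ x, x ∈ v i ∧ R M v x) :=
  Dfn.congr (R := fun M v => ∃ x, x ∈ M ∧ x ∈ v i ∧ R M v x) inferInstance
    fun _ hM _ hv => ⟨fun ⟨x, hx, h⟩ => ⟨x, hM.mem_trans hx (hv i), hx, h⟩,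
      fun ⟨x, _, hx, h⟩ => ⟨x, hx, h⟩⟩

end

/-- Substitution of variables. -/
theorem Dfn.comp {n m : ℕ} {P : ZFSet.{0} → (Fin n → ZFSet.{0}) → Prop} (hP : Dfn n P)
    (f : Fin n → Fin m) : Dfn m (fun M v => P M (fun i => v (f i))) := by
  obtain ⟨φ, hφ⟩ := hP.out
  let g : Empty ⊕ Fin n → Empty ⊕ Fin m := Sum.map id f
  refine ⟨(BoundedFormula.relabel (n := m) g φ.toFormula : memLang.BoundedFormula Empty (m + 0)),
    fun M hM w => ?_⟩
  have h := BoundedFormula.realize_relabel (M := M.toSet) (φ := φ.toFormula) (g := g)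
    (v := fun e => e.elim) (xs := (w : Fin (m + 0) → M.toSet))
  refine h.trans ?_
  rw [← hφ M hM]
  refine Iff.trans ?_ (BoundedFormula.realize_toFormula φ
    (Sum.elim (fun e => e.elim) fun i => w (f i)))
  have e1 : (Sum.elim (fun e : Empty => (e.elim : M.toSet)) ((w : Fin (m + 0) → M.toSet) ∘ Fin.castAdd 0) ∘ g)
      = Sum.elim (fun e => e.elim) fun i => w (f i) := by
    funext x
    rcases x with e | i
    · exact e.elim
    · rfl
  rw [e1]
  exact iff_of_eq (congrArg _ (Subsingleton.elim _ _))

instance Dfn.subset {n : ℕ} (i j : Fin n) : Dfn n (fun _ v => v i ⊆ v j) :=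
  inferInstanceAs (Dfn n (fun _ v => ∀ x, x ∈ v i → x ∈ v j))

theorem eq_pair_iff (x y z : ZFSet.{0}) : z = ZFSet.pair x y ↔
    ∃ a, a ∈ z ∧ ∃ b, b ∈ z ∧ (x ∈ a ∧ ∀ t, t ∈ a → t = x) ∧
      (x ∈ b ∧ y ∈ b ∧ ∀ t, t ∈ b → t = x ∨ t = y) ∧ ∀ t, t ∈ z → t = a ∨ t = b := by
  constructor
  · rintro rfl
    exact ⟨{x}, by simp [ZFSet.pair], {x, y}, by simp [ZFSet.pair], by simp, by simp,
      by simp [ZFSet.pair]⟩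
  · rintro ⟨a, ha, b, hb, ⟨h1, h2⟩, ⟨h3, h4, h5⟩, h6⟩
    have ea : a = {x} := by
      ext t; simp only [ZFSet.mem_singleton]
      exact ⟨h2 t, fun h => h ▸ h1⟩
    have eb : b = {x, y} := by
      ext t; simp only [ZFSet.mem_pair]
      exact ⟨h5 t, fun h => h.elim (fun h => h ▸ h3) (fun h => h ▸ h4)⟩
    subst ea eb
    ext t
    simp only [ZFSet.pair, ZFSet.mem_pair]
    exact ⟨h6 t, fun h => h.elim (fun h => h ▸ ha) (fun h => h ▸ hb)⟩

instance Dfn.eqPair {n : ℕ} (i j k : Fin n) : Dfn n (fun _ v => v k = ZFSet.pair (v i) (v j)) := by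
  simp only [eq_pair_iff]
  infer_instance

instance Dfn.pairMem {n : ℕ} (i j k : Fin n) : Dfn n (fun _ v => ZFSet.pair (v i) (v j) ∈ v k) :=
  Dfn.congr (R := fun _ v => ∃ p, p ∈ v k ∧ p = ZFSet.pair (v i) (v j)) inferInstance
    fun _ _ _ _ => by simp

instance Dfn.eqEmpty {n : ℕ} (i : Fin n) : Dfn n (fun _ v => v i = ∅) :=
  Dfn.congr (R := fun _ v => ∀ x, x ∈ v i → False) inferInstance
    fun _ _ _ _ => ZFSet.eq_empty _

instance Dfn.isTransitive {n : ℕ} (i : Fin n) : Dfn n (fun _ v => (v i).IsTransitive) :=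
  inferInstanceAs (Dfn n (fun _ v => ∀ x, x ∈ v i → x ⊆ v i))

/-! ## Elementarity for definable relations -/

theorem realizeIn_iff_of_dfn {M : ZFSet.{0}} {n : ℕ} {φ : memLang.BoundedFormula Empty n}
    {R : (Fin n → ZFSet.{0}) → Prop}
    (h : ∀ w : Fin n → M.toSet, φ.Realize (fun e => e.elim) w ↔ R (fun i => (w i).1))
    {v : Fin n → ZFSet.{0}} (hv : ∀ i, v i ∈ M) : RealizeIn M φ v ↔ R v :=
  ⟨fun ⟨_, h'⟩ => (h _).1 h', fun h' => ⟨hv, (h fun i => ⟨v i, hv i⟩).2 h'⟩⟩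

theorem IsElemEmbedding.dfn_iff {M N : ZFSet.{0}} {j : ZFSet.{0} → ZFSet.{0}}
    (hj : IsElemEmbedding M N j) (hM : M.IsTransitive) (hN : N.IsTransitive) {n : ℕ}
    (R : ZFSet.{0} → (Fin n → ZFSet.{0}) → Prop) [hR : Dfn n R] (v : Fin n → ZFSet.{0})
    (hv : ∀ i, v i ∈ M) : R M v ↔ R N (fun i => j (v i)) := by
  obtain ⟨φ, hφ⟩ := hR.out
  rw [← realizeIn_iff_of_dfn (hφ M hM) hv,
    ← realizeIn_iff_of_dfn (hφ N hN) fun i => hj.1 _ (hv i)]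
  exact hj.2 n φ v hv

theorem forall_vecCons_mem {n : ℕ} {a : ZFSet.{0}} {w : Fin n → ZFSet.{0}} {M : ZFSet.{0}} :
    (∀ i, (Matrix.vecCons a w : Fin (n + 1) → ZFSet.{0}) i ∈ M) ↔ a ∈ M ∧ ∀ i, w i ∈ M := by
  rw [Fin.forall_fin_succ]
  rfl

/-! ## Closure properties of transitive models of `ZFC⁻` -/

theorem snoc_lift {X : Type*} {m : ℕ} (w : Fin m → X) (a b c : X) (i : Fin (m + 1)) :
    (Fin.snoc (Fin.snoc (Fin.snoc w a : Fin (m + 1) → X) b : Fin (m + 2) → X) c : Fin (m + 3) → X)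
      i.castSucc.castSucc = (Fin.snoc w a : Fin (m + 1) → X) i := by
  simp

section

variable {M : ZFSet.{0}} (hM : M.IsTransitive) (hZ : ModelsZFCminus M)

include hM hZ

theorem exists_sep_mem {n : ℕ} (R : ZFSet.{0} → (Fin n → ZFSet.{0}) → ZFSet.{0} → Prop)
    [hR : Dfn (n + 1) (fun M u => R M (fun i => u i.castSucc) (u (Fin.last n)))]
    {v : Fin n → ZFSet.{0}} (hv : ∀ i, v i ∈ M) {a : ZFSet.{0}} (ha : a ∈ M) :
    ZFSet.sep (fun x => R M v x) a ∈ M := by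
  obtain ⟨φ, hφ⟩ := (hR.comp (m := n + 2)
    (Fin.lastCases (Fin.last _) fun i => i.castSucc.castSucc)).out
  have h := hZ (sepAx n φ) (Or.inl (Or.inr (Set.mem_iUnion.2 ⟨n, φ, rfl⟩)))
  unfold sepAx at h
  have h1 := BoundedFormula.realize_alls.1 h fun i => ⟨v i, hv i⟩
  rw [BoundedFormula.realize_all] at h1
  have h2 := h1 ⟨a, ha⟩
  rw [BoundedFormula.realize_ex] at h2
  obtain ⟨b, hb⟩ := h2
  rw [BoundedFormula.realize_all] at hb
  suffices hab : ZFSet.sep (fun x => R M v x) a = b.1 from hab ▸ b.2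
  ext x
  rw [mem_sep]
  suffices H : ∀ hx : x ∈ M, x ∈ b.1 ↔ x ∈ a ∧ R M v x by
    constructor
    · intro hx; exact (H (hM.mem_trans hx.1 ha)).2 hx
    · intro hx; exact (H (hM.mem_trans hx b.2)).1 hx
  intro hx
  have h3 := hb ⟨x, hx⟩
  rw [BoundedFormula.realize_iff, BoundedFormula.realize_inf,
    BoundedFormula.realize_liftAt_one (by omega),
    Subsingleton.elim (default : Empty → M.toSet) (fun e => e.elim), realize_mem', realize_mem',
    hφ M hM] at h3
  set w : Fin n → M.toSet := fun i => ⟨v i, hv i⟩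
  have e1 : (Fin.snoc (Fin.snoc (Fin.snoc w ⟨a, ha⟩ : Fin (n + 1) → M.toSet) b : Fin (n + 2) → M.toSet)
      ⟨x, hx⟩ : Fin (n + 3) → M.toSet) ⟨n + 2, by omega⟩ = ⟨x, hx⟩ :=
    Fin.snoc_last (α := fun _ => M.toSet) _ _
  have e2 : (Fin.snoc (Fin.snoc (Fin.snoc w ⟨a, ha⟩ : Fin (n + 1) → M.toSet) b : Fin (n + 2) → M.toSet)
      ⟨x, hx⟩ : Fin (n + 3) → M.toSet) ⟨n + 1, by omega⟩ = b :=
    (Fin.snoc_castSucc (α := fun _ => M.toSet) _ _ (Fin.last (n + 1))).trans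
      (Fin.snoc_last (α := fun _ => M.toSet) _ _)
  have e3 : (Fin.snoc (Fin.snoc (Fin.snoc w ⟨a, ha⟩ : Fin (n + 1) → M.toSet) b : Fin (n + 2) → M.toSet)
      ⟨x, hx⟩ : Fin (n + 3) → M.toSet) ⟨n, by omega⟩ = ⟨a, ha⟩ :=
    (snoc_lift _ _ _ _ (Fin.last n)).trans (Fin.snoc_last (α := fun _ => M.toSet) _ _)
  rw [e1, e2, e3] at h3
  simp only [Function.comp_apply, Fin.lastCases_last, Fin.lastCases_castSucc, Fin.val_last,
    Fin.val_castSucc] at h3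
  rw [if_neg (by omega), Fin.succ_last, Fin.snoc_last (α := fun _ => M.toSet)] at h3
  rw [h3]
  have e4 : ∀ i : Fin n, (if (i : ℕ) < n + 1 then i.castSucc.castSucc.castSucc else i.castSucc.castSucc.succ)
    = i.castSucc.castSucc.castSucc := fun i => if_pos (by omega)
  simp only [e4, Fin.snoc_castSucc (α := fun _ => M.toSet)]
  rfl

theorem exists_collection {n : ℕ}
    (R : ZFSet.{0} → (Fin n → ZFSet.{0}) → ZFSet.{0} → ZFSet.{0} → Prop)
    [hR : Dfn (n + 2) (fun M u => R M (fun i => u i.castSucc.castSucc) (u (Fin.last n).castSucc)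
      (u (Fin.last (n + 1))))]
    {v : Fin n → ZFSet.{0}} (hv : ∀ i, v i ∈ M) {a : ZFSet.{0}} (ha : a ∈ M)
    (h : ∀ x ∈ a, ∃ y ∈ M, R M v x y) : ∃ b ∈ M, ∀ x ∈ a, ∃ y ∈ b, R M v x y := by
  obtain ⟨φ, hφ⟩ := (hR.comp (m := n + 3)
    (Fin.lastCases (Fin.last _) (Fin.lastCases (Fin.last _).castSucc
      fun i => i.castSucc.castSucc.castSucc))).out
  have hc := hZ (collAx n φ) (Or.inr (Set.mem_iUnion.2 ⟨n, φ, rfl⟩))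
  unfold collAx at hc
  set w : Fin n → M.toSet := fun i => ⟨v i, hv i⟩
  have h1 := BoundedFormula.realize_alls.1 hc w
  simp only [BoundedFormula.realize_all, BoundedFormula.realize_ex, BoundedFormula.realize_imp,
    BoundedFormula.realize_inf,
    Subsingleton.elim (default : Empty → M.toSet) (fun e => e.elim), realize_mem'] at h1
  replace h1 := h1 ⟨a, ha⟩
  have e3 : ∀ b x : M.toSet, (Fin.snoc (Fin.snoc (Fin.snoc w ⟨a, ha⟩ : Fin (n + 1) → M.toSet) b : Fin (n + 2) → M.toSet)
      x : Fin (n + 3) → M.toSet) ⟨n, by omega⟩ = ⟨a, ha⟩ := fun b x =>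
    (snoc_lift _ _ _ _ (Fin.last n)).trans (Fin.snoc_last (α := fun _ => M.toSet) _ _)
  have e2 : ∀ x : M.toSet, (Fin.snoc (Fin.snoc w ⟨a, ha⟩ : Fin (n + 1) → M.toSet) x : Fin (n + 2) → M.toSet) ⟨n, by omega⟩ = ⟨a, ha⟩ := fun x =>
    (Fin.snoc_castSucc (α := fun _ => M.toSet) _ _ (Fin.last n)).trans
      (Fin.snoc_last (α := fun _ => M.toSet) _ _)
  have e1 : ∀ {m : ℕ} (w : Fin m → M.toSet) (x : M.toSet), (Fin.snoc w x : Fin (m + 1) → M.toSet) ⟨m, by omega⟩ = x := fun w x =>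
    (Fin.snoc_last (α := fun _ => M.toSet) _ _)
  have e5 : ∀ b x y : M.toSet, (Fin.snoc (Fin.snoc (Fin.snoc (Fin.snoc w ⟨a, ha⟩ : Fin (n + 1) → M.toSet) b : Fin (n + 2) → M.toSet)
      x : Fin (n + 3) → M.toSet) y : Fin (n + 4) → M.toSet) ⟨n + 1, by omega⟩ = b := fun b x y =>
    (snoc_lift _ _ _ _ (Fin.last (n + 1))).trans (Fin.snoc_last (α := fun _ => M.toSet) _ _)
  simp only [e1, e2, e3, e5] at h1
  obtain ⟨b, hb⟩ := h1 (by
    intro x hx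
    obtain ⟨y, hy, hxy⟩ := h x.1 hx
    refine ⟨⟨y, hy⟩, ?_⟩
    rw [hφ M hM]
    simp only [Fin.lastCases_last, Fin.lastCases_castSucc, Fin.snoc_castSucc (α := fun _ => M.toSet),
      Fin.snoc_last (α := fun _ => M.toSet)]
    exact hxy)
  refine ⟨b.1, b.2, fun x hx => ?_⟩
  obtain ⟨y, hy, hxy⟩ := hb ⟨x, hM.mem_trans hx ha⟩ hx
  refine ⟨y.1, hy, ?_⟩
  rw [BoundedFormula.realize_liftAt_one (by omega), hφ M hM] at hxy
  simp only [Function.comp_apply, Fin.lastCases_last, Fin.lastCases_castSucc, Fin.val_last,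
    Fin.val_castSucc] at hxy
  rw [if_neg (by omega), if_neg (by omega), Fin.succ_last, Fin.snoc_last (α := fun _ => M.toSet),
    ← Fin.castSucc_succ, Fin.snoc_castSucc (α := fun _ => M.toSet), Fin.succ_last,
    Fin.snoc_last (α := fun _ => M.toSet)] at hxy
  have e4 : ∀ i : Fin n, (if (i : ℕ) < n + 1 then i.castSucc.castSucc.castSucc.castSucc
      else i.castSucc.castSucc.castSucc.succ)
    = i.castSucc.castSucc.castSucc.castSucc := fun i => if_pos (by omega)
  simp only [e4, Fin.snoc_castSucc (α := fun _ => M.toSet)] at hxy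
  exact hxy

end

theorem mem_myImage {f : ZFSet.{0} → ZFSet.{0}} {x y : ZFSet.{0}} :
    y ∈ myImage f x ↔ ∃ z ∈ x, f z = y := by
  rw [myImage, ZFSet.mem_range]
  constructor
  · rintro ⟨a, rfl⟩
    refine ⟨_, ?_, rfl⟩
    have h : ZFSet.mk ((Quotient.out x).Func a) ∈ ZFSet.mk (Quotient.out x) :=
      ZFSet.mk_mem_iff.2 (PSet.func_mem _ _)
    exact Eq.mp (congrArg (fun t : ZFSet.{0} => ZFSet.mk ((Quotient.out x).Func a) ∈ t)
      (Quotient.out_eq x)) h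
  · rintro ⟨z, hz, rfl⟩
    replace hz := Eq.mp (congrArg (fun t : ZFSet.{0} => z ∈ t) (Quotient.out_eq x).symm) hz
    obtain ⟨p, rfl⟩ : ∃ p, ZFSet.mk p = z := Quotient.exists_rep z
    obtain ⟨a, ha⟩ := ZFSet.mk_mem_iff.1 hz
    exact ⟨a, congrArg f (ZFSet.sound ha).symm⟩

/-- The graph of `f` restricted to `a`. -/
noncomputable def graphOn (f : ZFSet.{0} → ZFSet.{0}) (a : ZFSet.{0}) : ZFSet.{0} :=
  myImage (fun x => ZFSet.pair x (f x)) a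

theorem mem_graphOn {f : ZFSet.{0} → ZFSet.{0}} {a z : ZFSet.{0}} :
    z ∈ graphOn f a ↔ ∃ x ∈ a, ZFSet.pair x (f x) = z := mem_myImage

theorem pair_mem_graphOn {f : ZFSet.{0} → ZFSet.{0}} {a x y : ZFSet.{0}} :
    ZFSet.pair x y ∈ graphOn f a ↔ x ∈ a ∧ y = f x := by
  rw [mem_graphOn]
  constructor
  · rintro ⟨z, hz, h⟩
    obtain ⟨rfl, rfl⟩ := pair_inj.1 h
    exact ⟨hz, rfl⟩
  · rintro ⟨h, rfl⟩
    exact ⟨x, h, rfl⟩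

section

variable {M : ZFSet.{0}} (hM : M.IsTransitive) (hZ : ModelsZFCminus M)

include hM hZ

theorem unordered_pair_mem {a b : ZFSet.{0}} (ha : a ∈ M) (hb : b ∈ M) : ({a, b} : ZFSet) ∈ M := by
  have h := hZ pairAx (by simp [ZFCminus])
  unfold pairAx at h
  have h0 := (BoundedFormula.realize_all.1 h) ⟨a, ha⟩
  have h1 := (BoundedFormula.realize_all.1 h0) ⟨b, hb⟩
  obtain ⟨c, hc⟩ := BoundedFormula.realize_ex.1 h1
  rw [BoundedFormula.realize_inf, Subsingleton.elim (default : Empty → M.toSet) (fun e => e.elim),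
    realize_mem', realize_mem'] at hc
  have hc1 : a ∈ c.1 := hc.1
  have hc2 : b ∈ c.1 := hc.2
  have := exists_sep_mem hM hZ (n := 2) (fun _ v x => x = v 0 ∨ x = v 1)
    (v := ![a, b]) (by simp [forall_vecCons_mem, ha, hb]) c.2
  convert this
  ext x
  simp only [mem_pair, mem_sep]
  constructor
  · rintro (rfl | rfl)
    · exact ⟨hc1, Or.inl rfl⟩
    · exact ⟨hc2, Or.inr rfl⟩
  · exact fun h => h.2

theorem singleton_mem {a : ZFSet.{0}} (ha : a ∈ M) : ({a} : ZFSet) ∈ M := by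
  have := unordered_pair_mem hM hZ ha ha
  rwa [ZFSet.pair_eq_singleton] at this

theorem pair_mem {a b : ZFSet.{0}} (ha : a ∈ M) (hb : b ∈ M) : ZFSet.pair a b ∈ M :=
  unordered_pair_mem hM hZ (singleton_mem hM hZ ha) (unordered_pair_mem hM hZ ha hb)

theorem sUnion_mem {a : ZFSet.{0}} (ha : a ∈ M) : (⋃₀ a : ZFSet) ∈ M := by
  have h := hZ unionAx (by simp [ZFCminus])
  unfold unionAx at h
  have h0 := (BoundedFormula.realize_all.1 h) ⟨a, ha⟩
  obtain ⟨c, hc⟩ := BoundedFormula.realize_ex.1 h0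
  have := exists_sep_mem hM hZ (n := 1) (fun _ v x => ∃ y, y ∈ v 0 ∧ x ∈ y)
    (v := ![a]) (by simp [ha]) c.2
  convert this
  ext x
  simp only [mem_sUnion, mem_sep]
  constructor
  · rintro ⟨y, hy, hx⟩
    have hyM := hM.mem_trans hy ha
    have h1 := (BoundedFormula.realize_all.1 hc) ⟨x, hM.mem_trans hx hyM⟩
    have h2 := (BoundedFormula.realize_all.1 h1) ⟨y, hyM⟩
    rw [BoundedFormula.realize_imp, BoundedFormula.realize_inf,
      Subsingleton.elim (default : Empty → M.toSet) (fun e => e.elim),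
      realize_mem', realize_mem', realize_mem'] at h2
    exact ⟨h2 ⟨hx, hy⟩, y, hy, hx⟩
  · exact fun h => h.2

theorem union_mem {a b : ZFSet.{0}} (ha : a ∈ M) (hb : b ∈ M) : a ∪ b ∈ M :=
  sUnion_mem hM hZ (unordered_pair_mem hM hZ ha hb)

theorem myImage_mem {n : ℕ} (R : ZFSet.{0} → (Fin n → ZFSet.{0}) → ZFSet.{0} → ZFSet.{0} → Prop)
    [hR : Dfn (n + 2) (fun M u => R M (fun i => u i.castSucc.castSucc) (u (Fin.last n).castSucc)
      (u (Fin.last (n + 1))))]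
    {v : Fin n → ZFSet.{0}} (hv : ∀ i, v i ∈ M) {a : ZFSet.{0}} (ha : a ∈ M)
    {f : ZFSet.{0} → ZFSet.{0}} (hf : ∀ x ∈ a, f x ∈ M)
    (hRf : ∀ x ∈ a, ∀ y ∈ M, R M v x y ↔ y = f x) : myImage f a ∈ M := by
  obtain ⟨b, hb, h⟩ := exists_collection hM hZ R hv ha
    fun x hx => ⟨f x, hf x hx, (hRf x hx _ (hf x hx)).2 rfl⟩
  have : Dfn (n + 1 + 1) (fun M u => (fun M (v : Fin (n + 1) → ZFSet.{0}) y =>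
      ∃ x, x ∈ v (Fin.last n) ∧ R M (fun i => v i.castSucc) x y) M
      (fun i => u i.castSucc) (u (Fin.last (n + 1)))) := by
    have := hR.comp (m := n + 3) (Fin.lastCases (Fin.last _).castSucc (Fin.lastCases (Fin.last _)
      fun i => i.castSucc.castSucc.castSucc))
    simp only [Fin.lastCases_last, Fin.lastCases_castSucc] at this
    exact Dfn.bex _
  have := exists_sep_mem hM hZ (n := n + 1)
    (fun M v y => ∃ x, x ∈ v (Fin.last n) ∧ R M (fun i => v i.castSucc) x y)
    (v := Fin.snoc v a) (fun i => by
      induction i using Fin.lastCases with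
      | last => simpa using ha
      | cast i => simpa using hv i) hb
  convert this
  ext y
  simp only [mem_myImage, mem_sep, Fin.snoc_last, Fin.snoc_castSucc]
  constructor
  · rintro ⟨x, hx, rfl⟩
    obtain ⟨y, hy, hxy⟩ := h x hx
    have := (hRf x hx y (hM.mem_trans hy hb)).1 hxy
    subst this
    exact ⟨hy, x, hx, hxy⟩
  · rintro ⟨hy, x, hx, hxy⟩
    exact ⟨x, hx, ((hRf x hx y (hM.mem_trans hy hb)).1 hxy).symm⟩

theorem graphOn_mem {n : ℕ} (R : ZFSet.{0} → (Fin n → ZFSet.{0}) → ZFSet.{0} → ZFSet.{0} → Prop)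
    [hR : Dfn (n + 2) (fun M u => R M (fun i => u i.castSucc.castSucc) (u (Fin.last n).castSucc)
      (u (Fin.last (n + 1))))]
    {v : Fin n → ZFSet.{0}} (hv : ∀ i, v i ∈ M) {a : ZFSet.{0}} (ha : a ∈ M)
    {f : ZFSet.{0} → ZFSet.{0}} (hf : ∀ x ∈ a, f x ∈ M)
    (hRf : ∀ x ∈ a, ∀ y ∈ M, R M v x y ↔ y = f x) : graphOn f a ∈ M := by
  have : Dfn (n + 2) (fun M u => (fun M (v : Fin n → ZFSet.{0}) x z =>
      ∃ y, y ∈ M ∧ (R M v x y ∧ z = ZFSet.pair x y)) M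
      (fun i => u i.castSucc.castSucc) (u (Fin.last n).castSucc) (u (Fin.last (n + 1)))) := by
    have := hR.comp (m := n + 3) (Fin.lastCases (Fin.last _) (Fin.lastCases (Fin.last _).castSucc.castSucc
      fun i => i.castSucc.castSucc.castSucc))
    simp only [Fin.lastCases_last, Fin.lastCases_castSucc] at this
    exact Dfn.ex
  refine myImage_mem hM hZ (fun M v x z => ∃ y, y ∈ M ∧ (R M v x y ∧ z = ZFSet.pair x y)) hv ha
    (fun x hx => pair_mem hM hZ (hM.mem_trans hx ha) (hf x hx)) fun x hx z _ => ?_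
  constructor
  · rintro ⟨y, hy, h, rfl⟩
    rw [(hRf x hx y hy).1 h]
  · rintro rfl
    exact ⟨f x, hf x hx, (hRf x hx _ (hf x hx)).2 rfl, rfl⟩

theorem zprod_mem {a b : ZFSet.{0}} (ha : a ∈ M) (hb : b ∈ M) : ZFSet.prod a b ∈ M := by
  have h1 : ∀ x ∈ a, myImage (ZFSet.pair x) b ∈ M := fun x hx =>
    myImage_mem hM hZ (n := 1) (fun _ v y z => z = ZFSet.pair (v 0) y) (v := ![x])
      (by simp [hM.mem_trans hx ha]) hb
      (fun y hy => pair_mem hM hZ (hM.mem_trans hx ha) (hM.mem_trans hy hb)) fun y hy z _ => Iff.rfl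
  have h2 : myImage (fun x => myImage (ZFSet.pair x) b) a ∈ M :=
    myImage_mem hM hZ (n := 1) (fun _ v x z => (∀ y, y ∈ v 0 → ZFSet.pair x y ∈ z) ∧
      ∀ p, p ∈ z → ∃ y, y ∈ v 0 ∧ p = ZFSet.pair x y) (v := ![b])
      (by simp [hb]) ha h1 fun x hx z _ => by
        constructor
        · rintro ⟨h, h'⟩
          ext p
          rw [mem_myImage]
          constructor
          · intro hp
            obtain ⟨y, hy, rfl⟩ := h' p hp
            exact ⟨y, hy, rfl⟩
          · rintro ⟨y, hy, rfl⟩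
            exact h y hy
        · rintro rfl
          refine ⟨fun y hy => mem_myImage.2 ⟨y, hy, rfl⟩, fun p hp => ?_⟩
          obtain ⟨y, hy, rfl⟩ := mem_myImage.1 hp
          exact ⟨y, hy, rfl⟩
  convert sUnion_mem hM hZ h2
  ext p
  simp only [mem_prod, mem_sUnion, mem_myImage]
  constructor
  · rintro ⟨x, hx, y, hy, rfl⟩
    exact ⟨_, ⟨x, hx, rfl⟩, mem_myImage.2 ⟨y, hy, rfl⟩⟩
  · rintro ⟨_, ⟨x, hx, rfl⟩, h⟩
    obtain ⟨y, hy, rfl⟩ := mem_myImage.1 h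
    exact ⟨x, hx, y, hy, rfl⟩

end

/-- The Mostowski collapse of a well-founded relation `r` on `a`. -/
noncomputable def mostowski (a : ZFSet.{0}) {r : ZFSet.{0} → ZFSet.{0} → Prop} (hr : WellFounded r) :
    ZFSet.{0} → ZFSet.{0} :=
  hr.fix fun x rec => myImage (fun y => if h : r y x then rec y h else ∅) (ZFSet.sep (fun y => r y x) a)

theorem mostowski_eq (a : ZFSet.{0}) {r : ZFSet.{0} → ZFSet.{0} → Prop} (hr : WellFounded r)
    (x : ZFSet.{0}) : mostowski a hr x = myImage (mostowski a hr) (ZFSet.sep (fun y => r y x) a) := by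
  rw [mostowski, hr.fix_eq]
  ext z
  simp only [mem_myImage, mem_sep]
  refine exists_congr fun y => and_congr_right fun h => ?_
  rw [dif_pos h.2]

theorem mem_mostowski {a : ZFSet.{0}} {r : ZFSet.{0} → ZFSet.{0} → Prop} {hr : WellFounded r}
    {x z : ZFSet.{0}} : z ∈ mostowski a hr x ↔ ∃ y ∈ a, r y x ∧ mostowski a hr y = z := by
  rw [mostowski_eq, mem_myImage]
  simp only [mem_sep, and_assoc]

/-- `g` is an approximation to the Mostowski collapse of the relation `r` on `a`. -/
def IsApprox (M a r g : ZFSet.{0}) : Prop :=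
  (∀ p, p ∈ g → ∃ x, x ∈ a ∧ ∃ y, y ∈ M ∧ p = ZFSet.pair x y) ∧
  ∀ x, x ∈ a → ∀ y, y ∈ M → ZFSet.pair x y ∈ g →
    (∀ z, z ∈ a → ZFSet.pair z x ∈ r → ∃ w, w ∈ y ∧ ZFSet.pair z w ∈ g) ∧
    ∀ w, w ∈ y → ∃ z, z ∈ a ∧ (ZFSet.pair z x ∈ r ∧ ZFSet.pair z w ∈ g)

instance Dfn.isApprox {n : ℕ} (i j k : Fin n) : Dfn n (fun M v => IsApprox M (v i) (v j) (v k)) := by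
  unfold IsApprox
  infer_instance

section

variable {M : ZFSet.{0}} (hM : M.IsTransitive) (hZ : ModelsZFCminus M)

include hM

theorem IsApprox.eq_mostowski {a r g : ZFSet.{0}} (hg : IsApprox M a r g)
    (hr : WellFounded fun x y => ZFSet.pair x y ∈ r) {x : ZFSet.{0}} (hx : x ∈ a) :
    ∀ {y : ZFSet.{0}}, y ∈ M → ZFSet.pair x y ∈ g → y = mostowski a hr x := by
  induction x using hr.induction with
  | _ x ih =>
    intro y hy hxy
    obtain ⟨h1, h2⟩ := hg.2 x hx y hy hxy
    ext w
    rw [mem_mostowski]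
    constructor
    · intro hw
      obtain ⟨z, hz, hzx, hzw⟩ := h2 w hw
      exact ⟨z, hz, hzx, (ih z hzx hz (hM.mem_trans hw hy) hzw).symm⟩
    · rintro ⟨z, hz, hzx, rfl⟩
      obtain ⟨w, hw, hzw⟩ := h1 z hz hzx
      rwa [← ih z hzx hz (hM.mem_trans hw hy) hzw]

include hZ

theorem exists_approx {a r : ZFSet.{0}} (ha : a ∈ M) (hrM : r ∈ M)
    (hr : WellFounded fun x y => ZFSet.pair x y ∈ r) {x : ZFSet.{0}} (hx : x ∈ a) :
    ∃ g ∈ M, IsApprox M a r g ∧ ∃ y ∈ M, ZFSet.pair x y ∈ g := by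
  induction x using hr.induction with
  | _ x ih =>
    have hxM := hM.mem_trans hx ha
    let p := ZFSet.sep (fun y => ZFSet.pair y x ∈ r) a
    have hp : p ∈ M := exists_sep_mem hM hZ (n := 2) (fun _ v y => ZFSet.pair y (v 0) ∈ v 1)
      (v := ![x, r]) (by simp [forall_vecCons_mem, hxM, hrM]) ha
    obtain ⟨b, hb, hpb⟩ := exists_collection hM hZ (n := 2)
      (fun M v y g => IsApprox M (v 0) (v 1) g ∧ ∃ w, w ∈ M ∧ ZFSet.pair y w ∈ g)
      (v := ![a, r]) (by simp [forall_vecCons_mem, ha, hrM]) hp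
      (fun y hy => by
        obtain ⟨h1, h2⟩ := mem_sep.1 hy
        exact ih y h2 h1)
    let c := ZFSet.sep (fun g => IsApprox M a r g) b
    have hc : c ∈ M := exists_sep_mem hM hZ (n := 2) (fun M v g => IsApprox M (v 0) (v 1) g)
      (v := ![a, r]) (by simp [forall_vecCons_mem, ha, hrM]) hb
    have hU : (⋃₀ c : ZFSet) ∈ M := sUnion_mem hM hZ hc
    have hUe : ∀ y ∈ a, ∀ w ∈ M, ZFSet.pair y w ∈ (⋃₀ c : ZFSet) → w = mostowski a hr y := by
      intro y hy w hw h
      obtain ⟨g, hg, h⟩ := mem_sUnion.1 h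
      exact (mem_sep.1 hg).2.eq_mostowski hM hr hy hw h
    have hpU : ∀ y ∈ p, mostowski a hr y ∈ M ∧ ZFSet.pair y (mostowski a hr y) ∈ (⋃₀ c : ZFSet) := by
      intro y hy
      obtain ⟨g, hg, h1, w, hw, h2⟩ := hpb y hy
      have := h1.eq_mostowski hM hr (mem_sep.1 hy).1 hw h2
      subst this
      exact ⟨hw, mem_sUnion.2 ⟨g, mem_sep.2 ⟨hg, h1⟩, h2⟩⟩
    have hG : mostowski a hr x ∈ M := by
      rw [mostowski_eq]
      refine myImage_mem hM hZ (n := 1) (fun _ v y w => ZFSet.pair y w ∈ v 0) (v := ![⋃₀ c])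
        (by simp [hU]) hp (fun y hy => (hpU y hy).1) fun y hy w hw => ?_
      constructor
      · exact hUe y (mem_sep.1 hy).1 w hw
      · rintro rfl
        exact (hpU y hy).2
    refine ⟨(⋃₀ c : ZFSet) ∪ {ZFSet.pair x (mostowski a hr x)},
      union_mem hM hZ hU (singleton_mem hM hZ (pair_mem hM hZ hxM hG)), ⟨?_, ?_⟩,
      mostowski a hr x, hG, by simp⟩
    · intro q hq
      rcases mem_union.1 hq with hq | hq
      · obtain ⟨g, hg, h⟩ := mem_sUnion.1 hq
        exact (mem_sep.1 hg).2.1 q h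
      · exact ⟨x, hx, _, hG, mem_singleton.1 hq⟩
    · intro x' hx' y hy hxy
      rcases mem_union.1 hxy with hxy | hxy
      · obtain ⟨g, hg, h⟩ := mem_sUnion.1 hxy
        obtain ⟨h1, h2⟩ := (mem_sep.1 hg).2.2 x' hx' y hy h
        refine ⟨fun z hz hzx => ?_, fun w hw => ?_⟩
        · obtain ⟨w, hw, hzw⟩ := h1 z hz hzx
          exact ⟨w, hw, mem_union.2 (Or.inl (mem_sUnion.2 ⟨g, hg, hzw⟩))⟩
        · obtain ⟨z, hz, hzx, hzw⟩ := h2 w hw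
          exact ⟨z, hz, hzx, mem_union.2 (Or.inl (mem_sUnion.2 ⟨g, hg, hzw⟩))⟩
      · obtain ⟨rfl, rfl⟩ := pair_inj.1 (mem_singleton.1 hxy)
        refine ⟨fun z hz hzx => ⟨mostowski a hr z, mem_mostowski.2 ⟨z, hz, hzx, rfl⟩,
          mem_union.2 (Or.inl (hpU z (mem_sep.2 ⟨hz, hzx⟩)).2)⟩, fun w hw => ?_⟩
        obtain ⟨z, hz, hzx, rfl⟩ := mem_mostowski.1 hw
        exact ⟨z, hz, hzx, mem_union.2 (Or.inl (hpU z (mem_sep.2 ⟨hz, hzx⟩)).2)⟩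

theorem mostowski_mem {a r : ZFSet.{0}} (ha : a ∈ M) (hrM : r ∈ M)
    (hr : WellFounded fun x y => ZFSet.pair x y ∈ r) {x : ZFSet.{0}} (hx : x ∈ a) :
    mostowski a hr x ∈ M := by
  obtain ⟨g, _, h, y, hy, hxy⟩ := exists_approx hM hZ ha hrM hr hx
  exact h.eq_mostowski hM hr hx hy hxy ▸ hy

theorem graphOn_mostowski_mem {a r : ZFSet.{0}} (ha : a ∈ M) (hrM : r ∈ M)
    (hr : WellFounded fun x y => ZFSet.pair x y ∈ r) : graphOn (mostowski a hr) a ∈ M := by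
  refine graphOn_mem hM hZ (n := 2)
    (fun M v x y => ∃ g, g ∈ M ∧ (IsApprox M (v 0) (v 1) g ∧ ZFSet.pair x y ∈ g))
    (v := ![a, r]) (by simp [forall_vecCons_mem, ha, hrM]) ha
    (fun x hx => mostowski_mem hM hZ ha hrM hr hx) fun x hx y hy => ?_
  constructor
  · rintro ⟨g, _, h, hxy⟩
    exact IsApprox.eq_mostowski hM h hr hx hy hxy
  · rintro rfl
    obtain ⟨g, hgM, h, y, hy, hxy⟩ := exists_approx hM hZ ha hrM hr hx
    exact ⟨g, hgM, h, h.eq_mostowski hM hr hx hy hxy ▸ hxy⟩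

end

/-! ## Cardinalities of sets -/

theorem zcard_eq (x : ZFSet.{0}) : zcard x = Cardinal.lift.{1} x.card := cardinalMk_coe_sort

theorem zcard_le_iff {x y : ZFSet.{0}} : zcard x ≤ zcard y ↔ x.card ≤ y.card := by
  rw [zcard_eq, zcard_eq, Cardinal.lift_le]

theorem zcard_eq_iff {x y : ZFSet.{0}} : zcard x = zcard y ↔ x.card = y.card := by
  rw [zcard_eq, zcard_eq, Cardinal.lift_inj]

theorem card_le_of_surj {a b : ZFSet.{0}} (f : ZFSet.{0} → ZFSet.{0})
    (h : ∀ y ∈ b, ∃ x ∈ a, f x = y) : b.card ≤ a.card := by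
  rw [← zcard_le_iff]
  choose! g hg hfg using h
  refine Cardinal.mk_le_of_injective (f := fun y : b.toSet => (⟨g y.1, hg _ y.2⟩ : a.toSet)) ?_
  intro y z hyz
  have h1 : g y.1 = g z.1 := congrArg Subtype.val hyz
  exact Subtype.ext (by rw [← hfg _ y.2, ← hfg _ z.2, h1])

theorem card_myImage_le (f : ZFSet.{0} → ZFSet.{0}) (a : ZFSet.{0}) :
    (myImage f a).card ≤ a.card :=
  card_le_of_surj f fun _ hy => mem_myImage.1 hy

theorem exists_surj_of_card_le {a b : ZFSet.{0}} (h : b.card ≤ a.card) (hb : ∃ y, y ∈ b) :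
    ∃ f : ZFSet.{0} → ZFSet.{0}, (∀ x ∈ a, f x ∈ b) ∧ ∀ y ∈ b, ∃ x ∈ a, f x = y := by
  rw [← zcard_le_iff] at h
  obtain ⟨g⟩ := h
  obtain ⟨y0, hy0⟩ := hb
  let f : ZFSet.{0} → ZFSet.{0} := fun x =>
    if hx : ∃ y : b.toSet, (g y).1 = x then (Classical.choose hx).1 else y0
  have hf : ∀ y : b.toSet, f (g y).1 = y.1 := fun y => by
    have hx : ∃ y' : b.toSet, (g y').1 = (g y).1 := ⟨y, rfl⟩
    simp only [f]
    rw [dif_pos hx, g.injective (Subtype.ext (Classical.choose_spec hx))]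
  refine ⟨f, fun x _ => ?_, fun y hy => ⟨_, (g ⟨y, hy⟩).2, hf ⟨y, hy⟩⟩⟩
  simp only [f]
  split_ifs with hx
  · exact (Classical.choose hx).2
  · exact hy0

theorem isFunc_graphOn {a b : ZFSet.{0}} {f : ZFSet.{0} → ZFSet.{0}} (hf : ∀ x ∈ a, f x ∈ b) :
    ZFSet.IsFunc a b (graphOn f a) := by
  refine ⟨fun p hp => ?_, fun x hx => ⟨f x, pair_mem_graphOn.2 ⟨hx, rfl⟩, fun y hy => (pair_mem_graphOn.1 hy).2⟩⟩
  obtain ⟨x, hx, rfl⟩ := mem_graphOn.1 hp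
  exact mem_prod.2 ⟨x, hx, f x, hf x hx, rfl⟩

theorem exists_eq_graphOn {a b g : ZFSet.{0}} (hg : ZFSet.IsFunc a b g) :
    ∃ f : ZFSet.{0} → ZFSet.{0}, (∀ x ∈ a, f x ∈ b) ∧ g = graphOn f a := by
  choose! f hf huniq using hg.2
  have hfb : ∀ x ∈ a, f x ∈ b := fun x hx => by
    have := hg.1 (hf x hx)
    exact (pair_mem_prod.1 this).2
  refine ⟨f, hfb, ?_⟩
  ext p
  rw [mem_graphOn]
  constructor
  · intro hp
    obtain ⟨x, hx, y, hy, rfl⟩ := mem_prod.1 (hg.1 hp)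
    exact ⟨x, hx, by rw [huniq x hx y hp]⟩
  · rintro ⟨x, hx, rfl⟩
    exact hf x hx

/-! ## κ-models -/

section

variable {κ M : ZFSet.{0}} (h : IsKappaModel κ M)

include h

theorem IsKappaModelIn.trans : M.IsTransitive := h.2.2.1

theorem IsKappaModelIn.zfc : ModelsZFCminus M := h.2.2.2.2.2

theorem IsKappaModelIn.card_eq : M.card = κ.card := zcard_eq_iff.1 h.2.2.2.1

theorem IsKappaModelIn.self_mem : κ ∈ M := h.2.1

theorem IsKappaModelIn.subset : κ ⊆ M := h.trans.subset_of_mem h.self_mem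

theorem IsKappaModelIn.graphOn_mem {β : ZFSet.{0}} (hβ : β ∈ κ) {f : ZFSet.{0} → ZFSet.{0}}
    (hf : ∀ x ∈ β, f x ∈ M) : graphOn f β ∈ M :=
  h.2.2.2.2.1 β hβ _ (Set.mem_univ _) (isFunc_graphOn hf)

theorem IsKappaModelIn.myImage_mem {β : ZFSet.{0}} (hβ : β ∈ κ) {f : ZFSet.{0} → ZFSet.{0}}
    (hf : ∀ x ∈ β, f x ∈ M) : myImage f β ∈ M := by
  refine _root_.myImage_mem h.trans h.zfc (n := 1) (fun _ v x y => ZFSet.pair x y ∈ v 0)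
    (v := ![graphOn f β]) (by simp [h.graphOn_mem hβ hf]) (h.subset hβ) hf
    fun x hx y _ => ?_
  exact pair_mem_graphOn.trans (and_iff_right hx)

theorem IsKappaModelIn.power_le {β : ZFSet.{0}} (hβ : β ∈ κ) : κ.card ^ β.card ≤ κ.card := by
  rw [← Cardinal.lift_le.{1}, Cardinal.lift_power, ← cardinalMk_coe_sort, ← cardinalMk_coe_sort,
    Cardinal.power_def]
  have h1 : Cardinal.mk κ = Cardinal.mk M := by
    rw [cardinalMk_coe_sort, cardinalMk_coe_sort, h.card_eq]
  rw [h1]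
  have hval : ∀ (f : β → κ) (x : ZFSet.{0}) (hx : x ∈ β),
      (fun x => if hx : x ∈ β then (f ⟨x, hx⟩).1 else ∅) x = (f ⟨x, hx⟩).1 := fun f x hx => dif_pos hx
  refine Cardinal.mk_le_of_injective (f := fun f : β → κ =>
    (⟨graphOn (fun x => if hx : x ∈ β then (f ⟨x, hx⟩).1 else ∅) β, h.graphOn_mem hβ fun x hx => by
      rw [dif_pos hx]; exact h.subset (f ⟨x, hx⟩).2⟩ : M)) ?_
  intro f g hfg
  have hfg' := congrArg Subtype.val hfg
  funext x
  have h2 : ZFSet.pair x.1 (f x).1 ∈ graphOn (fun x => if hx : x ∈ β then (f ⟨x, hx⟩).1 else ∅) β :=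
    pair_mem_graphOn.2 ⟨x.2, (hval f x.1 x.2).symm⟩
  simp only at hfg'
  rw [hfg'] at h2
  exact Subtype.ext ((pair_mem_graphOn.1 h2).2.trans (hval g x.1 x.2))

end

/-! ## Embeddings witnessing weak compactness -/

/-- `j : M → N` is an elementary embedding between `κ`-models with critical point `κ`. -/
structure IsCritEmbedding (κ M N : ZFSet.{0}) (j : ZFSet.{0} → ZFSet.{0}) : Prop where
  dom : IsKappaModel κ M
  cod : IsKappaModel κ N
  elem : IsElemEmbedding M N j
  crit : HasCritPoint j κ

/-- Cardinal-arithmetic properties of an ordinal carrying a weakly compact subset. -/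
structure IsLargeCardinal (κ : ZFSet.{0}) : Prop where
  ord : κ.IsOrdinal
  succ_mem : ∀ β ∈ κ, insert β β ∈ κ
  card_lt : ∀ β ∈ κ, β.card < κ.card
  aleph0_lt : Cardinal.aleph0 < κ.card
  power_le : ∀ β ∈ κ, κ.card ^ β.card ≤ κ.card

namespace IsCritEmbedding

variable {κ M N : ZFSet.{0}} {j : ZFSet.{0} → ZFSet.{0}} (h : IsCritEmbedding κ M N j)

include h

theorem iff {n : ℕ} (R : ZFSet.{0} → (Fin n → ZFSet.{0}) → Prop) [Dfn n R] (v : Fin n → ZFSet.{0})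
    (hv : ∀ i, v i ∈ M) : R M v ↔ R N (fun i => j (v i)) :=
  h.elem.dfn_iff h.dom.trans h.cod.trans R v hv

theorem map_mem {x : ZFSet.{0}} (hx : x ∈ M) : j x ∈ N := h.elem.1 x hx

theorem mem_iff {x y : ZFSet.{0}} (hx : x ∈ M) (hy : y ∈ M) : x ∈ y ↔ j x ∈ j y :=
  h.iff (fun _ v => v 0 ∈ v 1) ![x, y] (by simp [forall_vecCons_mem, hx, hy])

theorem eq_iff {x y : ZFSet.{0}} (hx : x ∈ M) (hy : y ∈ M) : x = y ↔ j x = j y :=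
  h.iff (fun _ v => v 0 = v 1) ![x, y] (by simp [forall_vecCons_mem, hx, hy])

theorem pair_mem_iff {x y z : ZFSet.{0}} (hx : x ∈ M) (hy : y ∈ M) (hz : z ∈ M) :
    ZFSet.pair x y ∈ z ↔ ZFSet.pair (j x) (j y) ∈ j z :=
  h.iff (fun _ v => ZFSet.pair (v 0) (v 1) ∈ v 2) ![x, y, z]
    (by simp [forall_vecCons_mem, hx, hy, hz])

theorem map_of_mem {x : ZFSet.{0}} (hx : x ∈ κ) : j x = x := h.crit.1 x hx

theorem self_mem_map : κ ∈ j κ := h.crit.2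

theorem mem_of_mem {x : ZFSet.{0}} (hx : x ∈ κ) : x ∈ M := h.dom.subset hx

/-- Bounding principle for definable properties of the critical point. -/
theorem exists_of_map {n : ℕ} (R : ZFSet.{0} → (Fin (n + 1) → ZFSet.{0}) → Prop) [hR : Dfn (n + 1) R]
    {K : ZFSet.{0}} (hK : K ∈ M) (hκ : κ ∈ j K) (v : Fin n → ZFSet.{0}) (hv : ∀ i, v i ∈ M)
    (hall : ∀ x ∈ K, R M (Fin.cons x v)) : R N (Fin.cons κ fun i => j (v i)) := by
  have hD : Dfn (n + 1) (fun M (u : Fin (n + 1) → ZFSet.{0}) => ∀ x, x ∈ u 0 →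
      R M (Fin.cons x fun i => u i.succ)) := by
    have h1 := hR.comp (Fin.cons (Fin.last (n + 1)) fun i => (i.succ).castSucc :
      Fin (n + 1) → Fin (n + 2))
    have h2 : Dfn (n + 1 + 1) (fun M u => R M (Fin.cons (u (Fin.last (n + 1)))
        fun i => u (i.succ).castSucc)) := by
      refine Dfn.congr h1 fun M _ w _ => iff_of_eq (congrArg _ (funext fun i => ?_))
      refine Fin.cases rfl (fun _ => rfl) i
    exact Dfn.ball (R := fun M u x => R M (Fin.cons x fun i => u i.succ)) 0
  exact (h.iff (fun M (u : Fin (n + 1) → ZFSet.{0}) => ∀ x, x ∈ u 0 →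
      R M (Fin.cons x fun i => u i.succ)) (Fin.cons K v) (Fin.cases hK hv)).1 hall κ hκ

variable (hκ : κ.IsOrdinal)

include hκ

theorem succ_mem {β : ZFSet.{0}} (hβ : β ∈ κ) : insert β β ∈ κ := by
  rcases (isOrdinal_succ (hκ.mem hβ)).mem_trichotomous hκ with h1 | h1 | h1
  · exact h1
  · have := h.exists_of_map (fun _ v => v 0 ∈ v 1 ∨ v 0 = v 1) h.dom.self_mem h.self_mem_map ![β]
      (by simp [h.mem_of_mem hβ]) (fun x hx => by
        rw [← h1, mem_insert_iff] at hx; exact hx.symm)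
    have h2 : κ ∈ j β ∨ κ = j β := this
    rw [h.map_of_mem hβ] at h2
    rcases h2 with h2 | h2
    · exact absurd hβ (mem_asymm h2)
    · exact absurd hβ (h2 ▸ mem_irrefl _)
  · rw [mem_insert_iff] at h1
    rcases h1 with h2 | h2
    · exact absurd hβ (h2 ▸ mem_irrefl _)
    · exact absurd hβ (mem_asymm h2)

theorem bdd {β : ZFSet.{0}} (hβ : β ∈ κ) {f : ZFSet.{0} → ZFSet.{0}} (hf : ∀ x ∈ β, f x ∈ κ) :
    ∃ δ ∈ κ, ∀ x ∈ β, f x ∈ δ := by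
  by_contra hcon
  push Not at hcon
  have hG : graphOn f β ∈ M := h.dom.graphOn_mem hβ fun x hx => h.mem_of_mem (hf x hx)
  have h1 := h.exists_of_map
    (fun _ v => ∃ x, x ∈ v 1 ∧ ∃ y, y ∈ v 2 ∧ ZFSet.pair x y ∈ v 3 ∧ ¬ y ∈ v 0)
    h.dom.self_mem h.self_mem_map ![β, κ, graphOn f β]
    (by simp [forall_vecCons_mem, h.mem_of_mem hβ, hG, h.dom.self_mem]) (fun δ hδ => by
      obtain ⟨x, hx, hxδ⟩ := hcon δ hδ
      exact ⟨x, hx, f x, hf x hx, pair_mem_graphOn.2 ⟨hx, rfl⟩, hxδ⟩)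
  have h2 : ∃ x, x ∈ j β ∧ ∃ y, y ∈ j κ ∧ ZFSet.pair x y ∈ j (graphOn f β) ∧ ¬ y ∈ κ := h1
  obtain ⟨x, hx, y, hy, hxy, hyκ⟩ := h2
  rw [h.map_of_mem hβ] at hx
  have hfun := (h.iff (n := 3) (fun _ v => ∀ y, y ∈ v 0 → ∀ z, z ∈ v 0 → ZFSet.pair (v 1) y ∈ v 2 →
      ZFSet.pair (v 1) z ∈ v 2 → y = z) ![κ, x, graphOn f β]
      (by simp [forall_vecCons_mem, h.mem_of_mem (hκ.mem_trans hx hβ), hG, h.dom.self_mem])).1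
    (fun y _ z _ hy hz => (pair_mem_graphOn.1 hy).2.trans (pair_mem_graphOn.1 hz).2.symm)
  have hfx := hf x hx
  have h3 := (h.pair_mem_iff (h.mem_of_mem (hκ.mem_trans hx hβ)) (h.mem_of_mem hfx) hG).1
    (pair_mem_graphOn.2 ⟨hx, rfl⟩)
  have h4 : j x = x := h.map_of_mem (hκ.mem_trans hx hβ)
  have h5 : y = j (f x) := hfun y hy _ ((h.mem_iff (h.mem_of_mem hfx) h.dom.self_mem).1 hfx)
    (by show ZFSet.pair (j x) y ∈ _; rw [h4]; exact hxy) h3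
  rw [h.map_of_mem hfx] at h5
  exact hyκ (h5 ▸ hfx)

theorem card_lt {β : ZFSet.{0}} (hβ : β ∈ κ) : β.card < κ.card := by
  by_contra hle
  obtain ⟨f, hf, hs⟩ := exists_surj_of_card_le (not_lt.1 hle) ⟨β, hβ⟩
  obtain ⟨δ, hδ, hb⟩ := h.bdd hκ hβ hf
  obtain ⟨x, hx, rfl⟩ := hs δ hδ
  exact mem_irrefl _ (hb x hx)

theorem aleph0_lt : Cardinal.aleph0 < κ.card := by
  have hlim : ∃ l ∈ κ, (∃ x, x ∈ l) ∧ ∀ x ∈ l, ∃ y ∈ l, x ∈ y := by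
    by_contra hcon
    push Not at hcon
    have h1 := h.exists_of_map
      (n := 0) (fun _ v => ¬ v 0 = ∅ → ∃ x, x ∈ v 0 ∧ ∀ y, y ∈ v 0 → ¬ x ∈ y)
      h.dom.self_mem h.self_mem_map ![] (by simp) (fun l hl hne => by
        exact hcon l hl (by simpa [ZFSet.eq_empty] using hne))
    have h2 : ¬ κ = ∅ → ∃ x, x ∈ κ ∧ ∀ y, y ∈ κ → ¬ x ∈ y := h1
    have hne : ¬ κ = ∅ := fun he => by
      have h3 := (h.iff (n := 1) (fun _ v => v 0 = ∅) ![κ] (by simp [h.dom.self_mem])).1 he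
      have h4 : j κ = ∅ := h3
      exact notMem_empty κ (h4 ▸ h.self_mem_map)
    obtain ⟨x, hx, hxy⟩ := h2 hne
    exact hxy _ (h.succ_mem hκ hx) (mem_insert x x)
  obtain ⟨l, hl, hne, hs⟩ := hlim
  refine lt_of_le_of_lt ?_ (h.card_lt hκ hl)
  have hlo := hκ.mem hl
  rw [← hlo.toZFSet_rank_eq, Ordinal.card_toZFSet, ← Cardinal.ord_le, Cardinal.ord_aleph0]
  by_contra hlt
  obtain ⟨n, hn⟩ := Ordinal.lt_omega0.1 (not_le.1 hlt)
  have hl' : l = Ordinal.toZFSet n := by rw [← hn, hlo.toZFSet_rank_eq]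
  subst hl'
  cases n with
  | zero =>
    obtain ⟨x, hx⟩ := hne
    simp [Ordinal.toZFSet_zero] at hx
  | succ n =>
    have hn1 : Ordinal.toZFSet n ∈ Ordinal.toZFSet ((n + 1 : ℕ) : Ordinal) := by
      rw [Ordinal.toZFSet_mem_toZFSet_iff]; exact_mod_cast Nat.lt_succ_self n
    obtain ⟨y, hy, hny⟩ := hs _ hn1
    obtain ⟨a, ha, rfl⟩ := Ordinal.mem_toZFSet_iff.1 hy
    rw [Ordinal.toZFSet_mem_toZFSet_iff] at hny
    rw [Nat.cast_succ, Order.lt_add_one_iff] at ha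
    exact absurd hny (not_lt.2 ha)

theorem isLargeCardinal : IsLargeCardinal κ where
  ord := hκ
  succ_mem _ hβ := h.succ_mem hκ hβ
  card_lt _ hβ := h.card_lt hκ hβ
  aleph0_lt := h.aleph0_lt hκ
  power_le _ hβ := h.dom.power_le hβ

end IsCritEmbedding

/-! ## Hereditary cardinality -/

/-- The components of an ordered pair. -/
noncomputable def unpair (p : ZFSet.{0}) : ZFSet.{0} × ZFSet.{0} :=
  Classical.epsilon fun q => p = ZFSet.pair q.1 q.2

@[simp]
theorem unpair_pair (x y : ZFSet.{0}) : unpair (ZFSet.pair x y) = (x, y) := by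
  have h := Classical.epsilon_spec (p := fun q : ZFSet.{0} × ZFSet.{0} =>
    ZFSet.pair x y = ZFSet.pair q.1 q.2) ⟨(x, y), rfl⟩
  have h' := pair_inj.1 h
  exact Prod.ext h'.1.symm h'.2.symm

theorem card_prod_le (a b : ZFSet.{0}) : (ZFSet.prod a b).card ≤ a.card * b.card := by
  rw [← Cardinal.lift_le.{1}, Cardinal.lift_mul, ← cardinalMk_coe_sort, ← cardinalMk_coe_sort,
    ← cardinalMk_coe_sort, Cardinal.mul_def]
  have hm : ∀ z : ↥(ZFSet.prod a b), (unpair z.1).1 ∈ a ∧ (unpair z.1).2 ∈ b ∧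
      z.1 = ZFSet.pair (unpair z.1).1 (unpair z.1).2 := by
    rintro ⟨z, hz⟩
    obtain ⟨x, hx, y, hy, rfl⟩ := mem_prod.1 hz
    simp [hx, hy]
  refine Cardinal.mk_le_of_injective
    (f := fun z => ((⟨_, (hm z).1⟩, ⟨_, (hm z).2.1⟩) : a × b)) fun z w hzw => ?_
  simp only [Prod.mk.injEq, Subtype.mk.injEq] at hzw
  exact Subtype.ext (by rw [(hm z).2.2, (hm w).2.2, hzw.1, hzw.2])

theorem card_sUnion_le_mul {a c : ZFSet.{0}} (h : ∀ y ∈ a, y.card ≤ c.card) :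
    (⋃₀ a : ZFSet).card ≤ a.card * c.card := by
  have h1 : ∀ y ∈ a, ∃ f : ZFSet.{0} → ZFSet.{0}, ∀ z ∈ y, ∃ x ∈ c, f x = z := fun y hy => by
    by_cases hne : ∃ z, z ∈ y
    · obtain ⟨f, -, hf⟩ := exists_surj_of_card_le (h y hy) hne
      exact ⟨f, hf⟩
    · exact ⟨id, fun z hz => absurd ⟨z, hz⟩ hne⟩
  choose! s hs using h1
  refine (card_le_of_surj (a := ZFSet.prod a c) (fun z => s (unpair z).1 (unpair z).2) ?_).trans
    (card_prod_le a c)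
  intro z hz
  obtain ⟨y, hy, hzy⟩ := mem_sUnion.1 hz
  obtain ⟨x, hx, rfl⟩ := hs y hy z hzy
  exact ⟨ZFSet.pair y x, pair_mem_prod.2 ⟨hy, hx⟩, by simp⟩

/-- `x` belongs to a transitive set of cardinality at most that of `κ`. -/
def HereditarilyLE (κ x : ZFSet.{0}) : Prop :=
  ∃ t : ZFSet.{0}, t.IsTransitive ∧ x ∈ t ∧ t.card ≤ κ.card

namespace HereditarilyLE

variable {κ x y : ZFSet.{0}}

theorem mem (hx : HereditarilyLE κ x) (hy : y ∈ x) : HereditarilyLE κ y :=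
  let ⟨t, ht, hxt, hc⟩ := hx
  ⟨t, ht, ht.mem_trans hy hxt, hc⟩

theorem card_le (hx : HereditarilyLE κ x) : x.card ≤ κ.card :=
  let ⟨_, ht, hxt, hc⟩ := hx
  (card_mono (ht.subset_of_mem hxt)).trans hc

theorem of_forall (hκ : Cardinal.aleph0 ≤ κ.card) (hc : x.card ≤ κ.card)
    (h : ∀ y ∈ x, HereditarilyLE κ y) : HereditarilyLE κ x := by
  choose! t ht hyt htc using h
  have hU : (⋃₀ myImage t x : ZFSet).IsTransitive := IsTransitive.sUnion' fun z hz => by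
    obtain ⟨y, hy, rfl⟩ := mem_myImage.1 hz
    exact ht y hy
  refine ⟨insert x (⋃₀ myImage t x : ZFSet), ?_, mem_insert _ _, ?_⟩
  · intro z hz w hw
    refine mem_insert_iff.2 (Or.inr ?_)
    rcases mem_insert_iff.1 hz with rfl | hz
    · exact mem_sUnion.2 ⟨t w, mem_myImage.2 ⟨w, hw, rfl⟩, hyt w hw⟩
    · exact hU.mem_trans hw hz
  · refine card_insert_le.trans ?_
    refine (add_le_add (card_sUnion_le_mul (c := κ) fun z hz => ?_) le_rfl).trans ?_
    · obtain ⟨y, hy, rfl⟩ := mem_myImage.1 hz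
      exact htc y hy
    · refine Cardinal.add_le_of_le hκ (Cardinal.mul_le_of_le hκ
        ((card_myImage_le _ _).trans hc) le_rfl) (Cardinal.one_le_aleph0.trans hκ)

theorem subset (hκ : Cardinal.aleph0 ≤ κ.card) (hy : HereditarilyLE κ y) (h : x ⊆ y) :
    HereditarilyLE κ x :=
  of_forall hκ ((card_mono h).trans hy.card_le) fun _ hz => hy.mem (h hz)

theorem insert (hκ : Cardinal.aleph0 ≤ κ.card) (hx : HereditarilyLE κ x) (hy : HereditarilyLE κ y) :
    HereditarilyLE κ (Insert.insert x y) :=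
  of_forall hκ (card_insert_le.trans (Cardinal.add_le_of_le hκ hy.card_le
    (Cardinal.one_le_aleph0.trans hκ))) fun z hz => by
      rcases mem_insert_iff.1 hz with rfl | hz
      · exact hx
      · exact hy.mem hz

theorem empty (hκ : Cardinal.aleph0 ≤ κ.card) : HereditarilyLE κ ∅ :=
  of_forall hκ (by simp) fun z hz => absurd hz (notMem_empty z)

theorem singleton (hκ : Cardinal.aleph0 ≤ κ.card) (hx : HereditarilyLE κ x) :
    HereditarilyLE κ {x} := by
  have := hx.insert hκ (empty hκ)
  rwa [show (Insert.insert x ∅ : ZFSet.{0}) = {x} by ext; simp] at this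

theorem pair (hκ : Cardinal.aleph0 ≤ κ.card) (hx : HereditarilyLE κ x) (hy : HereditarilyLE κ y) :
    HereditarilyLE κ (ZFSet.pair x y) :=
  (hx.singleton hκ).insert hκ ((hx.insert hκ (hy.singleton hκ)).singleton hκ)

theorem self (hκ : Cardinal.aleph0 ≤ κ.card) (ho : κ.IsTransitive) : HereditarilyLE κ κ :=
  ⟨Insert.insert κ κ, fun z hz w hw => by
    rw [mem_insert_iff] at hz ⊢
    rcases hz with rfl | hz
    · exact Or.inr hw
    · exact Or.inr (ho.mem_trans hw hz),
    mem_insert _ _, card_insert_le.trans (Cardinal.add_le_of_le hκ le_rfl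
    (Cardinal.one_le_aleph0.trans hκ))⟩

theorem graphOn (hκ : Cardinal.aleph0 ≤ κ.card) {a : ZFSet.{0}} (ha : HereditarilyLE κ a)
    {f : ZFSet.{0} → ZFSet.{0}} (hf : ∀ x ∈ a, HereditarilyLE κ (f x)) :
    HereditarilyLE κ (graphOn f a) := by
  refine of_forall hκ ((card_le_of_surj (a := a) (fun x => ZFSet.pair x (f x)) fun z hz => ?_).trans
    ha.card_le) fun z hz => ?_
  · obtain ⟨x, hx, rfl⟩ := mem_graphOn.1 hz
    exact ⟨x, hx, rfl⟩
  · obtain ⟨x, hx, rfl⟩ := mem_graphOn.1 hz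
    exact (ha.mem hx).pair hκ (hf x hx)

end HereditarilyLE

/-! ## Gödel pairing -/

/-- Gödel's well-ordering of pairs of ordinals. -/
def GoedelLT (a b c d : ZFSet.{0}) : Prop :=
  a ∪ b ∈ c ∪ d ∨ a ∪ b = c ∪ d ∧ (a ∈ c ∨ a = c ∧ b ∈ d)

/-- The graph of Gödel's well-ordering on `κ × κ`. -/
noncomputable def goedelRel (κ : ZFSet.{0}) : ZFSet.{0} :=
  ZFSet.sep (fun z => ∃ a ∈ κ, ∃ b ∈ κ, ∃ c ∈ κ, ∃ d ∈ κ,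
      z = ZFSet.pair (ZFSet.pair a b) (ZFSet.pair c d) ∧ GoedelLT a b c d)
    (ZFSet.prod (ZFSet.prod κ κ) (ZFSet.prod κ κ))

theorem mem_goedelRel {κ a b c d : ZFSet.{0}} (ha : a ∈ κ) (hb : b ∈ κ) (hc : c ∈ κ) (hd : d ∈ κ) :
    ZFSet.pair (ZFSet.pair a b) (ZFSet.pair c d) ∈ goedelRel κ ↔ GoedelLT a b c d := by
  simp only [goedelRel, mem_sep, pair_mem_prod, ha, hb, hc, hd, true_and, and_self]
  constructor
  · rintro ⟨a', _, b', _, c', _, d', _, he, h⟩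
    simp only [pair_inj] at he
    obtain ⟨⟨rfl, rfl⟩, rfl, rfl⟩ := he
    exact h
  · exact fun h => ⟨a, ha, b, hb, c, hc, d, hd, rfl, h⟩

theorem goedelRel_wf (κ : ZFSet.{0}) : WellFounded fun x y => ZFSet.pair x y ∈ goedelRel κ := by
  have hw : WellFounded (Prod.Lex (α := ZFSet.{0}) (· ∈ ·)
      (Prod.Lex (α := ZFSet.{0}) (β := ZFSet.{0}) (· ∈ ·) (· ∈ ·))) :=
    WellFounded.prod_lex mem_wf (WellFounded.prod_lex mem_wf mem_wf)
  refine Subrelation.wf ?_ (InvImage.wf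
    (fun z => ((unpair z).1 ∪ (unpair z).2, (unpair z).1, (unpair z).2)) hw)
  intro x y hxy
  obtain ⟨-, a, -, b, -, c, -, d, -, he, h⟩ := mem_sep.1 hxy
  obtain ⟨rfl, rfl⟩ := pair_inj.1 he
  simp only [InvImage, unpair_pair]
  rcases h with h | ⟨h, h' | ⟨h', h''⟩⟩
  · exact Prod.Lex.left _ _ h
  · rw [h]
    exact Prod.Lex.right _ (Prod.Lex.left _ _ h')
  · rw [h, h']
    exact Prod.Lex.right _ (Prod.Lex.right _ h'')

/-- Gödel's pairing function, on pairs of elements of `κ`. -/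
noncomputable def goedelPair (κ : ZFSet.{0}) : ZFSet.{0} → ZFSet.{0} :=
  mostowski (ZFSet.prod κ κ) (goedelRel_wf κ)

instance Dfn.eqUnion {n : ℕ} (i j k : Fin n) : Dfn n (fun _ v => v k = v i ∪ v j) :=
  Dfn.congr (R := fun _ v => (∀ x, x ∈ v k → x ∈ v i ∨ x ∈ v j) ∧ v i ⊆ v k ∧ v j ⊆ v k)
    inferInstance fun M _ v _ => by
      refine Iff.symm ⟨?_, ?_⟩
      · rintro ⟨h1, h2, h3⟩
        ext x
        rw [mem_union]
        exact ⟨h1 x, fun h => h.elim (fun h => h2 h) fun h => h3 h⟩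
      · intro h
        rw [h]
        exact ⟨fun x => mem_union.1, fun x hx => mem_union.2 (Or.inl hx),
          fun x hx => mem_union.2 (Or.inr hx)⟩

theorem goedelRel_mem {κ M : ZFSet.{0}} (hM : M.IsTransitive) (hZ : ModelsZFCminus M) (hκ : κ ∈ M) :
    goedelRel κ ∈ M := by
  have hp := zprod_mem hM hZ hκ hκ
  have hh : ∀ z, (∃ a ∈ κ, ∃ b ∈ κ, ∃ c ∈ κ, ∃ d ∈ κ,
      z = ZFSet.pair (ZFSet.pair a b) (ZFSet.pair c d) ∧ GoedelLT a b c d) ↔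
      ∃ a, a ∈ κ ∧ ∃ b, b ∈ κ ∧ ∃ c, c ∈ κ ∧ ∃ d, d ∈ κ ∧
      (∃ p, p ∈ M ∧ ∃ q, q ∈ M ∧ ∃ u, u ∈ M ∧ ∃ w, w ∈ M ∧ p = ZFSet.pair a b ∧ q = ZFSet.pair c d ∧
        z = ZFSet.pair p q ∧ u = a ∪ b ∧ w = c ∪ d ∧
        (u ∈ w ∨ u = w ∧ (a ∈ c ∨ a = c ∧ b ∈ d))) := fun z => by
    refine exists_congr fun a => and_congr_right fun ha => exists_congr fun b =>
      and_congr_right fun hb => exists_congr fun c => and_congr_right fun hc =>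
      exists_congr fun d => and_congr_right fun hd => ?_
    have ha := hM.mem_trans ha hκ
    have hb := hM.mem_trans hb hκ
    have hc := hM.mem_trans hc hκ
    have hd := hM.mem_trans hd hκ
    constructor
    · rintro ⟨h1, h2⟩
      exact ⟨_, pair_mem hM hZ ha hb, _, pair_mem hM hZ hc hd, _, union_mem hM hZ ha hb, _,
        union_mem hM hZ hc hd, rfl, rfl, h1, rfl, rfl, h2⟩
    · rintro ⟨_, _, _, _, _, _, _, _, rfl, rfl, h1, rfl, rfl, h2⟩
      exact ⟨h1, h2⟩
  simp only [goedelRel, hh]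
  exact exists_sep_mem hM hZ (n := 1) (fun M v z => ∃ a, a ∈ v 0 ∧ ∃ b, b ∈ v 0 ∧ ∃ c, c ∈ v 0 ∧
    ∃ d, d ∈ v 0 ∧ (∃ p, p ∈ M ∧ ∃ q, q ∈ M ∧ ∃ u, u ∈ M ∧ ∃ w, w ∈ M ∧ p = ZFSet.pair a b ∧
      q = ZFSet.pair c d ∧ z = ZFSet.pair p q ∧ u = a ∪ b ∧ w = c ∪ d ∧
        (u ∈ w ∨ u = w ∧ (a ∈ c ∨ a = c ∧ b ∈ d)))) (v := ![κ]) (by simp [hκ])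
    (zprod_mem hM hZ hp hp)

section

variable {κ : ZFSet.{0}} (hκ : κ.IsOrdinal)

include hκ

theorem GoedelLT.trans {a b c d e f : ZFSet.{0}} (he : e ∈ κ) (hf : f ∈ κ)
    (h1 : GoedelLT a b c d) (h2 : GoedelLT c d e f) : GoedelLT a b e f := by
  have hef : (e ∪ f).IsTransitive := (hκ.mem he).isTransitive.union (hκ.mem hf).isTransitive
  rcases h1 with h1 | ⟨h1, h1'⟩
  · rcases h2 with h2 | ⟨h2, -⟩
    · exact Or.inl (hef.mem_trans h1 h2)
    · exact Or.inl (h2 ▸ h1)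
  · rcases h2 with h2 | ⟨h2, h2'⟩
    · exact Or.inl (h1 ▸ h2)
    · refine Or.inr ⟨h1.trans h2, ?_⟩
      rcases h1' with h1' | ⟨rfl, h1'⟩
      · rcases h2' with h2' | ⟨rfl, h2'⟩
        · exact Or.inl ((hκ.mem he).mem_trans h1' h2')
        · exact Or.inl h1'
      · rcases h2' with h2' | ⟨rfl, h2'⟩
        · exact Or.inl h2'
        · exact Or.inr ⟨rfl, (hκ.mem hf).mem_trans h1' h2'⟩

theorem union_mem_of_isOrdinal {a b : ZFSet.{0}} (ha : a ∈ κ) (hb : b ∈ κ) : a ∪ b ∈ κ := by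
  rcases (hκ.mem ha).subset_total (hκ.mem hb) with h | h
  · rwa [show a ∪ b = b by ext x; simpa using fun hx => h hx]
  · rwa [show a ∪ b = a by ext x; simpa using fun hx => h hx]

theorem GoedelLT.trichotomous {a b c d : ZFSet.{0}} (ha : a ∈ κ) (hb : b ∈ κ) (hc : c ∈ κ)
    (hd : d ∈ κ) : GoedelLT a b c d ∨ (a = c ∧ b = d) ∨ GoedelLT c d a b := by
  rcases (hκ.mem (union_mem_of_isOrdinal hκ ha hb)).mem_trichotomous
    (hκ.mem (union_mem_of_isOrdinal hκ hc hd)) with h | h | h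
  · exact Or.inl (Or.inl h)
  · rcases (hκ.mem ha).mem_trichotomous (hκ.mem hc) with h1 | h1 | h1
    · exact Or.inl (Or.inr ⟨h, Or.inl h1⟩)
    · rcases (hκ.mem hb).mem_trichotomous (hκ.mem hd) with h2 | h2 | h2
      · exact Or.inl (Or.inr ⟨h, Or.inr ⟨h1, h2⟩⟩)
      · exact Or.inr (Or.inl ⟨h1, h2⟩)
      · exact Or.inr (Or.inr (Or.inr ⟨h.symm, Or.inr ⟨h1.symm, h2⟩⟩))
    · exact Or.inr (Or.inr (Or.inr ⟨h.symm, Or.inl h1⟩))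
  · exact Or.inr (Or.inr (Or.inl h))

omit hκ in
theorem mem_goedelPair {a b z : ZFSet.{0}} (ha : a ∈ κ) (hb : b ∈ κ) :
    z ∈ goedelPair κ (ZFSet.pair a b) ↔
      ∃ c ∈ κ, ∃ d ∈ κ, GoedelLT c d a b ∧ goedelPair κ (ZFSet.pair c d) = z := by
  rw [goedelPair, mem_mostowski]
  constructor
  · rintro ⟨p, hp, hr, rfl⟩
    obtain ⟨c, hc, d, hd, rfl⟩ := mem_prod.1 hp
    exact ⟨c, hc, d, hd, (mem_goedelRel hc hd ha hb).1 hr, rfl⟩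
  · rintro ⟨c, hc, d, hd, hr, rfl⟩
    exact ⟨_, pair_mem_prod.2 ⟨hc, hd⟩, (mem_goedelRel hc hd ha hb).2 hr, rfl⟩

theorem goedelPair_injective {a b c d : ZFSet.{0}} (ha : a ∈ κ) (hb : b ∈ κ) (hc : c ∈ κ)
    (hd : d ∈ κ) (h : goedelPair κ (ZFSet.pair a b) = goedelPair κ (ZFSet.pair c d)) :
    a = c ∧ b = d := by
  rcases GoedelLT.trichotomous hκ ha hb hc hd with h1 | h1 | h1
  · exact absurd (h ▸ (mem_goedelPair hc hd).2 ⟨a, ha, b, hb, h1, rfl⟩) (mem_irrefl _)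
  · exact h1
  · exact absurd (h ▸ (mem_goedelPair ha hb).2 ⟨c, hc, d, hd, h1, rfl⟩) (mem_irrefl _)

theorem goedelPair_isOrdinal {a b : ZFSet.{0}} (ha : a ∈ κ) (hb : b ∈ κ) :
    (goedelPair κ (ZFSet.pair a b)).IsOrdinal := by
  have htr : ∀ {a b}, a ∈ κ → b ∈ κ → (goedelPair κ (ZFSet.pair a b)).IsTransitive := by
    intro a b ha hb y hy z hz
    obtain ⟨c, hc, d, hd, h1, rfl⟩ := (mem_goedelPair ha hb).1 hy
    obtain ⟨e, he, f, hf, h2, rfl⟩ := (mem_goedelPair hc hd).1 hz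
    exact (mem_goedelPair ha hb).2 ⟨e, he, f, hf, h2.trans hκ ha hb h1, rfl⟩
  refine isOrdinal_iff_forall_mem_isTransitive.2 ⟨htr ha hb, fun y hy => ?_⟩
  obtain ⟨c, hc, d, hd, -, rfl⟩ := (mem_goedelPair ha hb).1 hy
  exact htr hc hd

end

theorem IsLargeCardinal.goedelPair_mem {κ a b : ZFSet.{0}} (h : IsLargeCardinal κ) (ha : a ∈ κ)
    (hb : b ∈ κ) : goedelPair κ (ZFSet.pair a b) ∈ κ := by
  have hm := union_mem_of_isOrdinal h.ord ha hb
  have hs := h.succ_mem _ hm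
  have hlt : (goedelPair κ (ZFSet.pair a b)).card < κ.card := by
    refine lt_of_le_of_lt (card_le_of_surj (a := ZFSet.prod (insert (a ∪ b) (a ∪ b))
      (insert (a ∪ b) (a ∪ b))) (goedelPair κ) fun z hz => ?_)
      (lt_of_le_of_lt (card_prod_le _ _) (Cardinal.mul_lt_of_lt h.aleph0_lt.le
        (h.card_lt _ hs) (h.card_lt _ hs)))
    obtain ⟨c, hc, d, hd, hl, rfl⟩ := (mem_goedelPair ha hb).1 hz
    have hsub : c ∪ d ⊆ a ∪ b := by
      rcases hl with hl | ⟨hl, -⟩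
      · exact (h.ord.mem hm).subset_of_mem hl
      · rw [hl]
    have hmem : ∀ e ∈ κ, e ⊆ a ∪ b → e ∈ insert (a ∪ b) (a ∪ b) := fun e he hsub =>
      mem_insert_iff.2 (((h.ord.mem he).subset_iff_eq_or_mem (h.ord.mem hm)).1 hsub)
    exact ⟨ZFSet.pair c d, pair_mem_prod.2
      ⟨hmem c hc fun x hx => hsub (mem_union.2 (Or.inl hx)),
        hmem d hd fun x hx => hsub (mem_union.2 (Or.inr hx))⟩, rfl⟩
  rcases (goedelPair_isOrdinal h.ord ha hb).mem_or_subset h.ord with h1 | h1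
  · exact h1
  · exact absurd (card_mono h1) (not_le.2 hlt)

/-! ## Capturing arbitrary parameters of hereditary cardinality `κ` -/

/-- Sets of hereditary cardinality at most `κ` can be put into the domain of an embedding
witnessing weak compactness. -/
theorem IsWeaklyCompactIn.exists_embedding {κ S x : ZFSet.{0}} (hκ : κ.IsOrdinal)
    (hS : IsWeaklyCompactSubset κ S) (hx : HereditarilyLE κ x) :
    ∃ M N j, IsCritEmbedding κ M N j ∧ x ∈ M ∧ S ∈ M ∧ κ ∈ j S := by
  obtain ⟨M₀, N₀, j₀, hM₀, hN₀, -, -, hj₀, hc₀, -⟩ := hS.2 ∅ (Set.mem_univ _) (empty_subset κ)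
  have hL := IsCritEmbedding.isLargeCardinal ⟨hM₀, hN₀, hj₀, hc₀⟩ hκ
  obtain ⟨t, ht, hxt, hc⟩ := hx
  obtain ⟨e, he, hes⟩ := exists_surj_of_card_le hc ⟨x, hxt⟩
  obtain ⟨M, N, j, hM, hN, hA, hSM, hj, hcr, hjS⟩ := hS.2
    (myImage (goedelPair κ) (ZFSet.sep (fun z => e (unpair z).1 ∈ e (unpair z).2) (ZFSet.prod κ κ)))
    (Set.mem_univ _) (fun z hz => by
      obtain ⟨p, hp, rfl⟩ := mem_myImage.1 hz
      obtain ⟨a, ha, b, hb, rfl⟩ := mem_prod.1 (mem_sep.1 hp).1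
      exact hL.goedelPair_mem ha hb)
  refine ⟨M, N, j, ⟨hM, hN, hj, hcr⟩, ?_, hSM, hjS⟩
  set A := myImage (goedelPair κ)
    (ZFSet.sep (fun z => e (unpair z).1 ∈ e (unpair z).2) (ZFSet.prod κ κ)) with hAdef
  have hκM := hM.self_mem
  have hG : graphOn (goedelPair κ) (ZFSet.prod κ κ) ∈ M :=
    graphOn_mostowski_mem hM.trans hM.zfc (zprod_mem hM.trans hM.zfc hκM hκM)
      (goedelRel_mem hM.trans hM.zfc hκM) (goedelRel_wf κ)
  have hE := exists_sep_mem hM.trans hM.zfc (n := 2)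
    (fun _ v z => ∃ y, y ∈ v 0 ∧ ZFSet.pair z y ∈ v 1)
    (v := ![A, graphOn (goedelPair κ) (ZFSet.prod κ κ)])
    (by simp [forall_vecCons_mem, hA, hG]) (zprod_mem hM.trans hM.zfc hκM hκM)
  set E := ZFSet.sep (fun z => ∃ y, y ∈ A ∧ ZFSet.pair z y ∈ graphOn (goedelPair κ) (ZFSet.prod κ κ))
    (ZFSet.prod κ κ) with hEdef
  have hEiff : ∀ a b, ZFSet.pair a b ∈ E ↔ a ∈ κ ∧ b ∈ κ ∧ e a ∈ e b := by
    intro a b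
    simp only [hEdef, mem_sep, pair_mem_prod, pair_mem_graphOn, hAdef, mem_myImage]
    constructor
    · rintro ⟨⟨ha, hb⟩, y, ⟨p, ⟨hp, hpe⟩, rfl⟩, -, hpab⟩
      obtain ⟨c, hc, d, hd, rfl⟩ := mem_prod.1 hp
      obtain ⟨rfl, rfl⟩ := goedelPair_injective hL.ord hc hd ha hb hpab
      exact ⟨ha, hb, by simpa using hpe⟩
    · rintro ⟨ha, hb, hab⟩
      exact ⟨⟨ha, hb⟩, _, ⟨ZFSet.pair a b, ⟨pair_mem_prod.2 ⟨ha, hb⟩, by simpa using hab⟩, rfl⟩,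
        ⟨ha, hb⟩, rfl⟩
  have hwf : WellFounded fun a b => ZFSet.pair a b ∈ E :=
    Subrelation.wf (fun {a b} h => ((hEiff a b).1 h).2.2) (InvImage.wf e mem_wf)
  have hcol : ∀ a, a ∈ κ → mostowski κ hwf a = e a := fun a => by
    induction a using hwf.induction with
    | _ a ih =>
      intro ha
      ext z
      rw [mem_mostowski]
      constructor
      · rintro ⟨b, hb, hba, rfl⟩
        rw [ih b hba hb]
        exact ((hEiff b a).1 hba).2.2
      · intro hz
        obtain ⟨b, hb, rfl⟩ := hes z (ht.mem_trans hz (he a ha))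
        have hba := (hEiff b a).2 ⟨hb, ha, hz⟩
        exact ⟨b, hb, hba, ih b hba hb⟩
  obtain ⟨a, ha, rfl⟩ := hes x hxt
  rw [← hcol a ha]
  exact mostowski_mem hM.trans hM.zfc hκM hE hwf ha

/-! ## Blocks of quantifiers and relativization -/

theorem Dfn.forallBlock {n k : ℕ} {P : ZFSet.{0} → (Fin (n + k) → ZFSet.{0}) → Prop}
    (hP : Dfn (n + k) P) :
    Dfn n (fun M v => ∀ y : Fin k → ZFSet.{0}, (∀ i, y i ∈ M) → P M (Fin.append v y)) := by
  induction k with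
  | zero =>
    refine hP.congr fun M _ v _ => ?_
    have h : ∀ y : Fin 0 → ZFSet.{0}, Fin.append v y = v := fun y => by
      rw [Subsingleton.elim y Fin.elim0, Fin.append_elim0]
      rfl
    simp only [h]
    exact ⟨fun h => h Fin.elim0 fun i => i.elim0, fun h _ _ => h⟩
  | succ k ih =>
    have hP' : Dfn (n + k + 1) (fun M u => P M
        (Fin.snoc (fun i : Fin (n + k) => u i.castSucc) (u (Fin.last (n + k))))) :=
      Dfn.congr (n := n + k + 1) hP fun M _ u _ => by
        rw [show (Fin.snoc (fun i : Fin (n + k) => u i.castSucc) (u (Fin.last (n + k))) :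
          Fin (n + k + 1) → ZFSet.{0}) = u from Fin.snoc_init_self u]
    have h := ih (P := fun M u => ∀ x, x ∈ M → P M (Fin.snoc u x))
      (Dfn.all (R := fun M v x => P M (Fin.snoc v x)))
    refine h.congr fun M _ v _ => ⟨fun H y hy x hx => ?_, fun H y hy => ?_⟩
    · have := H (Fin.snoc y x) (Fin.lastCases (by simpa using hx) fun i => by simpa using hy i)
      rwa [Fin.append_snoc] at this
    · have := H (fun i => y i.castSucc) (fun i => hy _) (y (Fin.last k)) (hy _)
      rw [← Fin.append_snoc] at this
      rwa [show (Fin.snoc (fun i : Fin k => y i.castSucc) (y (Fin.last k)) :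
          Fin (k + 1) → ZFSet.{0}) = y from Fin.snoc_init_self y] at this

section

variable {Q : ZFSet.{0}} {n : ℕ} {v : Fin n → ZFSet.{0}}

theorem realizeIn_falsum : ¬ RealizeIn Q (⊥ : memLang.BoundedFormula Empty n) v :=
  fun ⟨_, h⟩ => h

theorem realizeIn_imp {φ ψ : memLang.BoundedFormula Empty n} : RealizeIn Q (φ.imp ψ) v ↔
    (∀ i, v i ∈ Q) ∧ (RealizeIn Q φ v → RealizeIn Q ψ v) := by
  constructor
  · rintro ⟨hv, h⟩
    exact ⟨hv, fun ⟨_, h'⟩ => ⟨hv, BoundedFormula.realize_imp.1 h h'⟩⟩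
  · rintro ⟨hv, h⟩
    exact ⟨hv, BoundedFormula.realize_imp.2 fun h' => (h ⟨hv, h'⟩).2⟩

theorem snoc_mem {x : ZFSet.{0}} (hv : ∀ i, v i ∈ Q) (hx : x ∈ Q) :
    ∀ i, (Fin.snoc v x : Fin (n + 1) → ZFSet.{0}) i ∈ Q :=
  Fin.lastCases (by simpa using hx) fun i => by simpa using hv i

theorem snoc_subtype {x : ZFSet.{0}} (hv : ∀ i, v i ∈ Q) (hx : x ∈ Q) :
    (fun i => (⟨(Fin.snoc v x : Fin (n + 1) → ZFSet.{0}) i, snoc_mem hv hx i⟩ : Q.toSet)) =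
      Fin.snoc (fun i => (⟨v i, hv i⟩ : Q.toSet)) ⟨x, hx⟩ := by
  funext i
  refine Fin.lastCases ?_ (fun i => ?_) i <;> exact Subtype.ext (by simp)

theorem realizeIn_all {φ : memLang.BoundedFormula Empty (n + 1)} : RealizeIn Q φ.all v ↔
    (∀ i, v i ∈ Q) ∧ ∀ x ∈ Q, RealizeIn Q φ (Fin.snoc v x) := by
  constructor
  · rintro ⟨hv, h⟩
    refine ⟨hv, fun x hx => ⟨snoc_mem hv hx, ?_⟩⟩
    rw [snoc_subtype hv hx]
    exact BoundedFormula.realize_all.1 h ⟨x, hx⟩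
  · rintro ⟨hv, h⟩
    refine ⟨hv, BoundedFormula.realize_all.2 fun x => ?_⟩
    have := (h x.1 x.2).2
    rwa [snoc_subtype hv x.2] at this

theorem eq_var_of_term (t : memLang.Term (Empty ⊕ Fin n)) : ∃ i, t = Term.var (Sum.inr i) := by
  cases t with
  | var x =>
    rcases x with e | i
    · exact e.elim
    · exact ⟨i, rfl⟩
  | func f _ => exact Empty.elim f

theorem realizeIn_equal (i j : Fin n) :
    RealizeIn Q (eq' n i j) v ↔ (∀ i, v i ∈ Q) ∧ v i = v j :=
  ⟨fun ⟨hv, h⟩ => ⟨hv, (realize_eq' _ _ _).1 h⟩, fun ⟨hv, h⟩ => ⟨hv, (realize_eq' _ _ _).2 h⟩⟩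

theorem realizeIn_mem (i j : Fin n) :
    RealizeIn Q (mem' n i j) v ↔ (∀ i, v i ∈ Q) ∧ v i ∈ v j :=
  ⟨fun ⟨hv, h⟩ => ⟨hv, (realize_mem' _ _ _).1 h⟩, fun ⟨hv, h⟩ => ⟨hv, (realize_mem' _ _ _).2 h⟩⟩

end

/-- Induction on formulas of the language of set theory. -/
theorem memLang_induction {C : ∀ n, memLang.BoundedFormula Empty n → Prop}
    (falsum : ∀ n, C n ⊥) (equal : ∀ n i j, C n (eq' n i j)) (mem : ∀ n i j, C n (mem' n i j))
    (imp : ∀ n φ ψ, C n φ → C n ψ → C n (φ.imp ψ)) (all : ∀ n φ, C (n + 1) φ → C n φ.all)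
    {n : ℕ} (φ : memLang.BoundedFormula Empty n) : C n φ := by
  induction φ with
  | falsum => exact falsum _
  | equal t₁ t₂ =>
    obtain ⟨i, rfl⟩ := eq_var_of_term t₁
    obtain ⟨j, rfl⟩ := eq_var_of_term t₂
    exact equal _ i j
  | @rel m l R ts =>
    match l, R, ts with
    | 2, R, ts =>
      obtain ⟨i, hi⟩ := eq_var_of_term (ts 0)
      obtain ⟨j, hj⟩ := eq_var_of_term (ts 1)
      have : BoundedFormula.rel R ts = mem' m i j := by
        rw [mem', Relations.boundedFormula₂, Relations.boundedFormula, ← hi, ← hj]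
        congr 1
        funext x
        fin_cases x <;> rfl
      rw [this]
      exact mem _ i j
    | 0, R, _ => exact Empty.elim R
    | 1, R, _ => exact Empty.elim R
    | _ + 3, R, _ => exact Empty.elim R
  | imp f g hf hg => exact imp _ _ _ hf hg
  | all f hf => exact all _ _ hf

/-- Satisfaction in a set is definable. -/
theorem Dfn.realizeIn {k : ℕ} (φ : memLang.BoundedFormula Empty k) :
    ∀ {n : ℕ} (i : Fin n) (f : Fin k → Fin n),
      Dfn n (fun _ v => RealizeIn (v i) φ (fun l => v (f l))) := by
  refine memLang_induction (C := fun k φ => ∀ {n : ℕ} (i : Fin n) (f : Fin k → Fin n),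
      Dfn n (fun _ v => RealizeIn (v i) φ (fun l => v (f l)))) ?_ ?_ ?_ ?_ ?_ φ
  · intro k n i f
    simp only [realizeIn_falsum]
    infer_instance
  · intro k a b n i f
    simp only [realizeIn_equal]
    infer_instance
  · intro k a b n i f
    simp only [realizeIn_mem]
    infer_instance
  · intro k φ ψ hφ hψ n i f
    have := hφ i f
    have := hψ i f
    simp only [realizeIn_imp]
    infer_instance
  · intro k φ hφ n i f
    simp only [realizeIn_all]
    have : Dfn (n + 1) (fun _ u => RealizeIn (u i.castSucc) φ
        (Fin.snoc (fun l => u (f l).castSucc) (u (Fin.last n)))) := by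
      have h := hφ (n := n + 1) i.castSucc (Fin.snoc (fun l => (f l).castSucc) (Fin.last n))
      refine h.congr fun M _ u _ => iff_of_eq (congrArg _ ?_)
      funext l
      refine Fin.lastCases ?_ (fun i => ?_) l <;> simp
    infer_instance

/-- An `∈`-isomorphism preserves satisfaction. -/
theorem realizeIn_iff_of_iso {Q : ZFSet.{0}} {π : ZFSet.{0} → ZFSet.{0}}
    (hinj : ∀ x ∈ Q, ∀ y ∈ Q, π x = π y → x = y)
    (hmem : ∀ x ∈ Q, ∀ y ∈ Q, (π x ∈ π y ↔ x ∈ y)) {n : ℕ} (φ : memLang.BoundedFormula Empty n) :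
    ∀ v : Fin n → ZFSet.{0}, (∀ i, v i ∈ Q) →
      (RealizeIn Q φ v ↔ RealizeIn (myImage π Q) φ fun i => π (v i)) := by
  have him : ∀ x ∈ Q, π x ∈ myImage π Q := fun x hx => mem_myImage.2 ⟨x, hx, rfl⟩
  refine memLang_induction (C := fun n φ => ∀ v : Fin n → ZFSet.{0}, (∀ i, v i ∈ Q) →
      (RealizeIn Q φ v ↔ RealizeIn (myImage π Q) φ fun i => π (v i))) ?_ ?_ ?_ ?_ ?_ φ
  · intro n v hv
    simp only [realizeIn_falsum]
  · intro n i j v hv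
    rw [realizeIn_equal, realizeIn_equal]
    exact and_congr (iff_of_true hv fun i => him _ (hv i))
      ⟨fun h => congrArg π h, hinj _ (hv i) _ (hv j)⟩
  · intro n i j v hv
    rw [realizeIn_mem, realizeIn_mem]
    exact and_congr (iff_of_true hv fun i => him _ (hv i)) (hmem _ (hv i) _ (hv j)).symm
  · intro n φ ψ hφ hψ v hv
    rw [realizeIn_imp, realizeIn_imp, hφ v hv, hψ v hv]
    exact and_congr (iff_of_true hv fun i => him _ (hv i)) Iff.rfl
  · intro n φ hφ v hv
    rw [realizeIn_all, realizeIn_all]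
    refine and_congr (iff_of_true hv fun i => him _ (hv i)) ?_
    have key : ∀ x, (fun i => π ((Fin.snoc v x : Fin (n + 1) → ZFSet.{0}) i)) =
        Fin.snoc (fun i => π (v i)) (π x) := fun x => by
      funext i
      refine Fin.lastCases ?_ (fun i => ?_) i <;> simp
    constructor
    · intro h y hy
      obtain ⟨x, hx, rfl⟩ := mem_myImage.1 hy
      rw [← key, ← hφ _ (snoc_mem hv hx)]
      exact h x hx
    · intro h x hx
      rw [hφ _ (snoc_mem hv hx), key]
      exact h _ (him x hx)

/-- The elementary substructure relation. -/
def IsElemSub (Q M : ZFSet.{0}) : Prop :=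
  ∀ n (φ : memLang.BoundedFormula Empty n) (v : Fin n → ZFSet.{0}), (∀ i, v i ∈ Q) →
    (RealizeIn Q φ v ↔ RealizeIn M φ v)

/-- The Tarski–Vaught criterion. -/
theorem isElemSub_of_witnesses {Q M : ZFSet.{0}} (hQM : Q ⊆ M)
    (hw : ∀ n (φ : memLang.BoundedFormula Empty (n + 1)) (v : Fin n → ZFSet.{0}), (∀ i, v i ∈ Q) →
      (∃ x ∈ M, ¬ RealizeIn M φ (Fin.snoc v x)) → ∃ x ∈ Q, ¬ RealizeIn M φ (Fin.snoc v x)) :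
    IsElemSub Q M := by
  intro n φ
  refine memLang_induction (C := fun n φ => ∀ v : Fin n → ZFSet.{0}, (∀ i, v i ∈ Q) →
    (RealizeIn Q φ v ↔ RealizeIn M φ v)) ?_ ?_ ?_ ?_ ?_ φ
  · intro n v hv
    simp only [realizeIn_falsum]
  · intro n i j v hv
    rw [realizeIn_equal, realizeIn_equal]
    exact and_congr (iff_of_true hv fun i => hQM (hv i)) Iff.rfl
  · intro n i j v hv
    rw [realizeIn_mem, realizeIn_mem]
    exact and_congr (iff_of_true hv fun i => hQM (hv i)) Iff.rfl
  · intro n φ ψ hφ hψ v hv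
    rw [realizeIn_imp, realizeIn_imp, hφ v hv, hψ v hv]
    exact and_congr (iff_of_true hv fun i => hQM (hv i)) Iff.rfl
  · intro n φ hφ v hv
    rw [realizeIn_all, realizeIn_all]
    refine and_congr (iff_of_true hv fun i => hQM (hv i)) ?_
    constructor
    · intro h
      by_contra hc
      push Not at hc
      obtain ⟨x, hx, hn⟩ := hw n φ v hv hc
      exact hn ((hφ _ (snoc_mem hv hx)).1 (h x hx))
    · exact fun h x hx => (hφ _ (snoc_mem hv hx)).2 (h x (hQM hx))

theorem realizeIn_sentence {M : ZFSet.{0}} (φ : memLang.Sentence) (v : Fin 0 → ZFSet.{0}) :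
    RealizeIn M φ v ↔ Sentence.Realize M.toSet φ := by
  constructor
  · rintro ⟨_, h⟩
    rw [Sentence.Realize, Formula.Realize]
    convert h
  · intro h
    rw [Sentence.Realize, Formula.Realize] at h
    exact ⟨fun i => i.elim0, by convert h⟩

theorem IsElemEmbedding.modelsZFCminus {M N : ZFSet.{0}} {j : ZFSet.{0} → ZFSet.{0}}
    (h : IsElemEmbedding M N j) (hM : ModelsZFCminus M) : ModelsZFCminus N := fun φ hφ =>
  (realizeIn_sentence φ _).1 ((h.2 0 φ Fin.elim0 fun i => i.elim0).1
    ((realizeIn_sentence φ _).2 (hM φ hφ)))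

theorem countable_formulas : Countable (Σ n, memLang.BoundedFormula Empty n) := by
  have h1 : ∀ l, Countable (memLang.Functions l) := fun l => inferInstanceAs (Countable Empty)
  have h2 : ∀ l, Countable (memLang.Relations l) := fun l =>
    match l with
    | 2 => inferInstanceAs (Countable Unit)
    | 0 => inferInstanceAs (Countable Empty)
    | 1 => inferInstanceAs (Countable Empty)
    | _ + 3 => inferInstanceAs (Countable Empty)
  have : Countable memLang.Symbols := inferInstanceAs
    (Countable ((Σ l, memLang.Functions l) ⊕ Σ l, memLang.Relations l))
  infer_instance

/-! ## Collapsing elementary submodels -/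

theorem mem_wf' : WellFounded fun x y : ZFSet.{0} => x ∈ y := ZFSet.mem_wf

/-- The transitive collapse of the `∈`-relation on `Q`. -/
noncomputable def collapse (Q : ZFSet.{0}) : ZFSet.{0} → ZFSet.{0} := mostowski Q mem_wf'

theorem mem_collapse {Q x z : ZFSet.{0}} : z ∈ collapse Q x ↔ ∃ y ∈ Q, y ∈ x ∧ collapse Q y = z :=
  mem_mostowski

/-- `M` is closed under sequences of length `< κ`. -/
def SeqClosed (κ M : ZFSet.{0}) : Prop :=
  ∀ β ∈ κ, ∀ f : ZFSet.{0} → ZFSet.{0}, (∀ x ∈ β, f x ∈ M) → graphOn f β ∈ M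

theorem SeqClosed.isFunc_mem {κ M β f : ZFSet.{0}} (h : SeqClosed κ M) (hβ : β ∈ κ)
    (hf : ZFSet.IsFunc β M f) : f ∈ M := by
  obtain ⟨g, hg, rfl⟩ := exists_eq_graphOn hf
  exact h β hβ g hg

theorem IsElemSub.exists_mem {Q M : ZFSet.{0}} (h : IsElemSub Q M) (hQM : Q ⊆ M)
    (hM : M.IsTransitive) {n : ℕ}
    (R : ZFSet.{0} → (Fin (n + 1) → ZFSet.{0}) → Prop) [hR : Dfn (n + 1) R] {v : Fin n → ZFSet.{0}}
    (hv : ∀ i, v i ∈ Q) (hex : ∃ x ∈ M, R M (Fin.snoc v x)) : ∃ x ∈ Q, R M (Fin.snoc v x) := by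
  obtain ⟨φ, hφ⟩ := (Dfn.not (P := R)).out
  have hvM : ∀ i, v i ∈ M := fun i => hQM (hv i)
  have key : ∀ x ∈ M, (RealizeIn M φ (Fin.snoc v x) ↔ ¬ R M (Fin.snoc v x)) := fun x hx =>
    realizeIn_iff_of_dfn (R := fun v => ¬ R M v) (hφ M hM) (snoc_mem hvM hx)
  by_contra hc
  push Not at hc
  have h1 : RealizeIn Q φ.all v := realizeIn_all.2 ⟨hv, fun x hx =>
    (h _ φ _ (snoc_mem hv hx)).2 ((key x (hQM hx)).2 (hc x hx))⟩
  obtain ⟨x, hx, hRx⟩ := hex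
  exact (key x hx).1 ((realizeIn_all.1 ((h _ _ _ hv).1 h1)).2 x hx) hRx

/-- An elementary submodel of `M` containing `κ` and closed under sequences of length `< κ`. -/
structure IsClosedSub (κ M Q : ZFSet.{0}) : Prop where
  trans : M.IsTransitive
  zfc : ModelsZFCminus M
  ord : κ.IsTransitive
  sub : Q ⊆ M
  elem : IsElemSub Q M
  seq : SeqClosed κ Q
  subset : κ ⊆ Q

namespace IsClosedSub

variable {κ M Q : ZFSet.{0}} (h : IsClosedSub κ M Q)

include h

theorem eq_of_forall {x y : ZFSet.{0}} (hx : x ∈ Q) (hy : y ∈ Q) (hxy : ∀ z ∈ Q, z ∈ x ↔ z ∈ y) :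
    x = y := by
  by_contra hne
  have : ∃ z ∈ M, ¬ (z ∈ x ↔ z ∈ y) := by
    by_contra hc
    push Not at hc
    refine hne (ZFSet.ext fun z => ⟨fun hz => ?_, fun hz => ?_⟩)
    · exact (hc z (h.trans.mem_trans hz (h.sub hx))).1 hz
    · exact (hc z (h.trans.mem_trans hz (h.sub hy))).2 hz
  obtain ⟨z, hz, hn⟩ := h.elem.exists_mem h.sub h.trans (n := 2)
    (fun _ v => ¬ (v 2 ∈ v 0 ↔ v 2 ∈ v 1)) (v := ![x, y]) (by simp [forall_vecCons_mem, hx, hy]) this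
  exact hn (hxy z hz)

theorem unordered_pair_mem {x y : ZFSet.{0}} (hx : x ∈ Q) (hy : y ∈ Q) : ({x, y} : ZFSet) ∈ Q := by
  obtain ⟨z, hz, h1, h2, h3⟩ := h.elem.exists_mem h.sub h.trans (n := 2)
    (fun _ v => v 0 ∈ v 2 ∧ v 1 ∈ v 2 ∧ ∀ t, t ∈ v 2 → t = v 0 ∨ t = v 1) (v := ![x, y])
    (by simp [forall_vecCons_mem, hx, hy])
    ⟨{x, y}, _root_.unordered_pair_mem h.trans h.zfc (h.sub hx) (h.sub hy),
      ZFSet.mem_pair.2 (Or.inl rfl), ZFSet.mem_pair.2 (Or.inr rfl), fun t ht => ZFSet.mem_pair.1 ht⟩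
  have : z = {x, y} := ZFSet.ext fun t => by
    rw [ZFSet.mem_pair]
    exact ⟨h3 t, fun ht => ht.elim (fun e => e ▸ h1) fun e => e ▸ h2⟩
  exact this ▸ hz

theorem pair_mem {x y : ZFSet.{0}} (hx : x ∈ Q) (hy : y ∈ Q) : ZFSet.pair x y ∈ Q := by
  have h1 := h.unordered_pair_mem hx hx
  rw [ZFSet.pair_eq_singleton] at h1
  exact h.unordered_pair_mem h1 (h.unordered_pair_mem hx hy)

theorem collapse_injective : ∀ {x : ZFSet.{0}}, x ∈ Q → ∀ {y}, y ∈ Q → collapse Q x = collapse Q y →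
    x = y := by
  intro x
  induction x using mem_wf'.induction with
  | _ x ih =>
    intro hx y hy hxy
    refine h.eq_of_forall hx hy fun z hz => ⟨fun hzx => ?_, fun hzy => ?_⟩
    · have : collapse Q z ∈ collapse Q y := hxy ▸ mem_collapse.2 ⟨z, hz, hzx, rfl⟩
      obtain ⟨w, hw, hwy, e⟩ := mem_collapse.1 this
      rwa [ih z hzx hz hw e.symm]
    · have : collapse Q z ∈ collapse Q x := hxy ▸ mem_collapse.2 ⟨z, hz, hzy, rfl⟩
      obtain ⟨w, hw, hwx, e⟩ := mem_collapse.1 this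
      rwa [← ih w hwx hw hz e]

theorem collapse_mem_collapse_iff {x y : ZFSet.{0}} (hx : x ∈ Q) : collapse Q x ∈ collapse Q y ↔ x ∈ y := by
  refine ⟨fun hxy => ?_, fun hxy => mem_collapse.2 ⟨x, hx, hxy, rfl⟩⟩
  obtain ⟨w, hw, hwy, e⟩ := mem_collapse.1 hxy
  rwa [← h.collapse_injective hw hx e]

theorem collapse_of_mem : ∀ {x : ZFSet.{0}}, x ∈ κ → collapse Q x = x := by
  intro x
  induction x using mem_wf'.induction with
  | _ x ih =>
    intro hx
    ext z
    rw [mem_collapse]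
    constructor
    · rintro ⟨y, -, hyx, rfl⟩
      rwa [ih y hyx (h.ord.mem_trans hyx hx)]
    · intro hz
      have hzκ := h.ord.mem_trans hz hx
      exact ⟨z, h.subset hzκ, hz, ih z hz hzκ⟩

theorem collapse_eq {t : ZFSet.{0}} (h1 : ∀ x ∈ Q, x ∈ t → x ∈ κ) (h2 : κ ⊆ t) :
    collapse Q t = κ := by
  ext z
  rw [mem_collapse]
  constructor
  · rintro ⟨y, hy, hyt, rfl⟩
    rw [h.collapse_of_mem (h1 y hy hyt)]
    exact h1 y hy hyt
  · exact fun hz => ⟨z, h.subset hz, h2 hz, h.collapse_of_mem hz⟩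

omit h in
theorem collapse_unordered_pair {x y : ZFSet.{0}} (hx : x ∈ Q) (hy : y ∈ Q) :
    collapse Q {x, y} = {collapse Q x, collapse Q y} := by
  ext z
  rw [mem_collapse, ZFSet.mem_pair]
  constructor
  · rintro ⟨w, -, hw, rfl⟩
    exact (ZFSet.mem_pair.1 hw).imp (congrArg _) (congrArg _)
  · rintro (rfl | rfl)
    · exact ⟨x, hx, ZFSet.mem_pair.2 (Or.inl rfl), rfl⟩
    · exact ⟨y, hy, ZFSet.mem_pair.2 (Or.inr rfl), rfl⟩

theorem collapse_pair {x y : ZFSet.{0}} (hx : x ∈ Q) (hy : y ∈ Q) :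
    collapse Q (ZFSet.pair x y) = ZFSet.pair (collapse Q x) (collapse Q y) := by
  have h1 := h.unordered_pair_mem hx hx
  have h2 := collapse_unordered_pair hx hx
  rw [ZFSet.pair_eq_singleton] at h1
  rw [ZFSet.pair_eq_singleton, ZFSet.pair_eq_singleton] at h2
  rw [ZFSet.pair, collapse_unordered_pair h1 (h.unordered_pair_mem hx hy),
    collapse_unordered_pair hx hy, h2, ZFSet.pair]

theorem collapse_graphOn {β : ZFSet.{0}} (hβ : β ∈ κ) {f : ZFSet.{0} → ZFSet.{0}}
    (hf : ∀ x ∈ β, f x ∈ Q) : collapse Q (graphOn f β) = graphOn (fun x => collapse Q (f x)) β := by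
  have hβκ : ∀ x ∈ β, x ∈ κ := fun x hx => h.ord.mem_trans hx hβ
  ext z
  rw [mem_collapse, mem_graphOn]
  constructor
  · rintro ⟨w, -, hw, rfl⟩
    obtain ⟨x, hx, rfl⟩ := mem_graphOn.1 hw
    refine ⟨x, hx, ?_⟩
    rw [h.collapse_pair (h.subset (hβκ x hx)) (hf x hx), h.collapse_of_mem (hβκ x hx)]
  · rintro ⟨x, hx, rfl⟩
    refine ⟨_, h.pair_mem (h.subset (hβκ x hx)) (hf x hx), mem_graphOn.2 ⟨x, hx, rfl⟩, ?_⟩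
    rw [h.collapse_pair (h.subset (hβκ x hx)) (hf x hx), h.collapse_of_mem (hβκ x hx)]

omit h in
theorem collapse_mem {x : ZFSet.{0}} (hx : x ∈ Q) : collapse Q x ∈ myImage (collapse Q) Q :=
  mem_myImage.2 ⟨x, hx, rfl⟩

omit h in
theorem image_isTransitive : (myImage (collapse Q) Q).IsTransitive := by
  intro y hy z hz
  obtain ⟨x, -, rfl⟩ := mem_myImage.1 hy
  obtain ⟨w, hw, -, rfl⟩ := mem_collapse.1 hz
  exact mem_myImage.2 ⟨w, hw, rfl⟩

theorem image_seqClosed : SeqClosed κ (myImage (collapse Q) Q) := by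
  intro β hβ f hf
  choose! g hg hgf using fun x hx => mem_myImage.1 (hf x hx)
  have : graphOn f β = collapse Q (graphOn g β) := by
    rw [h.collapse_graphOn hβ hg]
    ext p
    rw [mem_graphOn, mem_graphOn]
    exact exists_congr fun x => and_congr_right fun hx => by rw [hgf x hx]
  rw [this]
  exact collapse_mem (h.seq β hβ g hg)

theorem realizeIn_image_iff {n : ℕ} (φ : memLang.BoundedFormula Empty n) {v : Fin n → ZFSet.{0}}
    (hv : ∀ i, v i ∈ Q) :
    RealizeIn Q φ v ↔ RealizeIn (myImage (collapse Q) Q) φ fun i => collapse Q (v i) :=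
  realizeIn_iff_of_iso (fun _ hx _ hy => h.collapse_injective hx hy)
    (fun _ hx _ _ => h.collapse_mem_collapse_iff hx) φ v hv

theorem image_modelsZFCminus : ModelsZFCminus (myImage (collapse Q) Q) := by
  have : ModelsZFCminus Q := fun φ hφ => (realizeIn_sentence φ _).1
    ((h.elem 0 φ Fin.elim0 fun i => i.elim0).2 ((realizeIn_sentence φ _).2 (h.zfc φ hφ)))
  exact IsElemEmbedding.modelsZFCminus (j := collapse Q)
    ⟨fun x hx => collapse_mem hx, fun _ φ _ hv => h.realizeIn_image_iff φ hv⟩ this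

theorem image_isKappaModel {t : ZFSet.{0}} (ht : t ∈ Q) (h1 : ∀ x ∈ Q, x ∈ t → x ∈ κ) (h2 : κ ⊆ t)
    (hc : Q.card ≤ κ.card) : IsKappaModel κ (myImage (collapse Q) Q) := by
  have hκ : κ ∈ myImage (collapse Q) Q := h.collapse_eq h1 h2 ▸ collapse_mem ht
  refine ⟨Set.mem_univ _, hκ, image_isTransitive, zcard_eq_iff.2 (le_antisymm
    ((card_myImage_le _ _).trans hc) (card_mono (image_isTransitive.subset_of_mem hκ))), ?_,
    h.image_modelsZFCminus⟩
  exact fun β hβ f _ hf => h.image_seqClosed.isFunc_mem hβ hf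

end IsClosedSub

/-! ## Löwenheim–Skolem -/

theorem exists_closed_subset {A : Type} (B : A → Type) (op : ∀ a, (B a → ZFSet.{0}) → ZFSet.{0})
    {M : ZFSet.{0}} (hop : ∀ a f, (∀ b, f b ∈ M) → op a f ∈ M) {c : Cardinal.{0}}
    (hc : Cardinal.aleph0 ≤ c) (hA : Cardinal.mk A ≤ c) (hB : ∀ a, c ^ Cardinal.mk (B a) ≤ c) :
    ∃ Q ⊆ M, Q.card ≤ c ∧ ∀ a f, (∀ b, f b ∈ Q) → op a f ∈ Q := by
  let ev : WType B → ZFSet.{0} := WType.elim ZFSet.{0} fun ⟨a, f⟩ => op a f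
  have hev : ∀ a f, ev (WType.mk a f) = op a fun b => ev (f b) := fun a f => rfl
  refine ⟨ZFSet.range ev, ?_, ?_, ?_⟩
  · intro x hx
    obtain ⟨w, rfl⟩ := ZFSet.mem_range.1 hx
    induction w with
    | mk a f ih => exact hop a _ fun b => ih b (ZFSet.mem_range.2 ⟨_, rfl⟩)
  · have h1 := ZFSet.lift_card_range_le (f := ev)
    rw [Cardinal.lift_id, Cardinal.lift_id] at h1
    refine h1.trans (WType.cardinalMk_le_of_le ?_)
    refine (Cardinal.sum_le_sum _ (fun _ => c) hB).trans ?_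
    rw [Cardinal.sum_const']
    exact Cardinal.mul_le_of_le hc hA le_rfl
  · intro a f hf
    choose g hg using fun b => ZFSet.mem_range.1 (hf b)
    refine ZFSet.mem_range.2 ⟨WType.mk a g, ?_⟩
    rw [hev]
    exact congrArg _ (funext hg)

theorem IsLargeCardinal.exists_isClosedSub {γ M Y : ZFSet.{0}} (hγ : IsLargeCardinal γ)
    (hM : M.IsTransitive) (hZ : ModelsZFCminus M) (hS : SeqClosed γ M) (hY : Y ⊆ M)
    (hγY : γ ⊆ Y) (hc : Y.card ≤ γ.card) :
    ∃ Q, IsClosedSub γ M Q ∧ Y ⊆ Q ∧ Q.card ≤ γ.card := by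
  have hω := hγ.aleph0_lt.le
  have hne : ∃ m, m ∈ M := by
    by_contra hc
    push Not at hc
    have : γ = ∅ := (ZFSet.eq_empty γ).2 fun x hx => hc x (hY (hγY hx))
    have h0 := hγ.aleph0_lt
    rw [this, ZFSet.card_empty] at h0
    exact not_lt_bot h0
  obtain ⟨m, hm⟩ := hne
  have : Countable (Σ n, memLang.BoundedFormula Empty (n + 1)) := by
    have := countable_formulas
    refine Function.Injective.countable (β := Σ n, memLang.BoundedFormula Empty n)
      (f := fun p => ⟨p.1 + 1, p.2⟩) ?_
    rintro ⟨n, φ⟩ ⟨n', φ'⟩ h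
    obtain ⟨h1, h2⟩ := Sigma.mk.inj h
    cases Nat.succ_injective h1
    cases h2
    rfl
  let A : Type := Shrink Y ⊕ (Σ n, memLang.BoundedFormula Empty (n + 1)) ⊕ Shrink γ
  let B : A → Type := fun a =>
    match a with
    | Sum.inl _ => Empty
    | Sum.inr (Sum.inl p) => Fin p.1
    | Sum.inr (Sum.inr β) => Shrink ((equivShrink γ).symm β).1
  let op : ∀ a, (B a → ZFSet.{0}) → ZFSet.{0} := fun a =>
    match a with
    | Sum.inl y => fun _ => ((equivShrink Y).symm y).1
    | Sum.inr (Sum.inl p) => fun v =>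
      if h : ∃ x ∈ M, ¬ RealizeIn M p.2 (Fin.snoc v x) then h.choose else m
    | Sum.inr (Sum.inr β) => fun v =>
      graphOn (fun x => if hx : x ∈ ((equivShrink γ).symm β).1 then v (equivShrink _ ⟨x, hx⟩) else m)
        ((equivShrink γ).symm β).1
  have hβ : ∀ β, ((equivShrink γ).symm β).1 ∈ γ := fun β => ((equivShrink γ).symm β).2
  have hop : ∀ a f, (∀ b, f b ∈ M) → op a f ∈ M := by
    rintro (y | p | β) f hf
    · exact hY ((equivShrink Y).symm y).2
    · by_cases h : ∃ x ∈ M, ¬ RealizeIn M p.2 (Fin.snoc f x)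
      · simp only [op, dif_pos h]
        exact h.choose_spec.1
      · simp only [op, dif_neg h]
        exact hm
    · refine hS _ (hβ β) _ fun x hx => ?_
      rw [dif_pos hx]
      exact hf _
  have hA : Cardinal.mk A ≤ γ.card := by
    simp only [A, Cardinal.mk_sum, Cardinal.lift_id]
    exact Cardinal.add_le_of_le hω hc
      (Cardinal.add_le_of_le hω ((Cardinal.mk_le_aleph0_iff.2 this).trans hω) le_rfl)
  have hB : ∀ a, γ.card ^ Cardinal.mk (B a) ≤ γ.card := by
    rintro (y | p | β)
    · simpa [B] using Cardinal.one_le_aleph0.trans hω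
    · simp only [B, Cardinal.mk_fin]
      exact Cardinal.power_nat_le hω
    · exact hγ.power_le _ (hβ β)
  obtain ⟨Q, hQM, hQc, hQ⟩ := exists_closed_subset B op hop hω hA hB
  have hYQ : Y ⊆ Q := fun y hy => by
    have := hQ (Sum.inl (equivShrink Y ⟨y, hy⟩)) (fun e => Empty.elim e) fun e => Empty.elim e
    simpa only [op, Equiv.symm_apply_apply] using this
  refine ⟨Q, ⟨hM, hZ, hγ.ord.isTransitive, hQM, isElemSub_of_witnesses hQM fun n φ v hv hex => ?_,
    fun β hβγ f hf => ?_, fun x hx => hYQ (hγY hx)⟩, hYQ, hQc⟩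
  · have := hQ (Sum.inr (Sum.inl ⟨n, φ⟩)) v hv
    simp only [op, dif_pos hex] at this
    exact ⟨_, this, hex.choose_spec.2⟩
  · have key : ∀ β' : Shrink γ, ((equivShrink γ).symm β').1 = β → graphOn f β ∈ Q := by
      rintro β' rfl
      have := hQ (Sum.inr (Sum.inr β')) (fun x => f ((equivShrink _).symm x).1) fun x =>
        hf _ ((equivShrink _).symm x).2
      simp only [op, Equiv.symm_apply_apply] at this
      convert this using 1
      ext p
      rw [mem_graphOn, mem_graphOn]
      exact exists_congr fun x => and_congr_right fun hx => by rw [dif_pos hx]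
    exact key (equivShrink γ ⟨β, hβγ⟩) (by rw [Equiv.symm_apply_apply])

/-! ## Submodels fitting an ordinal -/

theorem isFunc_iff {a b f : ZFSet.{0}} : ZFSet.IsFunc a b f ↔
    (∀ z, z ∈ f → ∃ x, x ∈ a ∧ ∃ y, y ∈ b ∧ z = ZFSet.pair x y) ∧
      ∀ x, x ∈ a → ∃ y, y ∈ b ∧ (ZFSet.pair x y ∈ f ∧ ∀ w, w ∈ b → ZFSet.pair x w ∈ f → w = y) := by
  have hs : f ⊆ ZFSet.prod a b ↔ ∀ z, z ∈ f → ∃ x, x ∈ a ∧ ∃ y, y ∈ b ∧ z = ZFSet.pair x y :=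
    forall₂_congr fun z _ => mem_prod
  rw [ZFSet.IsFunc, hs]
  refine and_congr_right fun h => forall₂_congr fun x hx => ?_
  constructor
  · rintro ⟨y, hy, hu⟩
    obtain ⟨x', -, y', hy', e⟩ := h _ hy
    obtain ⟨rfl, rfl⟩ := pair_inj.1 e
    exact ⟨y, hy', hy, fun w _ hw => hu w hw⟩
  · rintro ⟨y, hy, hxy, hu⟩
    refine ⟨y, hxy, fun w hw => ?_⟩
    obtain ⟨x', -, y', hy', e⟩ := h _ hw
    obtain ⟨rfl, rfl⟩ := pair_inj.1 e
    exact hu w hy' hw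

instance Dfn.isFunc {n : ℕ} (i j k : Fin n) : Dfn n (fun _ v => ZFSet.IsFunc (v i) (v j) (v k)) := by
  simp only [isFunc_iff]
  infer_instance

/-- The first-order requirements on a submodel `p` of `N` that fits `δ`, as witnessed by `g` collapsing
to `δ` and by an enumeration `e` of `N`. -/
def FitBase (δ p N g e : ZFSet.{0}) : Prop :=
  (∀ α, α ∈ δ → ∀ x, x ∈ N → ZFSet.pair α x ∈ e → x ∈ p) ∧ g ∈ p ∧ (∀ x, x ∈ p → x ∈ g → x ∈ δ) ∧
    δ ⊆ p ∧ ∀ β, β ∈ δ → ∀ f, f ∈ N → ZFSet.IsFunc β p f → f ∈ p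

/-- `FitBase`, or elementarity for a given formula. -/
def Fit (c : Option (Σ n, memLang.BoundedFormula Empty n)) (δ p N g e : ZFSet.{0}) : Prop :=
  match c with
  | none => FitBase δ p N g e
  | some φ => ∀ x : Fin φ.1 → ZFSet.{0}, (∀ i, x i ∈ p) → (RealizeIn p φ.2 x ↔ RealizeIn N φ.2 x)

theorem Dfn.elemFor {k : ℕ} (φ : memLang.BoundedFormula Empty k) {n : ℕ} (i j : Fin n) :
    Dfn n (fun _ v => ∀ x : Fin k → ZFSet.{0}, (∀ l, x l ∈ v i) →
      (RealizeIn (v i) φ x ↔ RealizeIn (v j) φ x)) := by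
  have h1 : Dfn (n + k) (fun _ u => RealizeIn (u (Fin.castAdd k i)) φ fun l => u (Fin.natAdd n l)) :=
    Dfn.realizeIn φ _ _
  have h2 : Dfn (n + k) (fun _ u => RealizeIn (u (Fin.castAdd k j)) φ fun l => u (Fin.natAdd n l)) :=
    Dfn.realizeIn φ _ _
  have h3 := Dfn.forallBlock (n := n) (k := k)
    (P := fun _ u => (∀ l, u (Fin.natAdd n l) ∈ u (Fin.castAdd k i)) →
      (RealizeIn (u (Fin.castAdd k i)) φ (fun l => u (Fin.natAdd n l)) ↔
        RealizeIn (u (Fin.castAdd k j)) φ fun l => u (Fin.natAdd n l))) inferInstance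
  refine h3.congr fun M hM v hv => ?_
  simp only [Fin.append_left, Fin.append_right]
  exact ⟨fun h y _ => h y, fun h y hy => h y (fun l => hM.mem_trans (hy l) (hv i)) hy⟩

instance Dfn.fit (c : Option (Σ n, memLang.BoundedFormula Empty n)) {n : ℕ} (i j k l m : Fin n) :
    Dfn n (fun _ v => Fit c (v i) (v j) (v k) (v l) (v m)) := by
  rcases c with _ | φ
  · simp only [Fit, FitBase]
    infer_instance
  · exact Dfn.elemFor φ.2 j k

/-- Fitting transfers along the collapse of `Q`. -/
theorem IsClosedSub.fit_of_collapse {γ M Q : ZFSet.{0}} (h : IsClosedSub γ M Q) {δ P g e e' : ZFSet.{0}}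
    {f : ZFSet.{0} → ZFSet.{0}} (hf : ∀ α ∈ γ, f α ∈ Q) (hδ : δ ∈ γ) (hP : P ⊆ Q) (hg : g ∈ Q)
    (he : ∀ α ∈ δ, ∀ x, ZFSet.pair α x ∈ e → x = f α)
    (he' : e' = graphOn (fun α => collapse Q (f α)) γ)
    (c : Option (Σ n, memLang.BoundedFormula Empty n))
    (hc : Fit c δ (myImage (collapse Q) P) (myImage (collapse Q) Q) (collapse Q g) e') :
    Fit c δ P M g e := by
  subst he'
  have hmem : ∀ x ∈ Q, collapse Q x ∈ myImage (collapse Q) P → x ∈ P := fun x hx hxP => by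
    obtain ⟨y, hy, e⟩ := mem_myImage.1 hxP
    rwa [← h.collapse_injective (hP hy) hx e]
  have hδγ : ∀ x ∈ δ, x ∈ γ := fun x hx => h.ord.mem_trans hx hδ
  rcases c with _ | ⟨n, φ⟩
  · obtain ⟨h1, h2, h3, h4, h5⟩ := hc
    refine ⟨fun α hα x _ hx => ?_, hmem _ hg h2, fun x hx hxg => ?_, fun x hx => ?_,
      fun β hβ u hu hfun => ?_⟩
    · rw [he α hα x hx]
      have := hf α (hδγ α hα)
      exact hmem _ this (h1 α hα _ (collapse_mem this) (pair_mem_graphOn.2 ⟨hδγ α hα, rfl⟩))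
    · have := h3 _ (mem_myImage.2 ⟨x, hx, rfl⟩) ((h.collapse_mem_collapse_iff (hP hx)).2 hxg)
      have e := h.collapse_injective (h.subset (hδγ _ this)) (hP hx)
        (h.collapse_of_mem (hδγ _ this))
      rwa [e] at this
    · have := h4 hx
      rw [← h.collapse_of_mem (hδγ x hx)] at this
      exact hmem x (h.subset (hδγ x hx)) this
    · obtain ⟨k, hk, rfl⟩ := exists_eq_graphOn hfun
      have hkQ := h.seq β (hδγ β hβ) k fun x hx => hP (hk x hx)
      refine hmem _ hkQ ?_
      rw [h.collapse_graphOn (hδγ β hβ) fun x hx => hP (hk x hx)]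
      refine h5 β hβ _ ?_ (isFunc_graphOn fun x hx => mem_myImage.2 ⟨_, hk x hx, rfl⟩)
      exact h.image_seqClosed β (hδγ β hβ) _ fun x hx => collapse_mem (hP (hk x hx))
  · intro x hx
    have h1 := realizeIn_iff_of_iso (Q := P) (π := collapse Q)
      (fun _ hx _ hy => h.collapse_injective (hP hx) (hP hy))
      (fun _ hx _ _ => h.collapse_mem_collapse_iff (hP hx)) φ x hx
    rw [h1, hc _ fun i => mem_myImage.2 ⟨_, hx i, rfl⟩,
      ← h.realizeIn_image_iff φ fun i => hP (hx i)]
    exact h.elem _ _ _ fun i => hP (hx i)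

theorem mem_of_pair_mem {M x y : ZFSet.{0}} (hM : M.IsTransitive) (h : ZFSet.pair x y ∈ M) :
    x ∈ M ∧ y ∈ M := by
  have : ({x, y} : ZFSet.{0}) ∈ M := hM.mem_trans (ZFSet.mem_pair.2 (Or.inr rfl)) h
  exact ⟨hM.mem_trans (ZFSet.mem_pair.2 (Or.inl rfl)) this,
    hM.mem_trans (ZFSet.mem_pair.2 (Or.inr rfl)) this⟩

namespace IsCritEmbedding

variable {κ M N : ZFSet.{0}} {j : ZFSet.{0} → ZFSet.{0}} (h : IsCritEmbedding κ M N j)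

include h

theorem eq_map_of_pair_mem {G x y z : ZFSet.{0}} (hG : G ∈ M) (hx : x ∈ M) (hy : y ∈ M)
    (hu : ∀ w, ZFSet.pair x w ∈ G → w = y) (hz : ZFSet.pair (j x) z ∈ j G) : z = j y := by
  have hzN : z ∈ N :=
    (mem_of_pair_mem h.cod.trans (h.cod.trans.mem_trans hz (h.map_mem hG))).2
  exact (h.iff (n := 3) (fun M v => ∀ w, w ∈ M → ZFSet.pair (v 1) w ∈ v 0 → w = v 2) ![G, x, y]
    (by simp [forall_vecCons_mem, hG, hx, hy])).1 (fun w _ => hu w) z hzN hz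

theorem map_graphOn {β : ZFSet.{0}} (hβ : β ∈ κ) {f : ZFSet.{0} → ZFSet.{0}}
    (hf : ∀ x ∈ β, f x ∈ M) (hκ : κ.IsTransitive) :
    j (graphOn f β) = graphOn (fun x => j (f x)) β := by
  have hG := h.dom.graphOn_mem hβ hf
  have hβM := h.mem_of_mem hβ
  have hβκ : ∀ x ∈ β, x ∈ κ := fun x hx => hκ.mem_trans hx hβ
  ext z
  rw [mem_graphOn]
  constructor
  · intro hz
    have h1 := (h.iff (n := 2) (fun M v => ∀ z, z ∈ v 0 → ∃ x, x ∈ v 1 ∧ ∃ y, y ∈ M ∧ z = ZFSet.pair x y)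
      ![graphOn f β, β] (by simp [forall_vecCons_mem, hG, hβM])).1 (fun z hz => by
        obtain ⟨x, hx, rfl⟩ := mem_graphOn.1 hz
        exact ⟨x, hx, f x, hf x hx, rfl⟩)
    obtain ⟨x, hx, y, -, rfl⟩ := h1 z hz
    replace hx : x ∈ j β := hx
    rw [h.map_of_mem hβ] at hx
    refine ⟨x, hx, ?_⟩
    rw [h.eq_map_of_pair_mem (z := y) hG (h.mem_of_mem (hβκ x hx)) (hf x hx)
      (fun w hw => (pair_mem_graphOn.1 hw).2) (by rwa [h.map_of_mem (hβκ x hx)])]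
  · rintro ⟨x, hx, rfl⟩
    have := (h.pair_mem_iff (h.mem_of_mem (hβκ x hx)) (hf x hx) hG).1
      (pair_mem_graphOn.2 ⟨hx, rfl⟩)
    rwa [h.map_of_mem (hβκ x hx)] at this

theorem image_fit {P e : ZFSet.{0}} (hκ : κ.IsTransitive) (hP : P ∈ M) (hseq : SeqClosed κ P)
    (hκP : κ ∈ P) (hsub : κ ⊆ P) {f : ZFSet.{0} → ZFSet.{0}}
    (hf : ∀ α ∈ κ, f α ∈ P) (he : e = graphOn f κ) (heM : e ∈ M)
    (c : Option (Σ n, memLang.BoundedFormula Empty n)) :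
    Fit c κ (myImage j P) (j P) (j κ) (j e) := by
  have hPM : ∀ x ∈ P, x ∈ M := fun x hx => h.dom.trans.mem_trans hx hP
  rcases c with _ | ⟨n, φ⟩
  · refine ⟨fun α hα x _ hx => ?_, mem_myImage.2 ⟨κ, hκP, rfl⟩, fun x hx hxκ => ?_, fun x hx => ?_,
      fun β hβ u hu hfun => ?_⟩
    · rw [h.eq_map_of_pair_mem (z := x) heM (h.mem_of_mem hα) (hPM _ (hf α hα))
        (fun w hw => (pair_mem_graphOn.1 (he ▸ hw)).2) (by rwa [h.map_of_mem hα])]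
      exact mem_myImage.2 ⟨_, hf α hα, rfl⟩
    · obtain ⟨y, hy, rfl⟩ := mem_myImage.1 hx
      have := (h.mem_iff (hPM y hy) h.dom.self_mem).2 hxκ
      rwa [h.map_of_mem this]
    · exact mem_myImage.2 ⟨x, hsub hx, h.map_of_mem hx⟩
    · obtain ⟨k, hk, rfl⟩ := exists_eq_graphOn hfun
      choose! k' hk' hkk using fun x hx => mem_myImage.1 (hk x hx)
      refine mem_myImage.2 ⟨graphOn k' β, hseq β hβ _ hk', ?_⟩
      rw [h.map_graphOn hβ (fun x hx => hPM _ (hk' x hx)) hκ]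
      ext p
      rw [mem_graphOn, mem_graphOn]
      exact exists_congr fun x => and_congr_right fun hx => by rw [hkk x hx]
  · intro x hx
    choose y hy hyx using fun i => mem_myImage.1 (hx i)
    obtain rfl : (fun i => j (y i)) = x := funext hyx
    rw [← realizeIn_iff_of_iso (Q := P) (π := j) (fun a ha b hb => (h.eq_iff (hPM a ha) (hPM b hb)).2)
      (fun a ha b hb => (h.mem_iff (hPM a ha) (hPM b hb)).symm) φ y hy]
    have : Dfn (n + 1) (fun _ v => RealizeIn (v (Fin.last n)) φ fun l => v l.castSucc) :=
      Dfn.realizeIn φ _ _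
    have := h.iff (fun _ v => RealizeIn (v (Fin.last n)) φ fun l => v l.castSucc)
      (Fin.snoc y P) (snoc_mem (fun i => hPM _ (hy i)) hP)
    simpa using this

end IsCritEmbedding

theorem IsLargeCardinal.exists_aleph0_le {κ : ZFSet.{0}} (hκ : IsLargeCardinal κ) :
    ∃ β ∈ κ, Cardinal.aleph0 ≤ β.card := by
  refine ⟨Ordinal.toZFSet Ordinal.omega0, ?_, by simp [Ordinal.card_toZFSet]⟩
  have h := hκ.aleph0_lt
  rw [← hκ.ord.toZFSet_rank_eq] at h ⊢
  rw [Ordinal.toZFSet_mem_toZFSet_iff]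
  rw [Ordinal.card_toZFSet] at h
  by_contra hle
  have := Ordinal.card_le_card (not_lt.1 hle)
  rw [Ordinal.card_omega0] at this
  exact absurd h (not_lt.2 this)

/-- `κ`-completeness of the ultrafilter derived from `j`. -/
theorem IsCritEmbedding.exists_mem_map {κ M N : ZFSet.{0}} {j : ZFSet.{0} → ZFSet.{0}}
    (h : IsCritEmbedding κ M N j) (hκ : κ.IsOrdinal) {T β : ZFSet.{0}} (hT : T ∈ M) (hκT : κ ∈ j T)
    (hβ : β ∈ κ) {E : ZFSet.{0} → ZFSet.{0}} (hE : ∀ i ∈ β, E i ∈ M)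
    (hall : ∀ δ ∈ T, ∃ i ∈ β, δ ∈ E i) : ∃ i ∈ β, κ ∈ j (E i) := by
  have hG := h.dom.graphOn_mem hβ hE
  have h1 := h.exists_of_map (n := 2)
    (fun M v => ∃ i, i ∈ v 1 ∧ ∃ e, e ∈ M ∧ (ZFSet.pair i e ∈ v 2 ∧ v 0 ∈ e)) hT hκT
    ![β, graphOn E β] (by simp [forall_vecCons_mem, hG, h.mem_of_mem hβ]) (fun δ hδ => by
      obtain ⟨i, hi, hiE⟩ := hall δ hδ
      exact ⟨i, hi, E i, hE i hi, pair_mem_graphOn.2 ⟨hi, rfl⟩, hiE⟩)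
  have h2 : ∃ i, i ∈ j β ∧ ∃ e, e ∈ N ∧ (ZFSet.pair i e ∈ j (graphOn E β) ∧ κ ∈ e) := h1
  obtain ⟨i, hi, e, -, hp, he⟩ := h2
  rw [h.map_of_mem hβ] at hi
  rw [h.map_graphOn hβ hE hκ.isTransitive, pair_mem_graphOn] at hp
  exact ⟨i, hi, hp.2 ▸ he⟩

theorem IsLargeCardinal.exists_enum {κ : ZFSet.{0}} (hκ : IsLargeCardinal κ) (ι : Type) [Countable ι]
    [Nonempty ι] : ∃ β ∈ κ, ∃ s : ZFSet.{0} → ι, ∀ c, ∃ x ∈ β, s x = c := by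
  obtain ⟨β, hβ, hc⟩ := hκ.exists_aleph0_le
  have h1 : Cardinal.mk ι ≤ Cardinal.mk (Shrink.{0} β) := Cardinal.mk_le_aleph0.trans hc
  obtain ⟨k⟩ := Cardinal.le_def _ _ |>.1 h1
  have hF : Function.Injective fun c => (((equivShrink β).symm (k c)).1 : ZFSet.{0}) :=
    Subtype.val_injective.comp ((equivShrink β).symm.injective.comp k.injective)
  exact ⟨β, hβ, Function.invFun _, fun c => ⟨_, ((equivShrink β).symm (k c)).2,
    Function.leftInverse_invFun hF c⟩⟩

theorem IsWeaklyCompactIn.isLargeCardinal {κ S : ZFSet.{0}} (hκ : κ.IsOrdinal)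
    (hS : IsWeaklyCompactSubset κ S) : IsLargeCardinal κ :=
  let ⟨_, _, _, hM, hN, _, _, hj, hc, _⟩ := hS.2 ∅ (Set.mem_univ _) (empty_subset κ)
  IsCritEmbedding.isLargeCardinal ⟨hM, hN, hj, hc⟩ hκ

theorem HereditarilyLE.of_isTransitive {κ M : ZFSet.{0}} (hκ : Cardinal.aleph0 ≤ κ.card)
    (hM : M.IsTransitive) (hc : M.card ≤ κ.card) : HereditarilyLE κ M :=
  .of_forall hκ hc fun _ hy => ⟨M, hM, hy, hc⟩

theorem IsWeaklyCompactIn.exists_fit {γ P T : ZFSet.{0}} {f g : ZFSet.{0} → ZFSet.{0}}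
    (hγ : γ.IsOrdinal) (hT : IsWeaklyCompactSubset γ T) (hP : P.IsTransitive) (hseq : SeqClosed γ P)
    (hγP : γ ∈ P) (hc : P.card ≤ γ.card) (hf : ∀ α ∈ γ, f α ∈ P) (hfs : ∀ x ∈ P, ∃ α ∈ γ, f α = x)
    (hg : ∀ α ∈ γ, g α ∈ P) : ∃ δ ∈ T, ∀ c, Fit c δ (myImage f δ) P γ (graphOn g γ) := by
  by_contra hcon
  push Not at hcon
  have hL := hT.isLargeCardinal hγ
  have hω := hL.aleph0_lt.le
  have : Countable (Σ n, memLang.BoundedFormula Empty n) := countable_formulas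
  obtain ⟨β, hβ, s, hs⟩ := hL.exists_enum (Option (Σ n, memLang.BoundedFormula Empty n))
  set E : ZFSet.{0} → ZFSet.{0} := fun i =>
    ZFSet.sep (fun δ => ¬ Fit (s i) δ (myImage f δ) P γ (graphOn g γ)) T with hE
  have hγH := HereditarilyLE.self hω hγ.isTransitive
  have hPH := HereditarilyLE.of_isTransitive hω hP hc
  have hfH := hγH.graphOn hω fun α hα => hPH.mem (hf α hα)
  have hgH := hγH.graphOn hω fun α hα => hPH.mem (hg α hα)
  have hEH : HereditarilyLE γ (graphOn E β) := (hγH.mem hβ).graphOn hω fun i _ =>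
    hγH.subset hω fun x hx => hT.1 (mem_sep.1 hx).1
  obtain ⟨M, N, j, h, hx, hTM, hγT⟩ := hT.exists_embedding hγ
    (hPH.pair hω (hfH.pair hω (hgH.pair hω hEH)))
  obtain ⟨hPM, hx⟩ := mem_of_pair_mem h.dom.trans hx
  obtain ⟨hfM, hx⟩ := mem_of_pair_mem h.dom.trans hx
  obtain ⟨hgM, hEM⟩ := mem_of_pair_mem h.dom.trans hx
  have hEiM : ∀ i ∈ β, E i ∈ M := fun i hi =>
    (mem_of_pair_mem h.dom.trans (h.dom.trans.mem_trans (pair_mem_graphOn.2 ⟨hi, rfl⟩) hEM)).2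
  obtain ⟨i, hi, hγE⟩ := h.exists_mem_map hγ hTM hγT hβ hEiM fun δ hδ => by
    obtain ⟨c, hc⟩ := hcon δ hδ
    obtain ⟨i, hi, rfl⟩ := hs c
    exact ⟨i, hi, mem_sep.2 ⟨hδ, hc⟩⟩
  have hsubM : ∀ x ∈ P, x ∈ M := fun x hx => h.dom.trans.mem_trans hx hPM
  have himg : ∀ δ ∈ γ, ∀ p, ((∀ x, x ∈ p → ∃ α, α ∈ δ ∧ ZFSet.pair α x ∈ graphOn f γ) ∧
      ∀ α, α ∈ δ → ∀ x, x ∈ M → ZFSet.pair α x ∈ graphOn f γ → x ∈ p) → p = myImage f δ := by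
    rintro δ hδ p ⟨h1, h2⟩
    ext x
    rw [mem_myImage]
    constructor
    · intro hx
      obtain ⟨α, hα, hp⟩ := h1 x hx
      exact ⟨α, hα, (pair_mem_graphOn.1 hp).2.symm⟩
    · rintro ⟨α, hα, rfl⟩
      have hαγ := hγ.isTransitive.mem_trans hα hδ
      exact h2 α hα _ (hsubM _ (hf α hαγ)) (pair_mem_graphOn.2 ⟨hαγ, rfl⟩)
  have h1 := h.exists_of_map (n := 1)
    (fun M v => ∃ p, p ∈ M ∧ ((∀ x, x ∈ p → ∃ α, α ∈ v 0 ∧ ZFSet.pair α x ∈ v 1) ∧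
      ∀ α, α ∈ v 0 → ∀ x, x ∈ M → ZFSet.pair α x ∈ v 1 → x ∈ p)) h.dom.self_mem h.self_mem_map
    ![graphOn f γ] (by simp [hfM]) (fun δ hδ => by
      have hδγ : ∀ x ∈ δ, x ∈ γ := fun x hx => hγ.isTransitive.mem_trans hx hδ
      refine ⟨myImage f δ, h.dom.myImage_mem hδ fun x hx => hsubM _ (hf x (hδγ x hx)), ?_, ?_⟩
      · intro x hx
        obtain ⟨α, hα, rfl⟩ := mem_myImage.1 hx
        exact ⟨α, hα, pair_mem_graphOn.2 ⟨hδγ α hα, rfl⟩⟩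
      · intro α hα x _ hp
        exact mem_myImage.2 ⟨α, hα, (pair_mem_graphOn.1 hp).2.symm⟩)
  have h2 : ∃ p, p ∈ N ∧ ((∀ x, x ∈ p → ∃ α, α ∈ γ ∧ ZFSet.pair α x ∈ j (graphOn f γ)) ∧
      ∀ α, α ∈ γ → ∀ x, x ∈ N → ZFSet.pair α x ∈ j (graphOn f γ) → x ∈ p) := h1
  obtain ⟨p, hpN, hp1, hp2⟩ := h2
  have hp : p = myImage j P := by
    ext x
    rw [mem_myImage]
    constructor
    · intro hx
      obtain ⟨α, hα, hax⟩ := hp1 x hx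
      refine ⟨f α, hf α hα, (h.eq_map_of_pair_mem (z := x) hfM (h.mem_of_mem hα) (hsubM _ (hf α hα))
        (fun w hw => (pair_mem_graphOn.1 hw).2) ?_).symm⟩
      rwa [h.map_of_mem hα]
    · rintro ⟨y, hy, rfl⟩
      obtain ⟨α, hα, rfl⟩ := hfs y hy
      have := (h.pair_mem_iff (h.mem_of_mem hα) (hsubM _ hy) hfM).1 (pair_mem_graphOn.2 ⟨hα, rfl⟩)
      rw [h.map_of_mem hα] at this
      exact hp2 α hα _ (h.map_mem (hsubM _ hy)) this
  have h3 := h.exists_of_map (n := 4)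
    (fun M v => ∀ p, p ∈ M → ((∀ x, x ∈ p → ∃ α, α ∈ v 0 ∧ ZFSet.pair α x ∈ v 1) ∧
      ∀ α, α ∈ v 0 → ∀ x, x ∈ M → ZFSet.pair α x ∈ v 1 → x ∈ p) →
        ¬ Fit (s i) (v 0) p (v 2) (v 3) (v 4)) (hEiM i hi) hγE
    ![graphOn f γ, P, γ, graphOn g γ] (by
      simp [forall_vecCons_mem, hfM, hPM, h.dom.self_mem, hgM]) (fun δ hδ p hp hpi => by
      obtain ⟨hδT, hδ⟩ := mem_sep.1 hδ
      rw [himg δ (hT.1 hδT) p hpi]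
      exact hδ)
  exact h3 p hpN ⟨hp1, hp2⟩ (hp ▸ h.image_fit hγ.isTransitive hPM hseq hγP
    (hP.subset_of_mem hγP) hg rfl hgM (s i))

/-- The absolute part of `IsFit`. -/
def FitCore (X M δ q t s : ZFSet.{0}) : Prop :=
  q ⊆ M ∧ t ∈ X ∧ δ ⊆ t ∧ s ∈ M ∧
    ∀ x, x ∈ q → ∃ α, α ∈ δ ∧ ZFSet.pair α x ∈ s ∧ ∀ y, y ∈ q → ZFSet.pair α y ∈ s → y = x

instance Dfn.fitCore {n : ℕ} (a b c d e f : Fin n) :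
    Dfn n (fun _ v => FitCore (v a) (v b) (v c) (v d) (v e) (v f)) := by
  simp only [FitCore]
  infer_instance

/-- `q` is an elementary submodel of `M` that fits `δ`, collapses `t ∈ X` to `δ`, contains the first `δ`
members of `M` listed by `e`, and is enumerated by `s` in order type `δ`. -/
def IsFit (X M e δ q t s : ZFSet.{0}) : Prop :=
  FitCore X M δ q t s ∧ ∀ c, Fit c δ q M t e

theorem FitCore.card_le {X M δ q t s : ZFSet.{0}} (h : FitCore X M δ q t s) : q.card ≤ δ.card := by
  refine card_le_of_surj (fun α => Classical.epsilon fun x =>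
    x ∈ q ∧ ZFSet.pair α x ∈ s ∧ ∀ y, y ∈ q → ZFSet.pair α y ∈ s → y = x) fun x hx => ?_
  obtain ⟨α, hα, hp, hu⟩ := h.2.2.2.2 x hx
  have := Classical.epsilon_spec (p := fun x =>
    x ∈ q ∧ ZFSet.pair α x ∈ s ∧ ∀ y, y ∈ q → ZFSet.pair α y ∈ s → y = x) ⟨x, hx, hp, hu⟩
  exact ⟨α, hα, hu _ this.1 this.2.1⟩

namespace IsCritEmbedding

variable {κ M' N' : ZFSet.{0}} {j : ZFSet.{0} → ZFSet.{0}} (h : IsCritEmbedding κ M' N' j)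

include h

theorem restrict {M : ZFSet.{0}} (hMM : M ∈ M') : IsElemEmbedding M (j M) j := by
  have hsub : ∀ x ∈ M, x ∈ M' := fun x hx => h.dom.trans.mem_trans hx hMM
  refine ⟨fun x hx => (h.mem_iff (hsub x hx) hMM).1 hx, fun n φ v hv => ?_⟩
  have : Dfn (n + 1) (fun _ v => RealizeIn (v (Fin.last n)) φ fun l => v l.castSucc) :=
    Dfn.realizeIn φ _ _
  have := h.iff (fun _ v => RealizeIn (v (Fin.last n)) φ fun l => v l.castSucc)
    (Fin.snoc v M) (snoc_mem (fun i => hsub _ (hv i)) hMM)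
  simpa using this

theorem map_seqClosed {M : ZFSet.{0}} (hMM : M ∈ M') (hseq : SeqClosed κ M) : SeqClosed κ (j M) := by
  have h1 : ∀ β, β ∈ j κ → ∀ f, f ∈ N' → ZFSet.IsFunc β (j M) f → f ∈ j M :=
    (h.iff (n := 2) (fun M v => ∀ β, β ∈ v 0 → ∀ f, f ∈ M → ZFSet.IsFunc β (v 1) f → f ∈ v 1) ![κ, M]
      (by simp [forall_vecCons_mem, h.dom.self_mem, hMM])).1
      fun β hβ f _ hf => hseq.isFunc_mem hβ hf
  intro β hβ k hk
  refine h1 β ?_ _ (h.cod.graphOn_mem hβ fun x hx => h.cod.trans.mem_trans (hk x hx) (h.map_mem hMM))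
    (isFunc_graphOn hk)
  have := (h.mem_iff (h.mem_of_mem hβ) h.dom.self_mem).1 hβ
  rwa [h.map_of_mem hβ] at this

theorem exists_isFit {X M e K : ZFSet.{0}} {q t s : ZFSet.{0} → ZFSet.{0}} (hX : X ∈ M') (hM : M ∈ M')
    (he : e ∈ M') (hK : K ∈ M') (hκK : κ ∈ j K) (hq : graphOn q K ∈ M') (ht : graphOn t K ∈ M')
    (hs : graphOn s K ∈ M') (hfit : ∀ δ ∈ K, IsFit X M e δ (q δ) (t δ) (s δ)) :
    ∃ q' t' s', IsFit (j X) (j M) (j e) κ q' t' s' := by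
  have hmem : ∀ f : ZFSet.{0} → ZFSet.{0}, graphOn f K ∈ M' →
      ∃ y, y ∈ N' ∧ ZFSet.pair κ y ∈ j (graphOn f K) := fun f hf =>
    h.exists_of_map (n := 1) (fun M v => ∃ y, y ∈ M ∧ ZFSet.pair (v 0) y ∈ v 1) hK hκK ![graphOn f K]
      (by simp [hf]) fun δ hδ => by
        have hp : ZFSet.pair δ (f δ) ∈ graphOn f K := pair_mem_graphOn.2 ⟨hδ, rfl⟩
        exact ⟨f δ, (mem_of_pair_mem h.dom.trans (h.dom.trans.mem_trans hp hf)).2, hp⟩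
  obtain ⟨q', hqN, hq'⟩ := hmem q hq
  obtain ⟨t', htN, ht'⟩ := hmem t ht
  obtain ⟨s', hsN, hs'⟩ := hmem s hs
  have key : ∀ c, FitCore (j X) (j M) κ q' t' s' ∧ Fit c κ q' (j M) t' (j e) := fun c =>
    h.exists_of_map (n := 6) (fun M v => ∀ q, q ∈ M → ∀ t, t ∈ M → ∀ s, s ∈ M →
      ZFSet.pair (v 0) q ∈ v 1 → ZFSet.pair (v 0) t ∈ v 2 → ZFSet.pair (v 0) s ∈ v 3 →
        FitCore (v 4) (v 5) (v 0) q t s ∧ Fit c (v 0) q (v 5) t (v 6)) hK hκK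
      ![graphOn q K, graphOn t K, graphOn s K, X, M, e]
      (by simp [forall_vecCons_mem, hq, ht, hs, hX, hM, he]) (fun δ hδ q₁ _ t₁ _ s₁ _ h1 h2 h3 => by
        obtain ⟨-, rfl⟩ := pair_mem_graphOn.1 h1
        obtain ⟨-, rfl⟩ := pair_mem_graphOn.1 h2
        obtain ⟨-, rfl⟩ := pair_mem_graphOn.1 h3
        exact ⟨(hfit δ hδ).1, (hfit δ hδ).2 c⟩) q' hqN t' htN s' hsN hq' ht' hs'
  exact ⟨q', t', s', (key none).1, fun c => (key c).2⟩

/-- Collapsing a fitting submodel of `j M` yields an embedding of `M` with `κ` in the image of `X`. -/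
theorem exists_of_isFit {X M q t s : ZFSet.{0}} {f : ZFSet.{0} → ZFSet.{0}} (hκ : κ.IsOrdinal)
    (hMκ : IsKappaModel κ M) (hM : M ∈ M') (hXM : X ∈ M) (hX : X ⊆ κ)
    (hfs : ∀ x ∈ M, ∃ α ∈ κ, f α = x) (he : graphOn f κ ∈ M')
    (hfit : IsFit (j X) (j M) (j (graphOn f κ)) κ q t s) :
    ∃ N k, IsCritEmbedding κ M N k ∧ κ ∈ k X := by
  obtain ⟨hcore, hfit⟩ := hfit
  have hsub : ∀ x ∈ M, x ∈ M' := fun x hx => h.dom.trans.mem_trans hx hM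
  have hseq : SeqClosed κ M := fun β hβ k hk => hMκ.graphOn_mem hβ hk
  have hjseq := h.map_seqClosed hM hseq
  have hel := h.restrict hM
  obtain ⟨h1, h2, h3, h4, h5⟩ : FitBase κ q (j M) t (j (graphOn f κ)) := hfit none
  have hQ : IsClosedSub κ (j M) q :=
    { trans := (h.iff (n := 1) (fun _ v => (v 0).IsTransitive) ![M] (by simp [hM])).1 hMκ.trans
      zfc := hel.modelsZFCminus hMκ.zfc
      ord := hκ.isTransitive
      sub := hcore.1
      elem := fun n φ v hv => hfit (some ⟨n, φ⟩) v hv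
      seq := fun β hβ k hk => h5 β hβ _ (hjseq β hβ k fun x hx => hcore.1 (hk x hx))
        (isFunc_graphOn hk)
      subset := h4 }
  have hjq : ∀ x ∈ M, j x ∈ q := fun x hx => by
    obtain ⟨α, hα, rfl⟩ := hfs x hx
    have := (h.pair_mem_iff (h.mem_of_mem hα) (hsub _ hx) he).1 (pair_mem_graphOn.2 ⟨hα, rfl⟩)
    rw [h.map_of_mem hα] at this
    exact h1 α hα _ (hel.1 _ hx) this
  have hXκ : j X ⊆ j κ := (h.iff (n := 2) (fun _ v => v 0 ⊆ v 1) ![X, κ]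
    (by simp [forall_vecCons_mem, hsub X hXM, h.dom.self_mem])).1 hX
  have ht : collapse q t = κ := hQ.collapse_eq h3 hcore.2.2.1
  have hmap : ∀ {y}, t ∈ y → κ ∈ collapse q y := fun hy =>
    ht ▸ (hQ.collapse_mem_collapse_iff h2).2 hy
  refine ⟨myImage (collapse q) q, fun x => collapse q (j x), ⟨hMκ,
    hQ.image_isKappaModel h2 h3 hcore.2.2.1 hcore.card_le,
    ⟨fun x hx => IsClosedSub.collapse_mem (hjq x hx), fun n φ v hv => ?_⟩, fun x hx => ?_, ?_⟩, hmap hcore.2.1⟩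
  · rw [hel.2 n φ v hv, ← hQ.elem n φ _ fun i => hjq _ (hv i)]
    exact hQ.realizeIn_image_iff φ fun i => hjq _ (hv i)
  · change collapse q (j x) = x
    rw [h.map_of_mem hx, hQ.collapse_of_mem hx]
  · exact hmap (hXκ hcore.2.1)

end IsCritEmbedding

/-! ## The weakly compact trace -/

theorem IsWeaklyCompactIn.mono {γ S T : ZFSet.{0}} (hγ : γ.IsOrdinal) (hT : IsWeaklyCompactSubset γ T)
    (hTS : T ⊆ S) (hS : S ⊆ γ) : IsWeaklyCompactSubset γ S := by
  have hω := (hT.isLargeCardinal hγ).aleph0_lt.le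
  have hγH := HereditarilyLE.self hω hγ.isTransitive
  refine ⟨hS, fun A _ hA => ?_⟩
  obtain ⟨M, N, j, h, hx, hTM, hγT⟩ := hT.exists_embedding hγ
    ((hγH.subset hω hA).pair hω (hγH.subset hω hS))
  obtain ⟨hAM, hSM⟩ := mem_of_pair_mem h.dom.trans hx
  exact ⟨M, N, j, h.dom, h.cod, hAM, hSM, h.elem, h.crit,
    h.exists_of_map (n := 1) (fun _ v => v 0 ∈ v 1) hTM hγT ![S] (by simp [hSM]) fun _ hx => hTS hx⟩

/-- The ordinals in `κ` admitting a fitting submodel of `M`. -/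
noncomputable def fitSet (κ X M e : ZFSet.{0}) : ZFSet.{0} :=
  ZFSet.sep (fun δ => ∃ q t s, IsFit X M e δ q t s) κ

theorem IsWeaklyCompactIn.diff_fitSet {κ S X M : ZFSet.{0}} {f : ZFSet.{0} → ZFSet.{0}}
    (hκ : κ.IsOrdinal) (hS : IsWeaklyCompactSubset κ S) (hM : IsKappaModel κ M)
    (hXM : X ∈ M) (hX : X ⊆ κ) (hf : ∀ α ∈ κ, f α ∈ M) (hfs : ∀ x ∈ M, ∃ α ∈ κ, f α = x)
    (hA : ∀ N k, IsCritEmbedding κ M N k → ¬ κ ∈ k X) :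
    IsWeaklyCompactSubset κ (S \ fitSet κ X M (graphOn f κ)) := by
  set K := fitSet κ X M (graphOn f κ) with hKdef
  have hω := (hS.isLargeCardinal hκ).aleph0_lt.le
  have hκH := HereditarilyLE.self hω hκ.isTransitive
  have hMH := HereditarilyLE.of_isTransitive hω hM.trans hM.card_eq.le
  have hKκ : K ⊆ κ := fun x hx => (mem_sep.1 hx).1
  have hKH := hκH.subset hω hKκ
  have hdS : S \ K ⊆ S := fun x hx => (mem_sdiff.1 hx).1
  have hdH : HereditarilyLE κ (S \ K) := hκH.subset hω fun x hx => hS.1 (hdS hx)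
  choose! q t s hfit using fun δ (hδ : δ ∈ K) => (mem_sep.1 hδ).2
  have hqH := hKH.graphOn hω fun δ hδ => hMH.subset hω (hfit δ hδ).1.1
  have htH := hKH.graphOn hω fun δ hδ => hκH.mem (hX (hfit δ hδ).1.2.1)
  have hsH := hKH.graphOn hω fun δ hδ => hMH.mem (hfit δ hδ).1.2.2.2.1
  have hfH := hκH.graphOn hω fun α hα => hMH.mem (hf α hα)
  refine ⟨fun x hx => hS.1 (hdS hx), fun B _ hB => ?_⟩
  obtain ⟨M', N', j, h, hx, hSM, hκS⟩ := hS.exists_embedding hκ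
    ((hκH.subset hω hB).pair hω (hdH.pair hω (hKH.pair hω (hMH.pair hω (hfH.pair hω
      (hqH.pair hω (htH.pair hω hsH)))))))
  have htr := h.dom.trans
  obtain ⟨hBM, hx⟩ := mem_of_pair_mem htr hx
  obtain ⟨hdM, hx⟩ := mem_of_pair_mem htr hx
  obtain ⟨hKM, hx⟩ := mem_of_pair_mem htr hx
  obtain ⟨hMM, hx⟩ := mem_of_pair_mem htr hx
  obtain ⟨hfM, hx⟩ := mem_of_pair_mem htr hx
  obtain ⟨hqM, hx⟩ := mem_of_pair_mem htr hx
  obtain ⟨htM, hsM⟩ := mem_of_pair_mem htr hx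
  have hsplit : κ ∈ j (S \ K) ∨ κ ∈ j K :=
    h.exists_of_map (n := 2) (fun _ v => v 0 ∈ v 1 ∨ v 0 ∈ v 2) hSM hκS ![S \ K, K]
      (by simp [forall_vecCons_mem, hdM, hKM]) fun x hx => by
        by_cases hxK : x ∈ K
        · exact Or.inr hxK
        · exact Or.inl (mem_sdiff.2 ⟨hx, hxK⟩)
  rcases hsplit with hκT | hκK
  · exact ⟨M', N', j, h.dom, h.cod, hBM, hdM, h.elem, h.crit, hκT⟩
  · obtain ⟨q', t', s', hfit'⟩ :=
      h.exists_isFit (htr.mem_trans hXM hMM) hMM hfM hKM hκK hqM htM hsM hfit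
    obtain ⟨N, k, hk, hκk⟩ := h.exists_of_isFit hκ hM hMM hXM hX hfs hfM hfit'
    exact absurd hκk (hA N k hk)

theorem not_isWeaklyCompactSubset_diff_fitSet {κ S X M γ : ZFSet.{0}} {f : ZFSet.{0} → ZFSet.{0}}
    (hκ : κ.IsOrdinal) (hM : IsKappaModel κ M) (hf : ∀ α ∈ κ, f α ∈ M) (hγκ : γ ∈ κ) (hγX : γ ∈ X) :
    ¬ IsWeaklyCompactSubset γ ((S \ fitSet κ X M (graphOn f κ)) ∩ γ) := by
  intro hT
  have hγ := hκ.mem hγκ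
  have hL := hT.isLargeCardinal hγ
  have hω := hL.aleph0_lt.le
  have hγs : ∀ x ∈ γ, x ∈ κ := fun x hx => hκ.isTransitive.mem_trans hx hγκ
  have hseq : SeqClosed γ M := fun β hβ k hk => hM.graphOn_mem (hγs β hβ) hk
  have hγM : γ ∈ M := hM.subset hγκ
  obtain ⟨Q, hQ, hYQ, hQc⟩ := hL.exists_isClosedSub hM.trans hM.zfc hseq
    (Y := insert γ (γ ∪ myImage f γ)) (fun x hx => by
      simp only [mem_insert_iff, mem_union, mem_myImage] at hx
      rcases hx with rfl | hx | ⟨y, hy, rfl⟩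
      · exact hγM
      · exact hM.subset (hγs x hx)
      · exact hf y (hγs y hy)) (fun x hx => by simp [hx])
    (card_insert_le.trans (Cardinal.add_le_of_le hω
      ((card_union_le).trans (Cardinal.add_le_of_le hω le_rfl (card_myImage_le _ _)))
      (Cardinal.one_le_aleph0.trans hω)))
  have hγQ : γ ∈ Q := hYQ (mem_insert _ _)
  have hfQ : ∀ α ∈ γ, f α ∈ Q := fun α hα => hYQ (by
    simp only [mem_insert_iff, mem_union, mem_myImage]
    exact Or.inr (Or.inr ⟨α, hα, rfl⟩))
  obtain ⟨u, hu, hus⟩ := exists_surj_of_card_le hQc ⟨γ, hγQ⟩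
  have hπγ : collapse Q γ = γ := hQ.collapse_eq (fun _ _ hx => hx) (fun _ hx => hx)
  have hcm : ∀ {x}, x ∈ Q → collapse Q x ∈ myImage (collapse Q) Q := IsClosedSub.collapse_mem
  obtain ⟨δ, hδ, hfit⟩ := hT.exists_fit (f := fun α => collapse Q (u α))
    (g := fun α => collapse Q (f α)) hγ IsClosedSub.image_isTransitive hQ.image_seqClosed
    (hπγ ▸ hcm hγQ) ((card_myImage_le _ _).trans hQc) (fun α hα => hcm (hu α hα))
    (fun x hx => by
      obtain ⟨y, hy, rfl⟩ := mem_myImage.1 hx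
      obtain ⟨α, hα, rfl⟩ := hus y hy
      exact ⟨α, hα, rfl⟩) (fun α hα => hcm (hfQ α hα))
  obtain ⟨hδ, hδγ⟩ := mem_inter.1 hδ
  have hδs : ∀ x ∈ δ, x ∈ γ := fun x hx => hγ.isTransitive.mem_trans hx hδγ
  refine (mem_sdiff.1 hδ).2 (mem_sep.2 ⟨hγs δ hδγ, myImage u δ, γ, graphOn u δ,
    ⟨?_, hγX, hδs, ?_, ?_⟩, fun c => ?_⟩)
  · intro x hx
    obtain ⟨y, hy, rfl⟩ := mem_myImage.1 hx
    exact hQ.sub (hu y (hδs y hy))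
  · exact hseq δ hδγ u fun x hx => hQ.sub (hu x (hδs x hx))
  · intro x hx
    obtain ⟨α, hα, rfl⟩ := mem_myImage.1 hx
    exact ⟨α, hα, pair_mem_graphOn.2 ⟨hα, rfl⟩, fun y _ hy => (pair_mem_graphOn.1 hy).2⟩
  · refine hQ.fit_of_collapse hfQ hδγ (fun x hx => ?_) hγQ
      (fun α _ x hx => (pair_mem_graphOn.1 hx).2) rfl c ?_
    · obtain ⟨y, hy, rfl⟩ := mem_myImage.1 hx
      exact hu y (hδs y hy)
    · rw [hπγ]
      convert hfit c using 1
      ext x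
      simp [mem_myImage]

theorem ReflWcIn.isWeaklyCompactIn_wcTraceIn {κ S : ZFSet.{0}} (h : ReflWcIn Set.univ κ)
    (hS : IsWeaklyCompactSubset κ S) : IsWeaklyCompactSubset κ (wcTraceIn Set.univ κ S) := by
  have hκ : κ.IsOrdinal := h.1.1.1
  have hω := (hS.isLargeCardinal hκ).aleph0_lt.le
  have hκH := HereditarilyLE.self hω hκ.isTransitive
  set X := wcTraceIn Set.univ κ S with hXdef
  have hX : X ⊆ κ := fun x hx => (mem_sep.1 hx).1
  refine ⟨hX, fun A _ hA => ?_⟩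
  by_contra hcon
  obtain ⟨M, _, _, h₀, hx, -, -⟩ := hS.exists_embedding hκ
    ((hκH.subset hω hA).pair hω (hκH.subset hω hX))
  obtain ⟨hAM, hXM⟩ := mem_of_pair_mem h₀.dom.trans hx
  obtain ⟨f, hf, hfs⟩ := exists_surj_of_card_le h₀.dom.card_eq.le ⟨κ, h₀.dom.self_mem⟩
  obtain ⟨γ, hγ, hT⟩ := h.2 _ (Set.mem_univ _) (hS.diff_fitSet hκ h₀.dom hXM hX hf hfs
    fun N k hk hκk => hcon ⟨M, N, k, hk.dom, hk.cod, hAM, hXM, hk.elem, hk.crit, hκk⟩)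
  have hγX : γ ∈ X := mem_sep.2 ⟨hγ, hT.mono (hκ.mem hγ) (fun x hx => by
    obtain ⟨h1, h2⟩ := mem_inter.1 hx
    exact mem_inter.2 ⟨(mem_sdiff.1 h1).1, h2⟩) fun x hx => (mem_inter.1 hx).2⟩
  exact not_isWeaklyCompactSubset_diff_fitSet hκ h₀.dom hf hγ hγX hT

/-- The weakly compact reflection principle `Refl_wc(κ)` implies that `κ`
is `ω`-weakly compact. -/
theorem reflWc_implies_omega_weakly_compact (κ : ZFSet)
    (h : ReflWcIn Set.univ κ) :
    IsOmegaWeaklyCompactIn Set.univ κ := by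
  intro n
  induction n with
  | zero => exact h.1.2.2
  | succ n ih => exact h.isWeaklyCompactIn_wcTraceIn ih
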